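/- Let c be a fixed real number with 1 < c < 8/7. Then for every ε > 0, for all sufficiently large primes p, there exists a positive integer n with n ≤ p^{1/(4(2−c)√e) + ε} such that ⌊n^c⌋ is a quadratic non-residue modulo p (i.e., N_c(p) ≤ p^{1/(4(2−c)√e) + ε}). -/

import Mathlib

open Polynomial in
theorem natDegree_lt_of_mem_degreeLT {R : Type*} [CommRing R] {n : ℕ} (hn : 0 < n) {r : R[X]}
    (hr : r ∈ degreeLT R n) : r.natDegree < n := by
  by_cases h : r = 0
  · simpa [h] using hn
  · exact (natDegree_lt_iff_degree_lt h).2 (mem_degreeLT.1 hr)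

open Polynomial in
theorem stepanov_base {p : ℕ} [Fact p.Prime] {f : (ZMod p)[X]} (hf0 : f.eval 0 ≠ 0)
    {u : ZMod p} (hu : Odd (f.rootMultiplicity u)) {n : ℕ} (hn : 2 * n + f.natDegree ≤ p)
    {r s : (ZMod p)[X]} (hr : r ∈ degreeLT (ZMod p) n) (hs : s ∈ degreeLT (ZMod p) n)
    (hdvd : X ^ p ∣ f * r ^ 2 - C (f.eval 0) * s ^ 2) : r = 0 ∧ s = 0 := by
  have hp0 := (Fact.out : p.Prime).pos
  have hfne : f ≠ 0 := by rintro rfl; simp at hf0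
  have hz : f * r ^ 2 - C (f.eval 0) * s ^ 2 = 0 := by
    refine eq_zero_of_dvd_of_natDegree_lt hdvd ?_
    rw [natDegree_X_pow]
    rcases Nat.eq_zero_or_pos n with rfl | hn0
    · have hr0 : r = 0 := by simpa [mem_degreeLT] using hr
      have hs0 : s = 0 := by simpa [mem_degreeLT] using hs
      simp [hr0, hs0, hp0]
    have hr' : r.natDegree < n := natDegree_lt_of_mem_degreeLT hn0 hr
    have hs' : s.natDegree < n := natDegree_lt_of_mem_degreeLT hn0 hs
    refine (natDegree_sub_le _ _).trans_lt (max_lt ?_ ?_)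
    · refine natDegree_mul_le.trans_lt ?_
      have := natDegree_pow_le (p := r) (n := 2)
      omega
    · refine natDegree_mul_le.trans_lt ?_
      have := natDegree_pow_le (p := s) (n := 2)
      rw [natDegree_C]
      omega
  rw [sub_eq_zero] at hz
  have hC : C (f.eval 0) ≠ 0 := by simpa using hf0
  by_cases hr0 : r = 0
  · subst hr0
    refine ⟨rfl, ?_⟩
    have : C (f.eval 0) * s ^ 2 = 0 := by rw [← hz]; simp
    simpa [hC, hf0] using this
  · exfalso
    have hs0 : s ≠ 0 := by
      rintro rfl
      have : f * r ^ 2 = 0 := by rw [hz]; simp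
      simp [hfne, hr0] at this
    have h1 := congrArg (rootMultiplicity u) hz
    rw [rootMultiplicity_mul (mul_ne_zero hfne (pow_ne_zero _ hr0)),
      rootMultiplicity_mul (mul_ne_zero hC (pow_ne_zero _ hs0)), rootMultiplicity_C, pow_two, pow_two,
      rootMultiplicity_mul (mul_ne_zero hr0 hr0), rootMultiplicity_mul (mul_ne_zero hs0 hs0)] at h1
    rcases hu with ⟨k, hk⟩
    omega

open Polynomial in
theorem stepanov_nonvanishing {p : ℕ} [Fact p.Prime] (hp2 : p ≠ 2) {f : (ZMod p)[X]}
    (hf0 : f.eval 0 ≠ 0) {u : ZMod p} (hu : Odd (f.rootMultiplicity u)) {n : ℕ}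
    (hn : 2 * n + f.natDegree ≤ p) (J : ℕ) :
    ∀ (r s : ℕ → (ZMod p)[X]), (∀ j, r j ∈ degreeLT (ZMod p) n) →
      (∀ j, s j ∈ degreeLT (ZMod p) n) →
      ∑ j ∈ Finset.range J, (r j + s j * f ^ ((p - 1) / 2)) * X ^ (j * p) = 0 →
      ∀ j < J, r j = 0 ∧ s j = 0 := by
  induction J with
  | zero => intro r s _ _ _ j hj; omega
  | succ J ih =>
    intro r s hr hs hsum
    have hodd : 1 + (p - 1) / 2 * 2 = p := by
      have := (Fact.out : p.Prime).eq_two_or_odd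
      omega
    set g := f ^ ((p - 1) / 2) with hg
    have hfg : f * g ^ 2 = expand (ZMod p) p f := by
      rw [ZMod.expand_card, hg, ← pow_mul, ← pow_succ']
      congr 1; omega
    have hexp : X ^ p ∣ expand (ZMod p) p f - C (f.eval 0) := by
      have h1 : X ∣ f - C (f.eval 0) := by rw [X_dvd_iff]; simp [coeff_zero_eq_eval_zero]
      obtain ⟨q, hq⟩ := h1
      refine ⟨expand (ZMod p) p q, ?_⟩
      have := congrArg (expand (ZMod p) p) hq
      simpa using this
    set R := ∑ j ∈ Finset.range J, r (j + 1) * X ^ (j * p) with hR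
    set S := ∑ j ∈ Finset.range J, s (j + 1) * X ^ (j * p) with hS
    have hsum' : (r 0 + X ^ p * R) + g * (s 0 + X ^ p * S) = 0 := by
      rw [← hsum, Finset.sum_range_succ', hR, hS, Finset.mul_sum, Finset.mul_sum]
      have : ∀ j ∈ Finset.range J, (r (j + 1) + s (j + 1) * g) * X ^ ((j + 1) * p) =
          X ^ p * (r (j + 1) * X ^ (j * p)) + g * (X ^ p * (s (j + 1) * X ^ (j * p))) := by
        intro j _; rw [add_mul j 1, one_mul, pow_add]; ring
      rw [Finset.sum_congr rfl this, Finset.sum_add_distrib, ← Finset.mul_sum (a := g)]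
      simp
      ring
    have key : r 0 = 0 ∧ s 0 = 0 := by
      refine stepanov_base hf0 hu hn (hr 0) (hs 0) ?_
      obtain ⟨q, hq⟩ := hexp
      have h2 : f * (r 0 + X ^ p * R) ^ 2 = (C (f.eval 0) + X ^ p * q) * (s 0 + X ^ p * S) ^ 2 := by
        rw [← hq, add_sub_cancel, ← hfg, eq_neg_of_add_eq_zero_left hsum']; ring
      refine ⟨q * (s 0 + X ^ p * S) ^ 2 + C (f.eval 0) * (2 * s 0 * S + X ^ p * S ^ 2)
        - f * (2 * r 0 * R + X ^ p * R ^ 2), ?_⟩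
      linear_combination h2
    intro j hj
    rcases j with _ | j
    · exact key
    · refine ih (fun j => r (j + 1)) (fun j => s (j + 1)) (fun j => hr _) (fun j => hs _) ?_ j
        (by omega)
      have h3 : X ^ p * (R + g * S) = 0 := by
        rw [key.1, key.2] at hsum'; linear_combination hsum'
      have h4 : R + g * S = 0 := by
        simpa using (mul_eq_zero.1 h3).resolve_left (by simp)
      rw [← h4, hR, hS, Finset.mul_sum, ← Finset.sum_add_distrib]
      exact Finset.sum_congr rfl fun j _ => by ring

open Polynomial in
/-- The linear operator describing `k` derivatives of `f ^ e * r` after removing `f ^ (e - k)`. -/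
noncomputable def stepanovOp {R : Type*} [CommRing R] (f : R[X]) (e : ℕ) : ℕ → R[X] →ₗ[R] R[X]
  | 0 => LinearMap.id
  | k + 1 => (LinearMap.mulLeft R (C ((e - k : ℕ) : R) * derivative f) +
      LinearMap.mulLeft R f ∘ₗ derivative) ∘ₗ stepanovOp f e k

open Polynomial in
theorem iterate_derivative_pow_mul_eq_stepanovOp {R : Type*} [CommRing R] (f r : R[X]) (e : ℕ) {k : ℕ}
    (hk : k ≤ e) : derivative^[k] (f ^ e * r) = f ^ (e - k) * stepanovOp f e k r := by
  induction k with
  | zero => simp [stepanovOp]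
  | succ k ih =>
    rw [Function.iterate_succ_apply', ih (by omega), stepanovOp]
    obtain ⟨d, hd⟩ : ∃ d, e - k = d + 1 := ⟨e - k - 1, by omega⟩
    have hd' : e - (k + 1) = d := by omega
    rw [hd, hd']
    simp only [derivative_mul, derivative_pow, LinearMap.comp_apply, LinearMap.add_apply,
      LinearMap.mulLeft_apply]
    simp only [Nat.add_sub_cancel]
    ring

open Polynomial in
theorem natDegree_stepanovOp_le {R : Type*} [CommRing R] (f r : R[X]) (e k : ℕ) :
    (stepanovOp f e k r).natDegree ≤ r.natDegree + k * f.natDegree := by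
  induction k with
  | zero => simp [stepanovOp]
  | succ k ih =>
    rw [stepanovOp]
    simp only [LinearMap.comp_apply, LinearMap.add_apply, LinearMap.mulLeft_apply]
    refine (natDegree_add_le _ _).trans (max_le ?_ ?_)
    · refine natDegree_mul_le.trans ?_
      have h1 := natDegree_C_mul_le ((e - k : ℕ) : R) (derivative f)
      have h2 := natDegree_derivative_le f
      have : (k + 1) * f.natDegree = k * f.natDegree + f.natDegree := by ring
      omega
    · refine natDegree_mul_le.trans ?_
      have h2 := natDegree_derivative_le (stepanovOp f e k r)
      have : (k + 1) * f.natDegree = k * f.natDegree + f.natDegree := by ring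
      omega

open Polynomial in
theorem iterate_derivative_mul_X_pow_char {p : ℕ} [Fact p.Prime] (g : (ZMod p)[X]) (j k : ℕ) :
    derivative^[k] (g * X ^ (j * p)) = derivative^[k] g * X ^ (j * p) := by
  induction k with
  | zero => rfl
  | succ k ih =>
    rw [Function.iterate_succ_apply', ih, Function.iterate_succ_apply', derivative_mul]
    have : derivative (X ^ (j * p) : (ZMod p)[X]) = 0 := by rw [derivative_X_pow]; simp
    rw [this, mul_zero, add_zero]

open Polynomial in
theorem card_mul_le_natDegree_of_iterate_derivative {p : ℕ} [Fact p.Prime] {R : (ZMod p)[X]}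
    (hR : R ≠ 0) (S : Finset (ZMod p)) {l : ℕ} (hl : l ≤ p)
    (h : ∀ x ∈ S, ∀ k < l, (derivative^[k] R).eval x = 0) : S.card * l ≤ R.natDegree := by
  rcases Nat.eq_zero_or_pos l with rfl | hl0
  · simp
  have h1 : ∀ x ∈ S, l ≤ R.roots.count x := by
    intro x hx
    rw [count_roots]
    have := lt_rootMultiplicity_of_isRoot_iterate_derivative_of_mem_nonZeroDivisors' (n := l - 1)
      (t := x) hR (fun m hm => h x hx m (by omega)) (fun m hm hm0 => by
        refine mem_nonZeroDivisors_of_ne_zero ?_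
        rw [Ne, ZMod.natCast_eq_zero_iff]
        exact Nat.not_dvd_of_pos_of_lt (by omega) (by omega))
    omega
  calc S.card * l = ∑ x ∈ S, l := by simp
    _ ≤ ∑ x ∈ S, R.roots.count x := Finset.sum_le_sum h1
    _ ≤ ∑ x ∈ S ∪ R.roots.toFinset, R.roots.count x :=
        Finset.sum_le_sum_of_subset Finset.subset_union_left
    _ = R.roots.card := Multiset.sum_count_eq_card fun a ha => by simp at ha ⊢; tauto
    _ ≤ R.natDegree := card_roots' R

open Polynomial in
theorem stepanov_card_le {p : ℕ} [Fact p.Prime] (hp2 : p ≠ 2) {f : (ZMod p)[X]}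
    (hf0 : f.eval 0 ≠ 0) {u : ZMod p} (hu : Odd (f.rootMultiplicity u)) {n J l : ℕ}
    (hn : 2 * n + f.natDegree ≤ p) (hl : l ≤ p)
    (hdim : l * (n + l * f.natDegree + J) < 2 * J * n) (a : ZMod p) :
    (Finset.univ.filter fun x : ZMod p => f.eval x ^ ((p - 1) / 2) = a).card * l ≤
      l * f.natDegree + n + f.natDegree * ((p - 1) / 2) + J * p := by
  classical
  set m := f.natDegree with hm
  set M := n + l * m + J with hM
  set e := l + (p - 1) / 2 with he
  have hn0 : 0 < n := by
    rcases Nat.eq_zero_or_pos n with h | h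
    · simp [h] at hdim
    · exact h
  have hfne : f ≠ 0 := by rintro rfl; simp at hf0
  let V := (Fin J → degreeLT (ZMod p) n) × (Fin J → degreeLT (ZMod p) n)
  let sig : ℕ → V →ₗ[(ZMod p)] (ZMod p)[X] := fun k => ∑ j : Fin J, LinearMap.mulRight (ZMod p) (X ^ (j : ℕ) : (ZMod p)[X]) ∘ₗ
    (stepanovOp f l k ∘ₗ (degreeLT (ZMod p) n).subtype ∘ₗ LinearMap.proj j ∘ₗ LinearMap.fst (ZMod p) _ _ +
      a • (stepanovOp f e k ∘ₗ (degreeLT (ZMod p) n).subtype ∘ₗ LinearMap.proj j ∘ₗ LinearMap.snd (ZMod p) _ _))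
  have sig_apply : ∀ k (v : V), sig k v = ∑ j : Fin J,
      (stepanovOp f l k (v.1 j : (ZMod p)[X]) + a • stepanovOp f e k (v.2 j : (ZMod p)[X])) * X ^ (j : ℕ) := by
    intro k v
    simp [sig]
    rfl
  let Φ : V →ₗ[(ZMod p)] (Fin l × Fin M → (ZMod p)) := LinearMap.pi fun ki => lcoeff (ZMod p) (ki.2 : ℕ) ∘ₗ sig ki.1
  have hfin : Module.finrank (ZMod p) (Fin l × Fin M → (ZMod p)) < Module.finrank (ZMod p) V := by
    have h1 : Module.finrank (ZMod p) (degreeLT (ZMod p) n) = n := by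
      rw [(degreeLTEquiv (ZMod p) n).finrank_eq]; simp
    have h2 : Module.finrank (ZMod p) V = J * n + J * n := by
      simp only [V]
      rw [Module.finrank_prod, Module.finrank_pi_fintype]
      simp [h1]
    rw [h2]
    simp only [Module.finrank_fintype_fun_eq_card, Fintype.card_prod, Fintype.card_fin]
    calc l * M < 2 * J * n := hdim
      _ = J * n + J * n := by ring
  have : FiniteDimensional (ZMod p) (degreeLT (ZMod p) n) := (degreeLTEquiv (ZMod p) n).symm.finiteDimensional
  obtain ⟨v, hv, hv0⟩ := Submodule.exists_mem_ne_zero_of_ne_bot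
    (LinearMap.ker_ne_bot_of_finrank_lt (f := Φ) hfin)
  have hdegop : ∀ (e' k : ℕ) (w : degreeLT (ZMod p) n), k < l →
      (stepanovOp f e' k (w : (ZMod p)[X])).natDegree < n + l * m := by
    intro e' k w hk
    have h1 := natDegree_stepanovOp_le f (w : (ZMod p)[X]) e' k
    have h2 := natDegree_lt_of_mem_degreeLT hn0 w.2
    have h3 : k * f.natDegree ≤ l * m := Nat.mul_le_mul_right _ hk.le
    omega
  have hsig : ∀ k < l, sig k v = 0 := by
    intro k hk
    ext i
    by_cases hi : i < M
    · have := congrFun (LinearMap.mem_ker.1 hv) (⟨k, hk⟩, ⟨i, hi⟩)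
      simpa [Φ] using this
    · rw [coeff_zero, sig_apply, finsetSum_coeff]
      refine Finset.sum_eq_zero fun j _ => coeff_eq_zero_of_natDegree_lt ?_
      refine natDegree_mul_le.trans_lt ?_
      have h1 := hdegop l k (v.1 j) hk
      have h2 := (natDegree_smul_le a (stepanovOp f e k (v.2 j : (ZMod p)[X]))).trans_lt
        (hdegop e k (v.2 j) hk)
      have h3 := natDegree_add_le (stepanovOp f l k (v.1 j : (ZMod p)[X]))
        (a • stepanovOp f e k (v.2 j : (ZMod p)[X]))
      have h4 := natDegree_X_pow_le (R := ZMod p) (j : ℕ)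
      have := j.2
      omega
  set g := f ^ ((p - 1) / 2) with hg
  let P : (ZMod p)[X] := ∑ j : Fin J, ((v.1 j : (ZMod p)[X]) + (v.2 j : (ZMod p)[X]) * g) * X ^ ((j : ℕ) * p)
  have hP : P ≠ 0 := by
    intro hP0
    apply hv0
    let r : ℕ → (ZMod p)[X] := fun j => if h : j < J then (v.1 ⟨j, h⟩ : (ZMod p)[X]) else 0
    let s : ℕ → (ZMod p)[X] := fun j => if h : j < J then (v.2 ⟨j, h⟩ : (ZMod p)[X]) else 0
    have := stepanov_nonvanishing hp2 hf0 hu hn J r s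
      (fun j => by by_cases h : j < J <;> simp [r, h])
      (fun j => by by_cases h : j < J <;> simp [s, h])
      (by
        rw [← Fin.sum_univ_eq_sum_range (fun j => (r j + s j * f ^ ((p - 1) / 2)) * X ^ (j * p)) J]
        rw [← hP0]
        exact Finset.sum_congr rfl fun j _ => by simp [r, s, g])
    refine Prod.ext (funext fun j => Subtype.ext ?_) (funext fun j => Subtype.ext ?_)
    · simpa [r] using (this j j.2).1
    · simpa [s] using (this j j.2).2
  have hR : f ^ l * P ≠ 0 := mul_ne_zero (pow_ne_zero _ hfne) hP
  have hRsum : f ^ l * P = ∑ j : Fin J, (f ^ l * (v.1 j : (ZMod p)[X]) + f ^ e * (v.2 j : (ZMod p)[X])) *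
      X ^ ((j : ℕ) * p) := by
    simp only [P, Finset.mul_sum]
    refine Finset.sum_congr rfl fun j _ => ?_
    rw [he, pow_add, hg]; ring
  refine (card_mul_le_natDegree_of_iterate_derivative hR _ hl ?_).trans ?_
  · intro x hx k hk
    simp only [Finset.mem_filter, Finset.mem_univ, true_and] at hx
    rw [hRsum, iterate_derivative_sum]
    simp only [iterate_derivative_mul_X_pow_char, iterate_map_add]
    have h1 := congrArg (eval x) (hsig k hk)
    rw [sig_apply, eval_finsetSum, eval_zero] at h1
    rw [eval_finsetSum]
    calc _ = ∑ j : Fin J, f.eval x ^ (l - k) * eval x ((stepanovOp f l k (v.1 j : (ZMod p)[X]) +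
            a • stepanovOp f e k (v.2 j : (ZMod p)[X])) * X ^ (j : ℕ)) := by
          refine Finset.sum_congr rfl fun j _ => ?_
          rw [iterate_derivative_pow_mul_eq_stepanovOp _ _ _ hk.le,
            iterate_derivative_pow_mul_eq_stepanovOp _ _ _ (by omega : k ≤ e)]
          have h2 : e - k = (l - k) + (p - 1) / 2 := by omega
          have h3 : x ^ ((j : ℕ) * p) = x ^ (j : ℕ) := by rw [pow_mul, ZMod.pow_card]
          simp only [eval_mul, eval_add, eval_pow, eval_X, eval_smul, smul_eq_mul, h2, pow_add, hx,
            h3]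
          ring
      _ = 0 := by rw [← Finset.mul_sum, h1, mul_zero]
  · refine natDegree_mul_le.trans ?_
    have h1 : (f ^ l).natDegree ≤ l * m := natDegree_pow_le
    have h2 : P.natDegree ≤ n + m * ((p - 1) / 2) + J * p := by
      refine natDegree_sum_le_of_forall_le _ _ fun j _ => ?_
      refine natDegree_mul_le.trans ?_
      have h3 := natDegree_lt_of_mem_degreeLT hn0 (v.1 j).2
      have h4 := natDegree_lt_of_mem_degreeLT hn0 (v.2 j).2
      have h5 : g.natDegree ≤ (p - 1) / 2 * m := natDegree_pow_le
      have h6 := natDegree_mul_le (p := (v.2 j : (ZMod p)[X])) (q := g)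
      have h7 := natDegree_add_le (v.1 j : (ZMod p)[X]) ((v.2 j : (ZMod p)[X]) * g)
      have h8 := natDegree_X_pow_le (R := ZMod p) ((j : ℕ) * p)
      have h9 : (j : ℕ) * p ≤ J * p := Nat.mul_le_mul_right _ j.2.le
      rw [mul_comm m]
      omega
    omega

theorem card_le_half_add_sqrt_of_stepanov {p m n J l N : ℕ} (hp : 16 * (m + 1) ^ 2 ≤ p)
    (hl : l = Nat.sqrt p) (hJ : J = l / 2 + 2 * m + 4) (hn : n = (p - m) / 2)
    (h : N * l ≤ l * m + n + m * ((p - 1) / 2) + J * p) :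
    (N : ℝ) ≤ p / 2 + (6 * m + 9) * √p := by
  have hl0 : 4 * (m + 1) ≤ l := by
    rw [hl, Nat.le_sqrt]; nlinarith
  have h1 : (n : ℝ) ≤ p / 2 := by
    have : 2 * n ≤ p := by omega
    have : (2 * n : ℝ) ≤ p := by exact_mod_cast this
    linarith
  have h2 : (((p - 1) / 2 : ℕ) : ℝ) ≤ p / 2 := by
    have : 2 * ((p - 1) / 2) ≤ p := by omega
    have : (2 * ((p - 1) / 2 : ℕ) : ℝ) ≤ p := by exact_mod_cast this
    linarith
  have h3 : (J : ℝ) ≤ l / 2 + 2 * m + 4 := by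
    have : 2 * J ≤ l + 4 * m + 8 := by omega
    have : (2 * J : ℝ) ≤ l + 4 * m + 8 := by exact_mod_cast this
    linarith
  have hpos : (0 : ℝ) < l := by exact_mod_cast (by omega : 0 < l)
  have h4 : √(p : ℝ) ≤ 2 * l := by
    rw [Real.sqrt_le_left (by positivity)]
    have : p < (l + 1) * (l + 1) := by rw [hl]; exact Nat.lt_succ_sqrt p
    have : (p : ℝ) < (l + 1) * (l + 1) := by exact_mod_cast this
    have : (1 : ℝ) ≤ l := by exact_mod_cast (by omega : 1 ≤ l)
    nlinarith
  have hs : √(p : ℝ) * √p = p := Real.mul_self_sqrt (by positivity)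
  have hs0 : 0 ≤ √(p : ℝ) := Real.sqrt_nonneg _
  have hp1 : (16 : ℝ) * (m + 1) ^ 2 ≤ p := by exact_mod_cast hp
  have hsm : (4 : ℝ) * (m + 1) ≤ √p := by
    apply Real.le_sqrt_of_sq_le; nlinarith
  have hR : (N : ℝ) * l ≤ l * m + n + m * ((p - 1) / 2 : ℕ) + J * p := by exact_mod_cast h
  have hm0 : (0 : ℝ) ≤ m := by positivity
  have h5 : (N : ℝ) * l ≤ (p / 2 + (6 * m + 9) * √p) * l := by
    have e1 : (m : ℝ) * ((p - 1) / 2 : ℕ) ≤ m * (p / 2) := by gcongr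
    have e2 : (J : ℝ) * p ≤ (l / 2 + 2 * m + 4) * p := by gcongr
    have e3 : (p : ℝ) ≤ √p * (2 * l) := by
      calc (p : ℝ) = √p * √p := hs.symm
        _ ≤ _ := by gcongr
    have e4 : (5 / 2 * m + 9 / 2 : ℝ) * p ≤ (5 / 2 * m + 9 / 2) * (√p * (2 * l)) := by gcongr
    have e5 : (l : ℝ) * m ≤ l * m * √p := by
      have : (1 : ℝ) ≤ √p := by nlinarith
      have : (0 : ℝ) ≤ l * m := by positivity
      nlinarith
    nlinarith
  exact le_of_mul_le_mul_right h5 hpos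

theorem stepanov_dimension_lt {p m m' n J l : ℕ} (hp : 16 * (m + 1) ^ 2 ≤ p) (hm : m' ≤ m)
    (hl : l = Nat.sqrt p) (hJ : J = l / 2 + 2 * m + 4) (hn : n = (p - m) / 2) :
    l * (n + l * m' + J) < 2 * J * n := by
  have hl0 : 4 * (m + 1) ≤ l := by
    rw [hl, Nat.le_sqrt]; nlinarith
  have hll : l * l ≤ p := by rw [hl]; exact Nat.sqrt_le p
  have h1 : p ≤ 2 * n + m + 1 := by omega
  have h2 : l + 4 * m + 7 ≤ 2 * J := by omega
  have h3 : 2 * J ≤ l + 4 * m + 8 := by omega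
  have h4 : l * (n + l * m' + J) ≤ l * (n + l * m + J) := by gcongr
  refine h4.trans_lt ?_
  have h5 : (l + 4 * m + 7) * n ≤ 2 * J * n := by gcongr
  have h6 : l * (2 * J) ≤ l * (l + 4 * m + 8) := by gcongr
  have h7 : l * l * m ≤ p * m := by gcongr
  have h8 : l * (4 * (m + 1)) ≤ l * l := by gcongr
  have h9 : (4 * m + 7) * p ≤ (4 * m + 7) * (2 * n + m + 1) := by gcongr
  zify at *
  nlinarith

open Polynomial in
theorem abs_sum_quadraticChar_le_of_eval_zero_ne {p m : ℕ} [Fact p.Prime] (hp : 16 * (m + 1) ^ 2 ≤ p)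
    {f : (ZMod p)[X]} (hdeg : f.natDegree ≤ m) (hf0 : f.eval 0 ≠ 0) {u : ZMod p}
    (hu : Odd (f.rootMultiplicity u)) :
    |∑ x : ZMod p, (quadraticChar (ZMod p) (f.eval x) : ℝ)| ≤ (13 * m + 18) * √p := by
  have hp2 : p ≠ 2 := by rintro rfl; nlinarith
  have hfne : f ≠ 0 := by rintro rfl; simp at hf0
  set l := Nat.sqrt p with hl
  obtain ⟨J, hJ⟩ : ∃ J, J = l / 2 + 2 * m + 4 := ⟨_, rfl⟩
  obtain ⟨n, hn⟩ : ∃ n, n = (p - m) / 2 := ⟨_, rfl⟩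
  have hmp : m ≤ p := by nlinarith
  have hcount : ∀ a : ZMod p,
      ((Finset.univ.filter fun x : ZMod p => f.eval x ^ ((p - 1) / 2) = a).card : ℝ) ≤
        p / 2 + (6 * m + 9) * √p := by
    intro a
    refine card_le_half_add_sqrt_of_stepanov hp hl hJ hn ?_
    refine (stepanov_card_le hp2 hf0 hu (n := n) (J := J) (l := l) (by omega) (Nat.sqrt_le_self p)
      (stepanov_dimension_lt hp hdeg hl hJ hn) a).trans ?_
    gcongr
  have hpow : ∀ x : ZMod p, ((quadraticChar (ZMod p) (f.eval x) : ℤ) : ZMod p) =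
      f.eval x ^ ((p - 1) / 2) := by
    intro x
    rw [quadraticChar_eq_pow_of_char_ne_two' (by rwa [ZMod.ringChar_zmod_n]), ZMod.card]
    congr 1
    have := (Fact.out : p.Prime).eq_two_or_odd
    omega
  set N : ℤ → Finset (ZMod p) := fun b =>
    Finset.univ.filter fun x : ZMod p => quadraticChar (ZMod p) (f.eval x) = b with hN
  have hle : ∀ b : ℤ, ((N b).card : ℝ) ≤ p / 2 + (6 * m + 9) * √p := by
    intro b
    refine le_trans ?_ (hcount (b : ZMod p))
    exact_mod_cast Finset.card_le_card fun x hx => by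
      simp only [hN, Finset.mem_filter, Finset.mem_univ, true_and] at hx ⊢
      rw [← hpow, hx]
  have hN0 : ((N 0).card : ℝ) ≤ m := by
    have : (N 0).card ≤ f.natDegree := by
      refine le_trans (Finset.card_le_card fun x hx => ?_) (f.roots.toFinset_card_le.trans (card_roots' f))
      simp only [hN, Finset.mem_filter, Finset.mem_univ, true_and, quadraticChar_eq_zero_iff] at hx
      simp [hfne, hx]
    exact_mod_cast this.trans hdeg
  have htri : ∀ x : ZMod p, (quadraticChar (ZMod p) (f.eval x) = 0) ∨
      (quadraticChar (ZMod p) (f.eval x) = 1) ∨ (quadraticChar (ZMod p) (f.eval x) = -1) := by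
    intro x
    by_cases h : f.eval x = 0
    · left; simp [h]
    · right; exact quadraticChar_dichotomy h
  have hcard : ∀ b, ((N b).card : ℝ) = ∑ x : ZMod p, if quadraticChar (ZMod p) (f.eval x) = b then 1 else 0 := by
    intro b; simp [hN]
  have htot : ((N 0).card : ℝ) + (N 1).card + (N (-1)).card = p := by
    rw [hcard, hcard, hcard, ← Finset.sum_add_distrib, ← Finset.sum_add_distrib]
    rw [Finset.sum_congr rfl (g := fun _ => (1 : ℝ)) fun x _ => by
      rcases htri x with h | h | h <;> rw [h] <;> norm_num]
    simp [ZMod.card]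
  have hsum : ∑ x : ZMod p, (quadraticChar (ZMod p) (f.eval x) : ℝ) = (N 1).card - (N (-1)).card := by
    rw [hcard, hcard, ← Finset.sum_sub_distrib]
    refine Finset.sum_congr rfl fun x _ => ?_
    rcases htri x with h | h | h <;> rw [h] <;> norm_num
  have h1 := hle 1
  have h2 := hle (-1)
  have hs1 : (1 : ℝ) ≤ √p := Real.one_le_sqrt.2 (by exact_mod_cast (Fact.out : p.Prime).one_lt.le)
  have hms : (m : ℝ) ≤ m * √p := le_mul_of_one_le_right (by positivity) hs1
  have h0 : (0 : ℝ) ≤ (N 0).card := by positivity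
  rw [hsum, abs_le]
  constructor <;> nlinarith

open Polynomial in
theorem abs_sum_quadraticChar_le {p m : ℕ} [Fact p.Prime]
    {f : (ZMod p)[X]} (hdeg : f.natDegree ≤ m) {u : ZMod p} (hu : Odd (f.rootMultiplicity u)) :
    |∑ x : ZMod p, (quadraticChar (ZMod p) (f.eval x) : ℝ)| ≤ (13 * m + 18) * √p := by
  have hs : √(p : ℝ) * √p = p := Real.mul_self_sqrt (by positivity)
  have hs0 : 0 ≤ √(p : ℝ) := Real.sqrt_nonneg _
  rcases lt_or_ge p (16 * (m + 1) ^ 2) with hp | hp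
  · have h1 : |∑ x : ZMod p, (quadraticChar (ZMod p) (f.eval x) : ℝ)| ≤ p := by
      refine (Finset.abs_sum_le_sum_abs _ _).trans ?_
      refine (Finset.sum_le_sum (g := fun _ => (1 : ℝ)) fun x _ => ?_).trans (by simp [ZMod.card])
      by_cases h : f.eval x = 0
      · simp [h]
      · rcases quadraticChar_dichotomy h with h | h <;> rw [h] <;> norm_num
    have h2 : √(p : ℝ) ≤ 4 * (m + 1) := by
      rw [Real.sqrt_le_left (by positivity)]
      have : (p : ℝ) < 16 * (m + 1) ^ 2 := by exact_mod_cast hp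
      nlinarith
    have h3 : √(p : ℝ) * √p ≤ 4 * (m + 1) * √p := by gcongr
    have : 0 ≤ m * √(p : ℝ) := by positivity
    nlinarith
  · have hfne : f ≠ 0 := by rintro rfl; simp at hu
    obtain ⟨t, ht⟩ : ∃ t, f.eval t ≠ 0 := by
      by_contra! hall
      have h1 : (Finset.univ : Finset (ZMod p)).card ≤ f.natDegree := by
        refine le_trans (Finset.card_le_card fun x hx => ?_) (f.roots.toFinset_card_le.trans (card_roots' f))
        simp [hfne, hall x]
      rw [Finset.card_univ, ZMod.card] at h1
      nlinarith
    have h1 := abs_sum_quadraticChar_le_of_eval_zero_ne (f := f.comp (X + C t)) (u := u - t) hp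
      (by rw [natDegree_comp]; simpa using hdeg) (by simpa using ht)
      (by
        rw [rootMultiplicity_eq_rootMultiplicity] at hu ⊢
        convert hu using 2
        rw [comp_assoc]
        simp only [add_comp, X_comp, C_comp, C_sub]
        congr 1
        ring)
    simp only [eval_comp, eval_add, eval_X, eval_C] at h1
    have h2 : ∑ x : ZMod p, (quadraticChar (ZMod p) (f.eval (x + t)) : ℝ) =
        ∑ x : ZMod p, (quadraticChar (ZMod p) (f.eval x) : ℝ) :=
      Fintype.sum_equiv (Equiv.addRight t) _ _ fun x => rfl
    rwa [h2] at h1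

theorem card_even_fibers_le {β : Type*} [Fintype β] [DecidableEq β] {r : ℕ} (hr : 0 < r) :
    (Finset.univ.filter fun t : Fin (2 * r) → β =>
      ∀ b, Even (Finset.univ.filter fun i => t i = b).card).card ≤
      Fintype.card β ^ r * r ^ (2 * r) := by
  classical
  let Ψ : (Fin r → β) × (Fin (2 * r) → Fin r) → (Fin (2 * r) → β) := fun z j => z.1 (z.2 j)
  have hsub : (Finset.univ.filter fun t : Fin (2 * r) → β =>
      ∀ b, Even (Finset.univ.filter fun i => t i = b).card) ⊆ Finset.univ.image Ψ := by
    intro t ht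
    simp only [Finset.mem_filter, Finset.mem_univ, true_and] at ht
    set I := Finset.univ.image t with hI
    have hcard : I.card ≤ r := by
      have h1 : (Finset.univ : Finset (Fin (2 * r))).card =
          ∑ b ∈ I, (Finset.univ.filter fun i => t i = b).card :=
        Finset.card_eq_sum_card_fiberwise fun i _ => by simp [hI]
      have h2 : ∑ b ∈ I, 2 ≤ ∑ b ∈ I, (Finset.univ.filter fun i => t i = b).card := by
        refine Finset.sum_le_sum fun b hb => ?_
        obtain ⟨i, -, hi⟩ := Finset.mem_image.1 hb
        have h3 : 0 < (Finset.univ.filter fun i => t i = b).card :=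
          Finset.card_pos.2 ⟨i, by simp [hi]⟩
        obtain ⟨k, hk⟩ := ht b
        omega
      rw [← h1] at h2
      simp at h2
      omega
    have hmem : ∀ j, t j ∈ I := fun j => by simp [hI]
    let e := I.equivFin
    refine Finset.mem_image.2 ⟨(fun i => if h : (i : ℕ) < I.card then (e.symm ⟨i, h⟩ : β)
      else t ⟨0, by omega⟩, fun j => Fin.castLE hcard (e ⟨t j, hmem j⟩)), Finset.mem_univ _, ?_⟩
    funext j
    simp [Ψ]
  refine (Finset.card_le_card hsub).trans (Finset.card_image_le.trans ?_)
  simp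

open Polynomial in
theorem rootMultiplicity_prod_X_add_C {F : Type*} [Field F] [DecidableEq F] {ι : Type*} [Fintype ι]
    (t : ι → F) (b : F) : (∏ i, (X + C (t i))).rootMultiplicity (-b) =
      (Finset.univ.filter fun i => t i = b).card := by
  classical
  have h : ∀ i, X + C (t i) ≠ 0 := fun i => X_add_C_ne_zero _
  rw [← count_roots, roots_prod _ _ (Finset.prod_ne_zero_iff.2 fun i _ => h i), Multiset.count_bind]
  simp only [roots_X_add_C, Multiset.count_singleton]
  rw [Finset.card_filter]
  refine Finset.sum_congr rfl fun i _ => ?_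
  simp [eq_comm]

open Polynomial in
/-- Moments of short sums of the quadratic character. -/
theorem sum_pow_sum_quadraticChar_le {p : ℕ} [Fact p.Prime] (S : Finset (ZMod p)) {r : ℕ}
    (hr : 0 < r) :
    ∑ u : ZMod p, (∑ b ∈ S, (quadraticChar (ZMod p) (u + b) : ℝ)) ^ (2 * r) ≤
      (S.card : ℝ) ^ r * r ^ (2 * r) * p + (26 * r + 18) * (S.card : ℝ) ^ (2 * r) * √p := by
  classical
  let f : (Fin (2 * r) → S) → (ZMod p)[X] := fun t => ∏ i, (X + C (t i : ZMod p))
  have h1 : ∑ u : ZMod p, (∑ b ∈ S, (quadraticChar (ZMod p) (u + b) : ℝ)) ^ (2 * r) =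
      ∑ t : Fin (2 * r) → S, ∑ u : ZMod p, (quadraticChar (ZMod p) ((f t).eval u) : ℝ) := by
    rw [Finset.sum_comm]
    refine Finset.sum_congr rfl fun u _ => ?_
    rw [← Finset.sum_coe_sort S, Fintype.sum_pow]
    refine Finset.sum_congr rfl fun t _ => ?_
    simp [f, eval_prod]
  set E := Finset.univ.filter fun t : Fin (2 * r) → S =>
      ∀ b, Even (Finset.univ.filter fun i => t i = b).card with hE
  have hdeg : ∀ t, (f t).natDegree ≤ 2 * r := by
    intro t
    refine (natDegree_prod_le _ _).trans ?_
    simp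
  have h2 : ∀ t, ∑ u : ZMod p, (quadraticChar (ZMod p) ((f t).eval u) : ℝ) ≤
      (if t ∈ E then (p : ℝ) else 0) + (26 * r + 18) * √p := by
    intro t
    by_cases ht : t ∈ E
    · rw [if_pos ht]
      have : ∑ u : ZMod p, (quadraticChar (ZMod p) ((f t).eval u) : ℝ) ≤ p := by
        refine (Finset.sum_le_sum (g := fun _ => (1 : ℝ)) fun x _ => ?_).trans (by simp [ZMod.card])
        by_cases h : (f t).eval x = 0
        · simp [h]
        · rcases quadraticChar_dichotomy h with h | h <;> rw [h] <;> norm_num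
      have : 0 ≤ (26 * r + 18) * √(p : ℝ) := by positivity
      linarith
    · rw [if_neg ht, zero_add]
      simp only [hE, Finset.mem_filter, Finset.mem_univ, true_and, not_forall, Nat.not_even_iff_odd] at ht
      obtain ⟨b, hb⟩ := ht
      have h3 := abs_sum_quadraticChar_le (f := f t) (hdeg t) (u := -(b : ZMod p)) (by
        rw [rootMultiplicity_prod_X_add_C]
        simpa only [Subtype.coe_inj] using hb)
      refine (le_abs_self _).trans (h3.trans (le_of_eq ?_))
      push_cast; ring
  rw [h1]
  refine (Finset.sum_le_sum fun t _ => h2 t).trans ?_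
  rw [Finset.sum_add_distrib]
  refine add_le_add ?_ ?_
  · rw [Finset.sum_ite_mem, Finset.univ_inter, Finset.sum_const, nsmul_eq_mul]
    have := card_even_fibers_le (β := S) hr
    rw [Fintype.card_coe] at this
    have h4 : (E.card : ℝ) ≤ (S.card : ℝ) ^ r * r ^ (2 * r) := by exact_mod_cast this
    gcongr
  · rw [Finset.sum_const, nsmul_eq_mul, Finset.card_univ, Fintype.card_fun, Fintype.card_coe,
      Fintype.card_fin]
    push_cast
    apply le_of_eq; ring

theorem exists_card_divisors_le_mul_rpow {ε : ℝ} (hε : 0 < ε) :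
    ∃ C : ℝ, 1 ≤ C ∧ ∀ n : ℕ, n ≠ 0 → (n.divisors.card : ℝ) ≤ C * (n : ℝ) ^ ε := by
  obtain ⟨P, hP⟩ : ∃ P : ℕ, (2 : ℝ) ^ (1 / ε) ≤ P := exists_nat_ge _
  set K : ℝ := 1 + 1 / (ε * Real.log 2) with hK
  have hlog : 0 < Real.log 2 := Real.log_pos one_lt_two
  have hK1 : 1 ≤ K := by rw [hK]; have : 0 < 1 / (ε * Real.log 2) := by positivity
                         linarith
  have hsmall : ∀ q a : ℕ, 2 ≤ q → ((a + 1 : ℕ) : ℝ) ≤ K * ((q : ℝ) ^ a) ^ ε := by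
    intro q a hq
    have h1 : (1 + a * (ε * Real.log 2)) ≤ ((q : ℝ) ^ a) ^ ε := by
      have h2 : ((2 : ℝ) ^ a) ^ ε ≤ ((q : ℝ) ^ a) ^ ε := by
        have : (2 : ℝ) ≤ q := by exact_mod_cast hq
        gcongr
      refine le_trans ?_ h2
      rw [← Real.rpow_natCast, ← Real.rpow_mul (by norm_num), Real.rpow_def_of_pos (by norm_num)]
      have := Real.add_one_le_exp (Real.log 2 * (a * ε))
      linarith
    have h3 : (a + 1 : ℝ) ≤ K * (1 + a * (ε * Real.log 2)) := by
      have h4 : 1 / (ε * Real.log 2) * (a * (ε * Real.log 2)) = a := by field_simp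
      have h5 : 0 ≤ 1 / (ε * Real.log 2) := by positivity
      have h6 : 0 ≤ a * (ε * Real.log 2) := by positivity
      rw [hK]; nlinarith
    push_cast
    exact h3.trans (by gcongr)
  have hbig : ∀ q a : ℕ, P ≤ q → ((a + 1 : ℕ) : ℝ) ≤ ((q : ℝ) ^ a) ^ ε := by
    intro q a hq
    have h1 : (2 : ℝ) ≤ (q : ℝ) ^ ε := by
      have h2 : (2 : ℝ) ^ (1 / ε) ≤ q := hP.trans (by exact_mod_cast hq)
      calc (2 : ℝ) = ((2 : ℝ) ^ (1 / ε)) ^ ε := by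
            rw [← Real.rpow_mul (by norm_num), one_div_mul_cancel hε.ne', Real.rpow_one]
        _ ≤ _ := by gcongr
    rw [← Real.rpow_natCast (q : ℝ), ← Real.rpow_mul (by positivity), mul_comm, Real.rpow_mul (by positivity),
      Real.rpow_natCast]
    have h3 : ((a + 1 : ℕ) : ℝ) ≤ 2 ^ a := by exact_mod_cast Nat.succ_le_of_lt (Nat.lt_two_pow_self)
    exact h3.trans (by gcongr)
  refine ⟨K ^ P, one_le_pow₀ hK1, fun n hn => ?_⟩
  have hn' : (n : ℝ) ^ ε = ∏ q ∈ n.primeFactors, ((q : ℝ) ^ n.factorization q) ^ ε := by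
    conv_lhs => rw [← Nat.prod_factorization_pow_eq_self hn]
    rw [Finsupp.prod, Nat.support_factorization, Nat.cast_prod,
      ← Real.finsetProd_rpow _ _ fun _ _ => by positivity]
    push_cast; rfl
  rw [Nat.card_divisors hn, hn', Nat.cast_prod]
  have h1 : ∏ q ∈ n.primeFactors, ((n.factorization q + 1 : ℕ) : ℝ) ≤
      ∏ q ∈ n.primeFactors, ((if q < P then K else 1) * ((q : ℝ) ^ n.factorization q) ^ ε) := by
    refine Finset.prod_le_prod (fun _ _ => by positivity) fun q hq => ?_
    split_ifs with h
    · exact hsmall q _ (Nat.prime_of_mem_primeFactors hq).two_le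
    · rw [one_mul]; exact hbig q _ (not_lt.1 h)
  refine h1.trans ?_
  rw [Finset.prod_mul_distrib]
  gcongr
  rw [Finset.prod_ite, Finset.prod_const, Finset.prod_const_one, mul_one]
  refine pow_le_pow_right₀ hK1 ?_
  refine (Finset.card_le_card (t := Finset.range P) fun q hq => ?_).trans (by simp)
  simpa using (Finset.mem_filter.1 hq).2

theorem sum_comp_pow_le {ι κ : Type*} [DecidableEq κ] [Fintype κ] (I : Finset ι) (φ : ι → κ)
    (F : κ → ℝ) (hF : ∀ z, 0 ≤ F z) {r : ℕ} (hr : 0 < r) :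
    (∑ i ∈ I, F (φ i)) ^ (2 * r) ≤ (I.card : ℝ) ^ (2 * (r - 1)) *
      ((((I ×ˢ I).filter fun ij => φ ij.1 = φ ij.2).card : ℝ) * ∑ z, F z ^ (2 * r)) := by
  classical
  have h1 : (∑ i ∈ I, F (φ i)) ^ r ≤ (I.card : ℝ) ^ (r - 1) * ∑ i ∈ I, F (φ i) ^ r := by
    obtain ⟨s, rfl⟩ := Nat.exists_eq_succ_of_ne_zero hr.ne'
    have h := pow_sum_div_card_le_sum_pow (s := I) (f := fun i => F (φ i)) (fun i _ => hF _) s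
    rcases I.eq_empty_or_nonempty with rfl | hI
    · simp
    · have : 0 < (I.card : ℝ) := by exact_mod_cast hI.card_pos
      rw [div_le_iff₀ (by positivity)] at h
      simpa [mul_comm] using h
  have h2 : ∑ i ∈ I, F (φ i) ^ r = ∑ z, ((I.filter fun i => φ i = z).card : ℝ) * F z ^ r := by
    rw [← Finset.sum_fiberwise (s := I) (g := φ)]
    refine Finset.sum_congr rfl fun z _ => ?_
    rw [Finset.sum_congr rfl (g := fun _ => F z ^ r), Finset.sum_const, nsmul_eq_mul]
    intro i hi
    rw [(Finset.mem_filter.1 hi).2]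
  have h3 : (∑ i ∈ I, F (φ i) ^ r) ^ 2 ≤
      (((I ×ˢ I).filter fun ij => φ ij.1 = φ ij.2).card : ℝ) * ∑ z, F z ^ (2 * r) := by
    rw [h2]
    refine (Finset.sum_mul_sq_le_sq_mul_sq _ _ _).trans (le_of_eq ?_)
    congr 1
    · rw [Finset.card_eq_sum_card_fiberwise (f := fun ij : ι × ι => φ ij.1) (t := Finset.univ)
        (fun _ _ => Finset.mem_coe.2 (Finset.mem_univ _))]
      push_cast
      refine Finset.sum_congr rfl fun z _ => ?_
      rw [sq, ← Nat.cast_mul, ← Finset.card_product]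
      congr 2
      ext ⟨i, j⟩
      simp only [Finset.mem_product, Finset.mem_filter]
      constructor
      · rintro ⟨⟨a, b⟩, c, d⟩; exact ⟨⟨⟨a, c⟩, b.trans d.symm⟩, b⟩
      · rintro ⟨⟨⟨a, c⟩, d⟩, b⟩; exact ⟨⟨a, b⟩, c, d.symm.trans b⟩
    · refine Finset.sum_congr rfl fun z _ => ?_
      rw [mul_comm 2 r, pow_mul]
  have h4 : 0 ≤ ∑ i ∈ I, F (φ i) := Finset.sum_nonneg fun i _ => hF _
  calc (∑ i ∈ I, F (φ i)) ^ (2 * r) = ((∑ i ∈ I, F (φ i)) ^ r) ^ 2 := by rw [mul_comm 2 r, pow_mul]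
    _ ≤ ((I.card : ℝ) ^ (r - 1) * ∑ i ∈ I, F (φ i) ^ r) ^ 2 := by gcongr
    _ = (I.card : ℝ) ^ (2 * (r - 1)) * (∑ i ∈ I, F (φ i) ^ r) ^ 2 := by
        rw [mul_pow, ← pow_mul, mul_comm 2 (r - 1)]
    _ ≤ _ := by gcongr

/-- The number of solutions of `n * b = m * a` is controlled by the divisor function. -/
theorem card_ratio_eq_le {p : ℕ} [Fact p.Prime] {N A D : ℕ} (hNA : N * A < p)
    (hD : ∀ m, m ≠ 0 → m ≤ N * A → m.divisors.card ≤ D) :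
    (((Finset.Icc 1 N ×ˢ Finset.Icc 1 A) ×ˢ (Finset.Icc 1 N ×ˢ Finset.Icc 1 A)).filter
      fun ij => (ij.1.1 : ZMod p) * (ij.1.2 : ZMod p)⁻¹ = (ij.2.1 : ZMod p) * (ij.2.2 : ZMod p)⁻¹).card
      ≤ N * A * D := by
  have key : ∀ n a n' a' : ℕ, n ∈ Finset.Icc 1 N → a ∈ Finset.Icc 1 A → n' ∈ Finset.Icc 1 N →
      a' ∈ Finset.Icc 1 A → (n : ZMod p) * (a : ZMod p)⁻¹ = (n' : ZMod p) * (a' : ZMod p)⁻¹ →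
      n * a' = n' * a := by
    intro n a n' a' hn ha hn' ha' h
    simp only [Finset.mem_Icc] at hn ha hn' ha'
    have hne : ∀ b : ℕ, 1 ≤ b → b ≤ A → (b : ZMod p) ≠ 0 := by
      intro b hb1 hb2 h0
      rw [ZMod.natCast_eq_zero_iff] at h0
      have := Nat.le_of_dvd hb1 h0
      nlinarith
    have h1 : (n : ZMod p) * a' = n' * a := by
      have := hne a ha.1 ha.2
      have := hne a' ha'.1 ha'.2
      field_simp at h
      linear_combination h
    have h2 : ((n * a' : ℕ) : ZMod p) = ((n' * a : ℕ) : ZMod p) := by push_cast; exact h1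
    rw [ZMod.natCast_eq_natCast_iff'] at h2
    rwa [Nat.mod_eq_of_lt ((Nat.mul_le_mul hn.2 ha'.2).trans_lt hNA),
      Nat.mod_eq_of_lt ((Nat.mul_le_mul hn'.2 ha.2).trans_lt hNA)] at h2
  have hcard : (Finset.Icc 1 N ×ˢ Finset.Icc 1 A).card = N * A := by
    rw [Finset.card_product]; simp
  rw [← hcard, mul_comm]
  refine Finset.card_le_mul_card_image_of_maps_to (f := fun ij : (ℕ × ℕ) × ℕ × ℕ => (ij.1.1, ij.2.2))
    ?_ _ ?_
  · rintro ⟨⟨n, a⟩, n', a'⟩ h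
    simp only [Finset.mem_filter, Finset.mem_product] at h ⊢
    exact ⟨h.1.1.1, h.1.2.2⟩
  · rintro ⟨n, a'⟩ h
    simp only [Finset.mem_product, Finset.mem_Icc] at h
    refine le_trans ?_ (hD (n * a') (by have := h.1.1; have := h.2.1; positivity)
      (Nat.mul_le_mul h.1.2 h.2.2))
    refine Finset.card_le_card_of_injOn (fun ij => ij.1.2) ?_ ?_
    · rintro ⟨⟨m, a⟩, n', b⟩ h'
      simp only [Finset.coe_filter, Finset.mem_filter, Finset.mem_product, Set.mem_ofPred_eq,
        Prod.mk.injEq] at h'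
      obtain ⟨⟨⟨⟨h1, h2⟩, h3, h4⟩, h5⟩, rfl, rfl⟩ := h'
      have := key _ _ _ _ h1 h2 h3 h4 h5
      simp only [Finset.mem_coe, Nat.mem_divisors]
      refine ⟨⟨n', by rw [this, mul_comm]⟩, ?_⟩
      have := h.1.1; have := h.2.1; positivity
    · rintro ⟨⟨m, a⟩, n', b⟩ h1 ⟨⟨m₂, a₂⟩, n₂', b₂⟩ h2 h3
      simp only [Finset.coe_filter, Finset.mem_filter, Finset.mem_product, Set.mem_ofPred_eq,
        Prod.mk.injEq] at h1 h2 h3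
      obtain ⟨⟨⟨⟨h1, h1'⟩, h1'', h1'''⟩, h5⟩, rfl, rfl⟩ := h1
      obtain ⟨⟨⟨⟨h2, h2'⟩, h2'', h2'''⟩, h6⟩, rfl, rfl⟩ := h2
      subst h3
      have e1 := key _ _ _ _ h1 h1' h1'' h1''' h5
      have e2 := key _ _ _ _ h2 h2' h2'' h2''' h6
      rw [e1] at e2
      have ha : 0 < a := (Finset.mem_Icc.1 h1').1
      have := Nat.eq_of_mul_eq_mul_right ha e2
      subst this
      rfl

theorem abs_quadraticChar_le_one {p : ℕ} [Fact p.Prime] (x : ZMod p) :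
    |(quadraticChar (ZMod p) x : ℝ)| ≤ 1 := by
  rcases quadraticChar_isQuadratic (ZMod p) x with h | h | h <;> rw [h] <;> norm_num

theorem abs_sum_shift_sub_le {p : ℕ} [Fact p.Prime] (N t : ℕ) :
    |∑ n ∈ Finset.Icc 1 N, (quadraticChar (ZMod p) (n : ZMod p) : ℝ) -
      ∑ n ∈ Finset.Icc 1 N, (quadraticChar (ZMod p) ((n : ZMod p) + t) : ℝ)| ≤ 2 * t := by
  set g : ℕ → ℝ := fun n => (quadraticChar (ZMod p) (n : ZMod p) : ℝ) with hg
  have hb : ∀ n, |g n| ≤ 1 := fun n => abs_quadraticChar_le_one _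
  have e1 : ∑ n ∈ Finset.Icc 1 N, g n = ∑ n ∈ Finset.range (N + 1), g n - g 0 := by
    rw [Finset.sum_range_succ', add_sub_cancel_right, Finset.range_eq_Ico,
      Finset.sum_Ico_add' g 0 N 1]; rfl
  have e2 : ∑ n ∈ Finset.Icc 1 N, (quadraticChar (ZMod p) ((n : ZMod p) + t) : ℝ) =
      ∑ n ∈ Finset.range (N + 1 + t), g n - ∑ n ∈ Finset.range (t + 1), g n := by
    have : ∑ n ∈ Finset.Icc 1 N, (quadraticChar (ZMod p) ((n : ZMod p) + t) : ℝ) =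
        ∑ n ∈ Finset.Ico 1 (N + 1), g (n + t) := by
      refine Finset.sum_congr rfl fun n _ => ?_
      simp [hg]
    rw [this, Finset.sum_Ico_add', Finset.sum_Ico_eq_sub _ (by omega), Nat.add_comm 1 t]
  have e3 : ∑ n ∈ Finset.range (N + 1 + t), g n = ∑ n ∈ Finset.range (N + 1), g n +
      ∑ n ∈ Finset.range t, g (N + 1 + n) := Finset.sum_range_add _ _ _
  have e4 : ∑ n ∈ Finset.range (t + 1), g n = ∑ n ∈ Finset.range t, g (n + 1) + g 0 :=
    Finset.sum_range_succ' _ _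
  rw [e1, e2, e3, e4]
  have b1 : ∀ h : ℕ → ℕ, |∑ n ∈ Finset.range t, g (h n)| ≤ t := fun h =>
    (Finset.abs_sum_le_sum_abs _ _).trans
      ((Finset.sum_le_sum fun n _ => hb (h n)).trans (by simp))
  have b2 := b1 fun n => N + 1 + n
  have b3 := b1 fun n => n + 1
  rw [abs_le] at b2 b3 ⊢
  constructor <;> linarith

theorem sum_quadraticChar_mul_le {p : ℕ} [Fact p.Prime] {N A B : ℕ} (hA : A < p)
    (hB : B < p) :
    (∑ n ∈ Finset.Icc 1 N, (quadraticChar (ZMod p) (n : ZMod p) : ℝ)) * (A * B) ≤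
      2 * (A * B) ^ 2 + ∑ i ∈ Finset.Icc 1 N ×ˢ Finset.Icc 1 A,
        |∑ b ∈ (Finset.Icc 1 B).image (Nat.cast : ℕ → ZMod p),
          (quadraticChar (ZMod p) ((i.1 : ZMod p) * (i.2 : ZMod p)⁻¹ + b) : ℝ)| := by
  have hinj : Set.InjOn (Nat.cast : ℕ → ZMod p) (Finset.Icc 1 B) := by
    intro x hx y hy h
    rw [Finset.mem_coe, Finset.mem_Icc] at hx hy
    rw [ZMod.natCast_eq_natCast_iff', Nat.mod_eq_of_lt (by omega), Nat.mod_eq_of_lt (by omega)] at h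
    exact h
  set S := ∑ n ∈ Finset.Icc 1 N, (quadraticChar (ZMod p) (n : ZMod p) : ℝ) with hS
  have h1 : S * (A * B) ≤ ∑ a ∈ Finset.Icc 1 A, ∑ b ∈ Finset.Icc 1 B, (2 * ((A : ℝ) * B) +
      ∑ n ∈ Finset.Icc 1 N, (quadraticChar (ZMod p) ((n : ZMod p) + (a * b : ℕ)) : ℝ)) := by
    have : S * (A * B) = ∑ a ∈ Finset.Icc 1 A, ∑ b ∈ Finset.Icc 1 B, S := by
      simp; ring
    rw [this]
    refine Finset.sum_le_sum fun a ha => Finset.sum_le_sum fun b hb => ?_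
    have h2 := abs_sum_shift_sub_le (p := p) N (a * b)
    rw [abs_le] at h2
    have h3 : ((a * b : ℕ) : ℝ) ≤ (A : ℝ) * B := by
      exact_mod_cast Nat.mul_le_mul (Finset.mem_Icc.1 ha).2 (Finset.mem_Icc.1 hb).2
    linarith [h2.2]
  refine h1.trans ?_
  simp only [Finset.sum_add_distrib]
  refine add_le_add (le_of_eq (by simp; ring)) ?_
  rw [Finset.sum_product_right]
  refine Finset.sum_le_sum fun a ha => ?_
  rw [Finset.sum_comm]
  refine Finset.sum_le_sum fun n hn => ?_
  rw [Finset.sum_image hinj]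
  have ha0 : (a : ZMod p) ≠ 0 := by
    rw [Finset.mem_Icc] at ha
    intro h0
    rw [ZMod.natCast_eq_zero_iff] at h0
    have := Nat.le_of_dvd ha.1 h0
    omega
  have h4 : ∀ b : ℕ, (quadraticChar (ZMod p) ((n : ZMod p) + (a * b : ℕ)) : ℝ) =
      (quadraticChar (ZMod p) (a : ZMod p) : ℝ) *
        (quadraticChar (ZMod p) ((n : ZMod p) * (a : ZMod p)⁻¹ + b) : ℝ) := by
    intro b
    rw [← Int.cast_mul, ← map_mul]
    congr 3
    push_cast
    field_simp
  simp only [h4]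
  rw [← Finset.mul_sum]
  refine (le_abs_self _).trans ?_
  rw [abs_mul]
  exact mul_le_of_le_one_left (abs_nonneg _) (abs_quadraticChar_le_one _)

theorem sum_quadraticChar_mul_pow_le {p : ℕ} [Fact p.Prime] {N A B D r : ℕ} (hr : 0 < r)
    (hA : A < p) (hB : B < p) (hNA : N * A < p)
    (hD : ∀ m, m ≠ 0 → m ≤ N * A → m.divisors.card ≤ D)
    (hBp : √(p : ℝ) ≤ (B : ℝ) ^ r) :
    ∃ T : ℝ, 0 ≤ T ∧
    (∑ n ∈ Finset.Icc 1 N, (quadraticChar (ZMod p) (n : ZMod p) : ℝ)) * (A * B) ≤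
      2 * (A * B) ^ 2 + T ∧
    T ^ (2 * r) * (N * A) ≤ ((N : ℝ) * A * B) ^ (2 * r) *
      (D * ((r : ℝ) ^ (2 * r) + (26 * r + 18)) * √p) := by
  refine ⟨_, ?_, sum_quadraticChar_mul_le hA hB, ?_⟩
  · exact Finset.sum_nonneg fun _ _ => abs_nonneg _
  set S := (Finset.Icc 1 B).image (Nat.cast : ℕ → ZMod p) with hS
  have hScard : (S.card : ℝ) ≤ B := by
    exact_mod_cast Finset.card_image_le.trans (by simp)
  have h1 := sum_comp_pow_le (Finset.Icc 1 N ×ˢ Finset.Icc 1 A)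
    (fun i : ℕ × ℕ => (i.1 : ZMod p) * (i.2 : ZMod p)⁻¹)
    (fun z => |∑ b ∈ S, (quadraticChar (ZMod p) (z + b) : ℝ)|) (fun _ => abs_nonneg _) hr
  have h2 : ∑ z : ZMod p, |∑ b ∈ S, (quadraticChar (ZMod p) (z + b) : ℝ)| ^ (2 * r) ≤
      ((r : ℝ) ^ (2 * r) + (26 * r + 18)) * (B : ℝ) ^ (2 * r) * √p := by
    have h3 := sum_pow_sum_quadraticChar_le S hr
    simp only [(even_two_mul r).pow_abs]
    refine h3.trans ?_
    have h4 : √(p : ℝ) * √p = p := Real.mul_self_sqrt (Nat.cast_nonneg p)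
    calc (S.card : ℝ) ^ r * r ^ (2 * r) * p + (26 * r + 18) * (S.card : ℝ) ^ (2 * r) * √p
        ≤ (B : ℝ) ^ r * r ^ (2 * r) * ((B : ℝ) ^ r * √p) +
          (26 * r + 18) * (B : ℝ) ^ (2 * r) * √p := by
          gcongr
          rw [← h4]
          gcongr
          exact h4.ge
      _ = _ := by rw [two_mul, pow_add (B : ℝ)]; ring
  have h3 := card_ratio_eq_le hNA hD
  have hcard : ((Finset.Icc 1 N ×ˢ Finset.Icc 1 A).card : ℝ) = N * A := by
    rw [Finset.card_product]; simp
  rw [hcard] at h1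
  have h4 := mul_le_mul_of_nonneg_right h1 (by positivity : (0 : ℝ) ≤ N * A)
  refine h4.trans ?_
  obtain ⟨s, rfl⟩ := Nat.exists_eq_succ_of_ne_zero hr.ne'
  have h5 : (((((Finset.Icc 1 N ×ˢ Finset.Icc 1 A) ×ˢ (Finset.Icc 1 N ×ˢ Finset.Icc 1 A)).filter
      fun ij => (ij.1.1 : ZMod p) * (ij.1.2 : ZMod p)⁻¹ =
        (ij.2.1 : ZMod p) * (ij.2.2 : ZMod p)⁻¹).card : ℕ) : ℝ) ≤ N * A * D := by
    exact_mod_cast h3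
  refine (mul_le_mul_of_nonneg_right (mul_le_mul_of_nonneg_left
    (mul_le_mul h5 h2 ?_ (by positivity)) (by positivity)) (by positivity)).trans (le_of_eq ?_)
  · exact Finset.sum_nonneg fun _ _ => by positivity
  · rw [Nat.succ_sub_one, Nat.succ_eq_add_one]; ring

open Filter in
set_option maxHeartbeats 1000000 in
/-- The Burgess estimate for initial segments. -/
theorem sum_quadraticChar_le_of_burgess {δ η : ℝ} (hδ : 0 < δ) (hδ' : δ < 1 / 8) (hη : 0 < η)
    (hη1 : η ≤ 1) :
    ∃ p₀ : ℕ, ∀ p : ℕ, p₀ ≤ p → ∀ _ : Fact p.Prime,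
      ∑ n ∈ Finset.Icc 1 ⌊(p : ℝ) ^ (1 / 4 + δ)⌋₊, (quadraticChar (ZMod p) (n : ZMod p) : ℝ) ≤
        η * (p : ℝ) ^ (1 / 4 + δ) := by
  obtain ⟨r, hr⟩ : ∃ r : ℕ, 1 / δ ≤ r := exists_nat_ge _
  have hr0' : (0 : ℝ) < r := lt_of_lt_of_le (by positivity) hr
  have hr0 : 0 < r := by exact_mod_cast hr0'
  have hrδ : 1 / (2 * (r : ℝ)) ≤ δ / 2 := by
    rw [div_le_iff₀ hδ] at hr
    rw [div_le_div_iff₀ (by positivity) (by positivity)]; linarith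
  obtain ⟨C, hC1, hC⟩ := exists_card_divisors_le_mul_rpow hδ
  set K : ℝ := (r : ℝ) ^ (2 * r) + (26 * r + 18) with hK
  have hK0 : 0 < K := by positivity
  set c₁ : ℝ := (η / 2) ^ (2 * r) / (2 * C * K * (64 / η)) with hc₁
  have hc₁0 : 0 < c₁ := by positivity
  have ev1 : ∀ᶠ p : ℕ in atTop, (p : ℝ) ^ (-(δ / 2)) ≤ c₁ :=
    ((tendsto_rpow_neg_atTop (by positivity : 0 < δ / 2)).comp
      tendsto_natCast_atTop_atTop).eventually (eventually_le_nhds hc₁0)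
  have ev2 : ∀ᶠ p : ℕ in atTop, 64 / η ≤ (p : ℝ) ^ (1 / 8 : ℝ) :=
    ((tendsto_rpow_atTop (by norm_num : (0 : ℝ) < 1 / 8)).comp
      tendsto_natCast_atTop_atTop).eventually_ge_atTop _
  obtain ⟨p₀, hp₀⟩ := eventually_atTop.1 (ev1.and (ev2.and (eventually_ge_atTop 2)))
  refine ⟨p₀, fun p hpp hp => ?_⟩
  clear_value K c₁
  obtain ⟨h1, h2, h3⟩ := hp₀ p hpp
  have hp1 : (1 : ℝ) ≤ p := by exact_mod_cast (by omega : 1 ≤ p)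
  have hp0 : (0 : ℝ) < p := by linarith
  set x : ℝ := (p : ℝ) ^ (1 / 4 + δ) with hx
  set y : ℝ := (p : ℝ) ^ (1 / (2 * (r : ℝ))) with hy
  have hy1 : 1 ≤ y := Real.one_le_rpow hp1 (by positivity)
  have hx1 : 1 ≤ x := Real.one_le_rpow hp1 (by positivity)
  set N := ⌊x⌋₊ with hN
  set B := ⌈y⌉₊ with hB
  set A := ⌊η * x / (8 * B)⌋₊ with hA
  have hB1 : y ≤ B := Nat.le_ceil _
  have hB2 : (B : ℝ) ≤ 2 * y := by have := Nat.ceil_lt_add_one (by linarith : 0 ≤ y); linarith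
  have hB0 : (0 : ℝ) < B := by linarith
  have hNx : (N : ℝ) ≤ x := Nat.floor_le (by linarith)
  have hN0 : 1 ≤ N := Nat.le_floor (by simpa using hx1)
  have hNx2 : x / 2 ≤ N := by
    have := Nat.lt_floor_add_one x
    have : (1 : ℝ) ≤ N := by exact_mod_cast hN0
    linarith
  have hAx : (A : ℝ) ≤ η * x / (8 * B) := Nat.floor_le (by positivity)
  have hyx : y * (p : ℝ) ^ (1 / 8 : ℝ) ≤ x := by
    rw [hy, hx, ← Real.rpow_add hp0]
    exact Real.rpow_le_rpow_of_exponent_le hp1 (by linarith)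
  have h64 : 64 * y ≤ η * x := by
    rw [div_le_iff₀ hη] at h2
    nlinarith
  have hA1 : 1 ≤ η * x / (8 * B) := by
    rw [le_div_iff₀ (by positivity)]; linarith
  have hA0 : 1 ≤ A := Nat.le_floor (by simpa using hA1)
  have hAx2 : η * x / (32 * y) ≤ A := by
    have := Nat.lt_floor_add_one (η * x / (8 * B))
    have h5 : (1 : ℝ) ≤ A := by exact_mod_cast hA0
    have h6 : η * x / (8 * B) / 2 ≤ A := by linarith
    refine le_trans ?_ h6
    rw [div_div]
    gcongr η * x / ?_
    linarith
  have hA0' : (0 : ℝ) < A := by exact_mod_cast hA0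
  have hN0' : (0 : ℝ) < N := by exact_mod_cast hN0
  have hAB : (A : ℝ) * B ≤ η * x / 8 := by
    rw [le_div_iff₀ (by positivity)] at hAx; linarith
  have hxp : x * x < p := by
    rw [hx, ← Real.rpow_add hp0]
    calc (p : ℝ) ^ (1 / 4 + δ + (1 / 4 + δ)) < (p : ℝ) ^ (1 : ℝ) :=
          Real.rpow_lt_rpow_of_exponent_lt (by exact_mod_cast (by omega : 1 < p)) (by linarith)
      _ = p := Real.rpow_one _
  have hB1' : (1 : ℝ) ≤ B := by linarith
  have hAlex : (A : ℝ) ≤ x :=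
    calc (A : ℝ) ≤ A * B := le_mul_of_one_le_right hA0'.le hB1'
      _ ≤ η * x / 8 := hAB
      _ ≤ x := by nlinarith
  have hBlex : (B : ℝ) ≤ x :=
    calc (B : ℝ) ≤ η * x := by linarith
      _ ≤ x := mul_le_of_le_one_left (by linarith) hη1
  have hNAp : (N : ℝ) * A < p := (by gcongr : (N : ℝ) * A ≤ x * x).trans_lt hxp
  have hxp' : x < p := (le_mul_of_one_le_left (by linarith) hx1).trans_lt hxp
  set D : ℕ := ⌊C * (p : ℝ) ^ δ⌋₊ with hD
  have hBp : √(p : ℝ) ≤ (B : ℝ) ^ r := by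
    calc √(p : ℝ) = y ^ r := by
          rw [hy, ← Real.rpow_natCast, ← Real.rpow_mul hp0.le, Real.sqrt_eq_rpow]
          congr 1; field_simp
      _ ≤ _ := by gcongr
  obtain ⟨T, hT0, hT1, hT2⟩ := sum_quadraticChar_mul_pow_le (p := p) (N := N) (A := A) (B := B)
    (D := D) hr0 (by exact_mod_cast hAlex.trans_lt hxp') (by exact_mod_cast hBlex.trans_lt hxp')
    (by exact_mod_cast hNAp) (fun m hm hm' => Nat.le_floor ((hC m hm).trans (by
      have : (m : ℝ) ≤ p := le_trans (by exact_mod_cast hm') hNAp.le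
      gcongr))) hBp
  have hD' : (D : ℝ) ≤ C * (p : ℝ) ^ δ := Nat.floor_le (by positivity)
  have hNAlow : η / 64 * (p : ℝ) ^ (1 / 2 + 3 * δ / 2) ≤ N * A := by
    calc η / 64 * (p : ℝ) ^ (1 / 2 + 3 * δ / 2) ≤ η / 64 * (x * x / y) := by
          gcongr
          rw [hx, hy, ← Real.rpow_add hp0, ← Real.rpow_sub hp0]
          exact Real.rpow_le_rpow_of_exponent_le hp1 (by linarith)
      _ = x / 2 * (η * x / (32 * y)) := by field_simp; ring
      _ ≤ N * A := by gcongr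
  have hT3 : T ^ (2 * r) ≤ (N * A * B * (η / 2)) ^ (2 * r) := by
    rw [mul_pow (_ * _)]
    refine le_of_mul_le_mul_right (hT2.trans ?_) (by positivity : (0 : ℝ) < N * A)
    rw [← hK, mul_assoc (_ ^ _)]
    refine mul_le_mul_of_nonneg_left ?_ (by positivity)
    calc (D : ℝ) * K * √p ≤ C * (p : ℝ) ^ δ * K * √p := by gcongr
      _ = C * K * (64 / η) * (p : ℝ) ^ (-(δ / 2)) *
          (η / 64 * (p : ℝ) ^ (1 / 2 + 3 * δ / 2)) := by
          have : (p : ℝ) ^ δ * √p = (p : ℝ) ^ (-(δ / 2)) * (p : ℝ) ^ (1 / 2 + 3 * δ / 2) := by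
            rw [Real.sqrt_eq_rpow, ← Real.rpow_add hp0, ← Real.rpow_add hp0]
            congr 1; ring
          have h5 : 64 / η * (η / 64) = 1 := by field_simp
          linear_combination C * K * this -
            C * K * (p : ℝ) ^ (-(δ / 2)) * (p : ℝ) ^ (1 / 2 + 3 * δ / 2) * h5
      _ ≤ C * K * (64 / η) * c₁ * (N * A) := by gcongr
      _ ≤ (η / 2) ^ (2 * r) * (N * A) := by
          gcongr
          have h5 : C * K * (64 / η) * ((η / 2) ^ (2 * r) / (2 * C * K * (64 / η))) =
            (η / 2) ^ (2 * r) / 2 := by field_simp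
          rw [hc₁, h5]
          have : 0 < (η / 2) ^ (2 * r) := by positivity
          linarith
  have hT4 : T ≤ N * A * B * (η / 2) :=
    le_of_pow_le_pow_left₀ (by omega) (by positivity) hT3
  have hfin : (∑ n ∈ Finset.Icc 1 N, (quadraticChar (ZMod p) (n : ZMod p) : ℝ)) * (A * B) ≤
      (2 * (A * B) + N * (η / 2)) * (A * B) := by
    refine hT1.trans ?_
    linarith
  have h6 := le_of_mul_le_mul_right hfin (by positivity)
  have h7 : (N : ℝ) * (η / 2) ≤ x * (η / 2) := by gcongr
  linarith [mul_pos hη (by linarith : 0 < x)]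

open ArithmeticFunction in
theorem sum_vonMangoldt_div_bounds {n : ℕ} (hn : n ≠ 0) :
    Real.log n - 1 ≤ ∑ d ∈ Finset.Ioc 0 n, ArithmeticFunction.vonMangoldt d / d ∧
    ∑ d ∈ Finset.Ioc 0 n, ArithmeticFunction.vonMangoldt d / d ≤ Real.log n + (Real.log 4 + 4) := by
  have hn0 : (0 : ℝ) < n := by exact_mod_cast Nat.pos_of_ne_zero hn
  set M := ∑ d ∈ Finset.Ioc 0 n, ArithmeticFunction.vonMangoldt d / d with hM
  have h1 : ∑ d ∈ Finset.Ioc 0 n, ArithmeticFunction.vonMangoldt d * ((n / d : ℕ) : ℝ) =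
      Real.log n.factorial := by
    rw [← sum_Ioc_mul_zeta_eq_sum, vonMangoldt_mul_zeta, ← Finset.prod_Ico_id_eq_factorial,
      show Finset.Ioc 0 n = Finset.Ico 1 (n + 1) by ext; simp; omega]
    push_cast
    rw [Real.log_prod]
    · rfl
    · intro i hi
      have := (Finset.mem_Ioc.1 hi).1
      positivity
  have h2 : Real.log n.factorial ≤ n * M := by
    rw [← h1, hM, Finset.mul_sum]
    refine Finset.sum_le_sum fun d _ => ?_
    calc ArithmeticFunction.vonMangoldt d * ((n / d : ℕ) : ℝ)
        ≤ ArithmeticFunction.vonMangoldt d * ((n : ℝ) / d) :=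
          mul_le_mul_of_nonneg_left Nat.cast_div_le vonMangoldt_nonneg
      _ = _ := by ring
  have h3 : n * M ≤ Real.log n.factorial + (Real.log 4 + 4) * n := by
    refine le_trans ?_ (add_le_add_right (Chebyshev.psi_le_const_mul_self hn0.le) _)
    rw [← h1, hM, Finset.mul_sum, Chebyshev.psi, Nat.floor_natCast, ← Finset.sum_add_distrib]
    refine Finset.sum_le_sum fun d hd => ?_
    have hd0 : (0 : ℝ) < d := by exact_mod_cast (Finset.mem_Ioc.1 hd).1
    calc (n : ℝ) * (ArithmeticFunction.vonMangoldt d / d)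
        = ArithmeticFunction.vonMangoldt d * ((n : ℝ) / d) := by ring
      _ ≤ ArithmeticFunction.vonMangoldt d * (((n / d : ℕ) : ℝ) + 1) := by
          refine mul_le_mul_of_nonneg_left ?_ vonMangoldt_nonneg
          rw [← Nat.floor_div_eq_div (K := ℝ)]
          exact (Nat.lt_floor_add_one _).le
      _ = _ := by ring
  have h4 := Stirling.le_log_factorial_stirling hn
  have h5 : 0 ≤ Real.log n := Real.log_natCast_nonneg n
  have h6 : 0 ≤ Real.log (2 * Real.pi) := Real.log_nonneg (by linarith [Real.pi_gt_three])
  have h7 : Real.log n.factorial ≤ n * Real.log n := by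
    rw [← Real.log_pow]
    refine Real.log_le_log (by exact_mod_cast n.factorial_pos) ?_
    exact_mod_cast n.factorial_le_pow
  constructor
  · refine le_of_mul_le_mul_left ?_ hn0
    linarith
  · refine le_of_mul_le_mul_left ?_ hn0
    linarith

theorem sum_prime_log_div_le {z w : ℕ} (hz : z ≠ 0) (hzw : z ≤ w) :
    ∑ q ∈ (Finset.Ioc z w).filter Nat.Prime, Real.log q / q ≤
      Real.log w - Real.log z + (Real.log 4 + 5) := by
  have h1 := (sum_vonMangoldt_div_bounds hz).1
  have h2 := (sum_vonMangoldt_div_bounds (by omega : w ≠ 0)).2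
  have h3 : ∑ d ∈ Finset.Ioc 0 w, ArithmeticFunction.vonMangoldt d / d =
      ∑ d ∈ Finset.Ioc 0 z, ArithmeticFunction.vonMangoldt d / d +
      ∑ d ∈ Finset.Ioc z w, ArithmeticFunction.vonMangoldt d / d :=
    (Finset.sum_Ioc_consecutive _ (Nat.zero_le z) hzw).symm
  have h4 : ∑ q ∈ (Finset.Ioc z w).filter Nat.Prime, Real.log q / q ≤
      ∑ d ∈ Finset.Ioc z w, ArithmeticFunction.vonMangoldt d / d := by
    rw [Finset.sum_filter]
    refine Finset.sum_le_sum fun q _ => ?_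
    split_ifs with h
    · rw [ArithmeticFunction.vonMangoldt_apply_prime h]
    · exact div_nonneg ArithmeticFunction.vonMangoldt_nonneg (Nat.cast_nonneg _)
  linarith

theorem sum_prime_inv_le {x a b : ℝ} (hx : 1 < x) (ha : 0 < a) (hab : a ≤ b) :
    ∑ q ∈ (Finset.Ioc ⌊x ^ a⌋₊ ⌊x ^ b⌋₊).filter Nat.Prime, (1 : ℝ) / q ≤
      (b / a - 1) + (Real.log 4 + 6) / (a * Real.log x) := by
  have hlx : 0 < Real.log x := Real.log_pos hx
  have hx0 : 0 < x := by linarith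
  have hxa : 1 < x ^ a := Real.one_lt_rpow hx ha
  have hxab : x ^ a ≤ x ^ b := Real.rpow_le_rpow_of_exponent_le hx.le hab
  have hz1 : 1 ≤ ⌊x ^ a⌋₊ := Nat.le_floor (by simpa using hxa.le)
  have hz := sum_prime_log_div_le (z := ⌊x ^ a⌋₊) (w := ⌊x ^ b⌋₊) (by omega)
    (Nat.floor_mono hxab)
  have hw : Real.log ⌊x ^ b⌋₊ ≤ b * Real.log x := by
    rw [← Real.log_rpow hx0]
    exact Real.log_le_log (by exact_mod_cast hz1.trans (Nat.floor_mono hxab))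
      (Nat.floor_le (by positivity))
  have hz2 : a * Real.log x - 1 ≤ Real.log ⌊x ^ a⌋₊ := by
    have h1 : x ^ a ≤ 2 * ⌊x ^ a⌋₊ := by
      have := Nat.lt_floor_add_one (x ^ a)
      have : (1 : ℝ) ≤ ⌊x ^ a⌋₊ := by exact_mod_cast hz1
      linarith
    have h2 := Real.log_le_log (by positivity) h1
    rw [Real.log_rpow hx0, Real.log_mul (by norm_num) (by positivity)] at h2
    linarith [Real.log_two_lt_d9]
  have key : (a * Real.log x) * ∑ q ∈ (Finset.Ioc ⌊x ^ a⌋₊ ⌊x ^ b⌋₊).filter Nat.Prime, (1 : ℝ) / q ≤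
      (b - a) * Real.log x + (Real.log 4 + 6) := by
    have h3 : (a * Real.log x) *
        ∑ q ∈ (Finset.Ioc ⌊x ^ a⌋₊ ⌊x ^ b⌋₊).filter Nat.Prime, (1 : ℝ) / q ≤
        ∑ q ∈ (Finset.Ioc ⌊x ^ a⌋₊ ⌊x ^ b⌋₊).filter Nat.Prime, Real.log q / q := by
      rw [Finset.mul_sum]
      refine Finset.sum_le_sum fun q hq => ?_
      have hq1 := (Finset.mem_Ioc.1 (Finset.mem_filter.1 hq).1).1
      have hq2 : x ^ a ≤ q := (Nat.lt_of_floor_lt hq1).le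
      rw [← Real.log_rpow hx0, mul_one_div]
      gcongr
    linarith
  have h4 : (b / a - 1) + (Real.log 4 + 6) / (a * Real.log x) =
      ((b - a) * Real.log x + (Real.log 4 + 6)) / (a * Real.log x) := by
    field_simp
  rw [h4, le_div_iff₀ (by positivity)]
  linarith

open Filter in
/-- An upper bound of Mertens type for sums of reciprocals of primes. -/
theorem eventually_sum_prime_inv_le {a b η : ℝ} (ha : 0 < a) (hab : a ≤ b) (hη : 0 < η) :
    ∀ᶠ x : ℝ in atTop, ∑ q ∈ (Finset.Ioc ⌊x ^ a⌋₊ ⌊x ^ b⌋₊).filter Nat.Prime, (1 : ℝ) / q ≤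
      Real.log (b / a) + η := by
  set ℓ := Real.log (b / a) with hℓ
  have hℓ0 : 0 ≤ ℓ := Real.log_nonneg (by rwa [le_div_iff₀ ha, one_mul])
  obtain ⟨k, hk⟩ : ∃ k : ℕ, max (max ℓ 1) (2 * ℓ ^ 2 / η) ≤ k := exists_nat_ge _
  have hk1 : (1 : ℝ) ≤ k := (le_max_right _ _).trans ((le_max_left _ _).trans hk)
  have hkℓ : ℓ ≤ k := (le_max_left _ _).trans ((le_max_left _ _).trans hk)
  have hkη : ℓ ^ 2 / k ≤ η / 2 := by
    have := (le_max_right _ _).trans hk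
    rw [div_le_iff₀ hη] at this
    rw [div_le_div_iff₀ (by linarith) (by norm_num)]; linarith
  have hk0 : (0 : ℝ) < k := by linarith
  set ρ := Real.exp (ℓ / k) with hρ
  have hρ1 : 1 ≤ ρ := Real.one_le_exp (by positivity)
  have hρ2 : ρ - 1 ≤ ℓ / k + (ℓ / k) ^ 2 := by
    have h := Real.abs_exp_sub_one_sub_id_le (x := ℓ / k) (by
      rw [abs_of_nonneg (by positivity)]; exact (div_le_one hk0).2 hkℓ)
    have := (abs_le.1 h).2
    linarith
  have hρk : a * ρ ^ k = b := by
    rw [hρ, ← Real.exp_nat_mul, mul_div_cancel₀ _ hk0.ne', hℓ,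
      Real.exp_log (div_pos (by linarith) ha), mul_div_cancel₀ _ ha.ne']
  have ev : ∀ᶠ x : ℝ in atTop, 2 * k * (Real.log 4 + 6) / (a * η) ≤ Real.log x :=
    Real.tendsto_log_atTop.eventually_ge_atTop _
  filter_upwards [ev, eventually_gt_atTop 1] with x hx hx1
  have hlx : 0 < Real.log x := Real.log_pos hx1
  have hlog4 : 0 < Real.log 4 := Real.log_pos (by norm_num)
  have hmono : ∀ i : ℕ, ⌊x ^ (a * ρ ^ i)⌋₊ ≤ ⌊x ^ (a * ρ ^ (i + 1))⌋₊ := fun i =>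
    Nat.floor_mono (Real.rpow_le_rpow_of_exponent_le hx1.le (by gcongr; omega))
  have hmono' : Monotone fun i : ℕ => ⌊x ^ (a * ρ ^ i)⌋₊ := monotone_nat_of_le_succ hmono
  have hind : ∀ j : ℕ, ∑ q ∈ (Finset.Ioc ⌊x ^ a⌋₊ ⌊x ^ (a * ρ ^ j)⌋₊).filter Nat.Prime,
      (1 : ℝ) / q ≤ j * ((ρ - 1) + (Real.log 4 + 6) / (a * Real.log x)) := by
    intro j
    induction j with
    | zero => simp
    | succ j ih =>
      have h0 : ⌊x ^ a⌋₊ ≤ ⌊x ^ (a * ρ ^ j)⌋₊ := by simpa using hmono' (Nat.zero_le j)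
      rw [Finset.sum_filter, ← Finset.sum_Ioc_consecutive _ h0 (hmono j), ← Finset.sum_filter,
        ← Finset.sum_filter]
      have hstep := sum_prime_inv_le (x := x) (a := a * ρ ^ j) (b := a * ρ ^ (j + 1)) hx1
        (by positivity) (by gcongr; omega)
      have e1 : a * ρ ^ (j + 1) / (a * ρ ^ j) = ρ := by rw [pow_succ]; field_simp
      rw [e1] at hstep
      have e2 : (Real.log 4 + 6) / (a * ρ ^ j * Real.log x) ≤
          (Real.log 4 + 6) / (a * Real.log x) := by
        gcongr
        exact le_mul_of_one_le_right ha.le (one_le_pow₀ hρ1)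
      push_cast
      linarith
  have hfin := hind k
  rw [hρk] at hfin
  refine hfin.trans ?_
  have e3 : k * ((Real.log 4 + 6) / (a * Real.log x)) ≤ η / 2 := by
    rw [div_le_iff₀ (by positivity)] at hx
    rw [← mul_div_assoc, div_le_iff₀ (by positivity)]
    linarith
  have e4 : k * (ρ - 1) ≤ ℓ + η / 2 := by
    have : k * (ℓ / k + (ℓ / k) ^ 2) = ℓ + ℓ ^ 2 / k := by field_simp
    have := mul_le_mul_of_nonneg_left hρ2 hk0.le
    linarith
  linarith

theorem exists_prime_dvd_quadraticChar_eq_neg_one {p : ℕ} [Fact p.Prime] (n : ℕ)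
    (hn : quadraticChar (ZMod p) (n : ZMod p) = -1) :
    ∃ q : ℕ, q.Prime ∧ q ∣ n ∧ quadraticChar (ZMod p) (q : ZMod p) = -1 := by
  induction n using induction_on_primes with
  | zero => simp at hn
  | one => norm_num at hn
  | prime_mul q n hq ih =>
    rcases quadraticChar_isQuadratic (ZMod p) (q : ZMod p) with h | h | h
    · rw [Nat.cast_mul, map_mul, h, zero_mul] at hn; norm_num at hn
    · rw [Nat.cast_mul, map_mul, h, one_mul] at hn
      obtain ⟨r, h1, h2, h3⟩ := ih hn
      exact ⟨r, h1, h2.mul_left q, h3⟩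
    · exact ⟨q, hq, dvd_mul_right q n, h⟩

theorem card_nonresidue_le {p : ℕ} [Fact p.Prime] (N : ℕ) :
    (((Finset.Icc 1 N).filter fun n : ℕ => quadraticChar (ZMod p) (n : ZMod p) = -1).card : ℝ) ≤
      N * ∑ q ∈ (Finset.Icc 1 N).filter
        (fun q : ℕ => q.Prime ∧ quadraticChar (ZMod p) (q : ZMod p) = -1), (1 : ℝ) / q := by
  classical
  have h1 : ((Finset.Icc 1 N).filter fun n : ℕ => quadraticChar (ZMod p) (n : ZMod p) = -1) ⊆
      ((Finset.Icc 1 N).filter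
        (fun q : ℕ => q.Prime ∧ quadraticChar (ZMod p) (q : ZMod p) = -1)).biUnion
        fun q => (Finset.Icc 1 N).filter (q ∣ ·) := by
    intro n hn
    obtain ⟨hn1, hn2⟩ := Finset.mem_filter.1 hn
    obtain ⟨q, hq, hqn, hq1⟩ := exists_prime_dvd_quadraticChar_eq_neg_one n hn2
    have := Finset.mem_Icc.1 hn1
    refine Finset.mem_biUnion.2 ⟨q, Finset.mem_filter.2 ⟨Finset.mem_Icc.2 ⟨hq.one_le, ?_⟩, hq, hq1⟩,
      Finset.mem_filter.2 ⟨hn1, hqn⟩⟩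
    exact (Nat.le_of_dvd this.1 hqn).trans this.2
  have h2 : ∀ q ∈ (Finset.Icc 1 N).filter
        (fun q : ℕ => q.Prime ∧ quadraticChar (ZMod p) (q : ZMod p) = -1),
      (((Finset.Icc 1 N).filter (q ∣ ·)).card : ℝ) ≤ N * (1 / q) := by
    intro q _
    have : (Finset.Icc 1 N).filter (q ∣ ·) = (Finset.Ioc 0 N).filter (q ∣ ·) := rfl
    rw [this, Nat.Ioc_filter_dvd_card_eq_div, mul_one_div]
    exact Nat.cast_div_le
  rw [Finset.mul_sum]
  refine le_trans ?_ (Finset.sum_le_sum h2)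
  exact_mod_cast (Finset.card_le_card h1).trans Finset.card_biUnion_le

theorem le_card_nonresidue {p : ℕ} [Fact p.Prime] {N : ℕ} (hN : N < p) {t : ℝ}
    (h : ∑ n ∈ Finset.Icc 1 N, (quadraticChar (ZMod p) (n : ZMod p) : ℝ) ≤ t) :
    ((N : ℝ) - t) / 2 ≤
      ((Finset.Icc 1 N).filter fun n : ℕ => quadraticChar (ZMod p) (n : ZMod p) = -1).card := by
  have h1 : ∑ n ∈ Finset.Icc 1 N, ((1 : ℝ) - (quadraticChar (ZMod p) (n : ZMod p) : ℝ)) =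
      ∑ n ∈ Finset.Icc 1 N, if quadraticChar (ZMod p) (n : ZMod p) = -1 then (2 : ℝ) else 0 := by
    refine Finset.sum_congr rfl fun n hn => ?_
    have hn' := Finset.mem_Icc.1 hn
    have hn0 : (n : ZMod p) ≠ 0 := by
      intro h0
      rw [ZMod.natCast_eq_zero_iff] at h0
      have := Nat.le_of_dvd hn'.1 h0
      omega
    rcases quadraticChar_dichotomy hn0 with h | h <;> rw [h] <;> norm_num
  rw [Finset.sum_sub_distrib, ← Finset.sum_filter] at h1
  simp only [Finset.sum_const, Nat.card_Icc, nsmul_eq_mul] at h1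
  push_cast [add_tsub_cancel_right] at h1
  linarith

open Filter in
/-- The argument of Vinogradov: non-residues below `p ^ θ` have positive logarithmic density among
primes as soon as `θ > 1 / (4 * √e)`. -/
theorem exists_le_sum_prime_nonresidue_inv {θ : ℝ} (hθ : 1 / (4 * Real.sqrt (Real.exp 1)) < θ)
    (hθ' : θ < 1 / 4) :
    ∃ κ : ℝ, 0 < κ ∧ ∃ p₀ : ℕ, ∀ p : ℕ, p₀ ≤ p → ∀ _ : Fact p.Prime,
      κ ≤ ∑ q ∈ (Finset.Icc 1 ⌊(p : ℝ) ^ θ⌋₊).filter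
        (fun q : ℕ => q.Prime ∧ quadraticChar (ZMod p) (q : ZMod p) = -1), (1 : ℝ) / q := by
  have hθ0 : 0 < θ := lt_trans (by positivity) hθ
  have hsq : Real.sqrt (Real.exp 1) = Real.exp (1 / 2) := by
    rw [Real.sqrt_eq_rpow, ← Real.exp_mul, one_mul]
  rw [hsq, div_lt_iff₀ (by positivity)] at hθ
  set δ := min (1 / 16) ((θ * Real.exp (1 / 2) - 1 / 4) / 2) with hδ
  have hδ0 : 0 < δ := lt_min (by norm_num) (by linarith)
  have hδ1 : δ ≤ 1 / 16 := min_le_left _ _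
  have hδ2 : 1 / 4 + δ < θ * Real.exp (1 / 2) := by
    have := min_le_right (1 / 16) ((θ * Real.exp (1 / 2) - 1 / 4) / 2)
    rw [← hδ] at this; linarith
  set ℓ := Real.log ((1 / 4 + δ) / θ) with hℓ
  have hℓ1 : ℓ < 1 / 2 := by
    rw [hℓ, Real.log_lt_iff_lt_exp (by positivity), div_lt_iff₀ hθ0]
    linarith
  have hℓ0 : 0 < ℓ := Real.log_pos (by rw [lt_div_iff₀ hθ0]; linarith)
  set κ := (1 / 2 - ℓ) / 4 with hκ
  have hκ0 : 0 < κ := by rw [hκ]; linarith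
  obtain ⟨p₁, hp₁⟩ := sum_quadraticChar_le_of_burgess hδ0 (by linarith) hκ0 (by linarith)
  have ev1 : ∀ᶠ p : ℕ in atTop, _ := tendsto_natCast_atTop_atTop.eventually
    (eventually_sum_prime_inv_le hθ0 (by linarith : θ ≤ 1 / 4 + δ) hκ0)
  have ev2 : ∀ᶠ p : ℕ in atTop, 1 / κ ≤ (p : ℝ) ^ (1 / 4 + δ) :=
    ((tendsto_rpow_atTop (by positivity : (0 : ℝ) < 1 / 4 + δ)).comp
      tendsto_natCast_atTop_atTop).eventually_ge_atTop _
  obtain ⟨p₀, hp₀⟩ := eventually_atTop.1 (ev1.and (ev2.and (eventually_ge_atTop (max 2 p₁))))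
  refine ⟨κ, hκ0, p₀, fun p hpp hp => ?_⟩
  obtain ⟨h1, h2, h3⟩ := hp₀ p hpp
  have hp2 : 2 ≤ p := (le_max_left _ _).trans h3
  have hp1 : (1 : ℝ) < p := by exact_mod_cast hp2
  have hb := hp₁ p ((le_max_right _ _).trans h3) hp
  set x : ℝ := (p : ℝ) ^ (1 / 4 + δ) with hx
  have hx1 : 1 < x := Real.one_lt_rpow hp1 (by positivity)
  have hxp : x < p := by
    calc x < (p : ℝ) ^ (1 : ℝ) := Real.rpow_lt_rpow_of_exponent_lt hp1 (by linarith)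
      _ = p := Real.rpow_one _
  have hNx : (⌊x⌋₊ : ℝ) ≤ x := Nat.floor_le (by linarith)
  have hNx2 := Nat.lt_floor_add_one x
  have h4 := le_card_nonresidue (by exact_mod_cast hNx.trans_lt hxp) hb
  have h5 := h4.trans (card_nonresidue_le _)
  set f : ℕ → ℝ := fun q => if q.Prime ∧ quadraticChar (ZMod p) (q : ZMod p) = -1 then 1 / (q : ℝ)
    else 0 with hf
  have hzw : ⌊(p : ℝ) ^ θ⌋₊ ≤ ⌊x⌋₊ :=
    Nat.floor_mono (Real.rpow_le_rpow_of_exponent_le hp1.le (by linarith))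
  have h6 : ∑ q ∈ Finset.Icc 1 ⌊x⌋₊, f q = ∑ q ∈ Finset.Icc 1 ⌊(p : ℝ) ^ θ⌋₊, f q +
      ∑ q ∈ Finset.Ioc ⌊(p : ℝ) ^ θ⌋₊ ⌊x⌋₊, f q :=
    (Finset.sum_Ioc_consecutive f (Nat.zero_le _) hzw).symm
  have h7 : ∑ q ∈ Finset.Ioc ⌊(p : ℝ) ^ θ⌋₊ ⌊x⌋₊, f q ≤ ℓ + κ := by
    refine le_trans ?_ h1
    rw [Finset.sum_filter]
    refine Finset.sum_le_sum fun q _ => ?_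
    by_cases hq : q.Prime
    · simp only [hf, hq, true_and, if_true]
      split_ifs
      · exact le_rfl
      · positivity
    · simp [hf, hq]
  rw [Finset.sum_filter] at h5 ⊢
  set S := ∑ q ∈ Finset.Icc 1 ⌊(p : ℝ) ^ θ⌋₊, f q with hS
  change _ ≤ _ * ∑ q ∈ Finset.Icc 1 ⌊x⌋₊, f q at h5
  change κ ≤ S
  rw [h6] at h5
  have hS0 : 0 ≤ S := Finset.sum_nonneg fun q _ => by simp only [hf]; split_ifs <;> positivity
  have h8 : (⌊x⌋₊ : ℝ) * (S + ∑ q ∈ Finset.Ioc ⌊(p : ℝ) ^ θ⌋₊ ⌊x⌋₊, f q) ≤ x * (S + (ℓ + κ)) := by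
    have : 0 ≤ S + (ℓ + κ) := by positivity
    gcongr
  rw [div_le_iff₀ hκ0] at h2
  have h9 : x * (1 / 2 - κ - ℓ - κ) ≤ x * S := by linarith
  have := le_of_mul_le_mul_left h9 (by linarith)
  linarith

theorem card_le_mul_card_of_mul_mem {P : Finset (ℕ × ℕ)} {t : Finset ℕ} {D : ℕ}
    (hP : ∀ x ∈ P, x.1 * x.2 ∈ t) (ht : ∀ n ∈ t, n ≠ 0 ∧ n.divisors.card ≤ D) :
    P.card ≤ D * t.card := by
  refine Finset.card_le_mul_card_image_of_maps_to (f := fun x : ℕ × ℕ => x.1 * x.2) hP D ?_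
  intro n hn
  refine le_trans ?_ (ht n hn).2
  refine Finset.card_le_card_of_injOn Prod.fst ?_ ?_
  · intro x hx
    have h := (Finset.mem_filter.1 hx).2
    exact Nat.mem_divisors.2 ⟨⟨x.2, h.symm⟩, (ht n hn).1⟩
  · intro x hx y hy hxy
    have h1 := (Finset.mem_filter.1 hx).2
    have h2 := (Finset.mem_filter.1 hy).2
    have hx0 : x.1 ≠ 0 := by
      rintro h0
      rw [h0, zero_mul] at h1
      exact (ht n hn).1 h1.symm
    rw [← hxy, ← h1] at h2
    exact Prod.ext hxy (Nat.eq_of_mul_eq_mul_left (Nat.pos_of_ne_zero hx0) h2.symm)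

theorem natCast_ne_zero_of_pos_of_lt {p n : ℕ} (h0 : 0 < n) (h1 : n < p) : (n : ZMod p) ≠ 0 := by
  intro h
  rw [ZMod.natCast_eq_zero_iff] at h
  exact absurd (Nat.le_of_dvd h0 h) (by omega)

/-- Quadratic residues are abundant in every interval `(y, 4 * y]`. -/
theorem exists_le_card_residue {ε : ℝ} (hε : 0 < ε) :
    ∃ c : ℝ, 0 < c ∧ ∀ p : ℕ, ∀ _ : Fact p.Prime, ∀ y : ℝ, 1 ≤ y → 4 * y < p →
      c * y ^ (1 - ε) ≤ ((Finset.Ioc ⌊y⌋₊ ⌊4 * y⌋₊).filter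
        fun k : ℕ => quadraticChar (ZMod p) (k : ZMod p) = 1).card := by
  obtain ⟨C, hC1, hC⟩ := exists_card_divisors_le_mul_rpow hε
  have hC0 : 0 < C := by linarith
  refine ⟨1 / (16 * (C * 4 ^ ε)), by positivity, fun p hp y hy hyp => ?_⟩
  have hy0 : 0 < y := by linarith
  set s := √y with hs
  have hs1 : 1 ≤ s := Real.one_le_sqrt.2 hy
  have hss : s * s = y := Real.mul_self_sqrt hy0.le
  set U := Finset.Ioc ⌊s⌋₊ ⌊2 * s⌋₊ with hU
  have hUmem : ∀ u ∈ U, s < u ∧ (u : ℝ) ≤ 2 * s := by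
    intro u hu
    rw [hU, Finset.mem_Ioc] at hu
    exact ⟨Nat.lt_of_floor_lt hu.1, (Nat.le_floor_iff (by positivity)).1 hu.2⟩
  have hUcard : s / 2 ≤ (U.card : ℝ) := by
    have h1 := Nat.lt_floor_add_one (2 * s)
    have h2 := Nat.floor_le (by positivity : 0 ≤ s)
    have h3 : ⌊s⌋₊ + 1 ≤ ⌊2 * s⌋₊ := by
      refine Nat.le_floor ?_
      push_cast
      linarith
    rw [hU, Nat.card_Ioc, Nat.cast_sub (by omega)]
    have h4 : ((⌊s⌋₊ + 1 : ℕ) : ℝ) ≤ (⌊2 * s⌋₊ : ℕ) := by exact_mod_cast h3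
    push_cast at h4
    linarith
  have hχ : ∀ u ∈ U, quadraticChar (ZMod p) (u : ZMod p) = 1 ∨
      quadraticChar (ZMod p) (u : ZMod p) = -1 := by
    intro u hu
    obtain ⟨h1, h2⟩ := hUmem u hu
    refine quadraticChar_dichotomy (natCast_ne_zero_of_pos_of_lt ?_ ?_)
    · have : (0 : ℝ) < u := by linarith
      exact_mod_cast this
    · have : (u : ℝ) < p := by nlinarith
      exact_mod_cast this
  have hexists : ∃ τ : ℤ, τ * τ = 1 ∧
      s / 4 ≤ ((U.filter fun u : ℕ => quadraticChar (ZMod p) (u : ZMod p) = τ).card : ℝ) := by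
    have h1 : U.card ≤ (U.filter fun u : ℕ => quadraticChar (ZMod p) (u : ZMod p) = 1).card +
        (U.filter fun u : ℕ => quadraticChar (ZMod p) (u : ZMod p) = -1).card := by
      refine le_trans (Finset.card_le_card ?_) (Finset.card_union_le _ _)
      intro u hu
      rw [Finset.mem_union, Finset.mem_filter, Finset.mem_filter]
      exact (hχ u hu).imp (fun h => ⟨hu, h⟩) fun h => ⟨hu, h⟩
    have h2 : (U.card : ℝ) ≤
        ((U.filter fun u : ℕ => quadraticChar (ZMod p) (u : ZMod p) = 1).card : ℝ) +
        ((U.filter fun u : ℕ => quadraticChar (ZMod p) (u : ZMod p) = -1).card : ℝ) := by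
      exact_mod_cast h1
    by_cases h : s / 4 ≤ ((U.filter fun u : ℕ => quadraticChar (ZMod p) (u : ZMod p) = 1).card : ℝ)
    · exact ⟨1, rfl, h⟩
    · exact ⟨-1, rfl, by push Not at h; linarith⟩
  obtain ⟨τ, hτ, hV⟩ := hexists
  set V := U.filter fun u : ℕ => quadraticChar (ZMod p) (u : ZMod p) = τ with hVdef
  set D := ⌊C * (4 * y) ^ ε⌋₊ with hD
  have hcount : (V ×ˢ V).card ≤ D * ((Finset.Ioc ⌊y⌋₊ ⌊4 * y⌋₊).filter
        fun k : ℕ => quadraticChar (ZMod p) (k : ZMod p) = 1).card := by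
    refine card_le_mul_card_of_mul_mem ?_ ?_
    · rintro ⟨u, v⟩ huv
      obtain ⟨hu, hv⟩ := Finset.mem_product.1 huv
      obtain ⟨hu1, hu2⟩ := Finset.mem_filter.1 hu
      obtain ⟨hv1, hv2⟩ := Finset.mem_filter.1 hv
      obtain ⟨a1, a2⟩ := hUmem u hu1
      obtain ⟨b1, b2⟩ := hUmem v hv1
      simp only [Finset.mem_filter, Finset.mem_Ioc]
      refine ⟨⟨?_, ?_⟩, ?_⟩
      · rw [Nat.floor_lt hy0.le, ← hss]
        push_cast
        exact mul_lt_mul'' a1 b1 (by positivity) (by positivity)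
      · refine Nat.le_floor ?_
        push_cast
        calc (u : ℝ) * v ≤ (2 * s) * (2 * s) := by gcongr
          _ = 4 * y := by rw [← hss]; ring
      · rw [Nat.cast_mul, map_mul]
        exact (congrArg₂ (· * ·) hu2 hv2).trans hτ
    · intro n hn
      have hn1 := Finset.mem_Ioc.1 (Finset.mem_filter.1 hn).1
      have hn0 : n ≠ 0 := by omega
      refine ⟨hn0, Nat.le_floor ((hC n hn0).trans ?_)⟩
      have : (n : ℝ) ≤ 4 * y := (Nat.le_floor_iff (by positivity)).1 hn1.2
      gcongr
  set R := ((Finset.Ioc ⌊y⌋₊ ⌊4 * y⌋₊).filter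
        fun k : ℕ => quadraticChar (ZMod p) (k : ZMod p) = 1).card with hR
  have h1 : (V.card : ℝ) * V.card ≤ D * R := by
    rw [Finset.card_product] at hcount
    exact_mod_cast hcount
  have h2 : (D : ℝ) ≤ C * (4 * y) ^ ε := Nat.floor_le (by positivity)
  have h3 : y / 16 ≤ C * 4 ^ ε * y ^ ε * R := by
    calc y / 16 = s / 4 * (s / 4) := by rw [← hss]; ring
      _ ≤ V.card * V.card := by gcongr
      _ ≤ D * R := h1
      _ ≤ C * (4 * y) ^ ε * R := by gcongr
      _ = _ := by rw [Real.mul_rpow (by norm_num) hy0.le]; ring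
  rw [Real.rpow_sub hy0, Real.rpow_one, one_div_mul_eq_div, div_div, div_le_iff₀ (by positivity)]
  linarith

/-- If non-residues have positive logarithmic density among the primes up to `Q`, then they are
abundant in `(Q, 4 * Q]`. -/
theorem exists_le_card_nonresidue {ε : ℝ} (hε : 0 < ε) (hε1 : ε ≤ 1) :
    ∃ c : ℝ, 0 < c ∧ ∀ p : ℕ, ∀ _ : Fact p.Prime, ∀ Q : ℕ, 4 * Q < p → ∀ κ : ℝ,
      κ ≤ ∑ q ∈ (Finset.Icc 1 Q).filter
        (fun q : ℕ => q.Prime ∧ quadraticChar (ZMod p) (q : ZMod p) = -1), (1 : ℝ) / q →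
      c * κ * (Q : ℝ) ^ (1 - ε) ≤ ((Finset.Ioc Q (4 * Q)).filter
        fun k : ℕ => quadraticChar (ZMod p) (k : ZMod p) = -1).card := by
  obtain ⟨C, hC1, hC⟩ := exists_card_divisors_le_mul_rpow (half_pos hε)
  obtain ⟨c, hc0, hc⟩ := exists_le_card_residue (half_pos hε)
  have hC0 : 0 < C := by linarith
  refine ⟨c / (C * 4 ^ (ε / 2)), by positivity, fun p hp Q hQp κ hκ => ?_⟩
  set A := (Finset.Icc 1 Q).filter
        (fun q : ℕ => q.Prime ∧ quadraticChar (ZMod p) (q : ZMod p) = -1) with hA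
  have hAmem : ∀ q ∈ A, (1 : ℝ) ≤ q ∧ (q : ℝ) ≤ Q ∧ quadraticChar (ZMod p) (q : ZMod p) = -1 := by
    intro q hq
    obtain ⟨h1, h2⟩ := Finset.mem_filter.1 hq
    rw [Finset.mem_Icc] at h1
    exact ⟨by exact_mod_cast h1.1, by exact_mod_cast h1.2, h2.2⟩
  rcases Nat.eq_zero_or_pos Q with rfl | hQ
  · rcases eq_or_lt_of_le hε1 with rfl | h
    · simp [A] at hκ
      simp
      exact mul_nonpos_of_nonneg_of_nonpos (by positivity) hκ
    · simp [Real.zero_rpow (by linarith : 1 - ε ≠ 0)]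
  have hQ0 : (0 : ℝ) < Q := by exact_mod_cast hQ
  have hQp' : (4 : ℝ) * Q < p := by exact_mod_cast hQp
  let R : ℕ → Finset ℕ := fun q => (Finset.Ioc ⌊(Q : ℝ) / q⌋₊ ⌊4 * ((Q : ℝ) / q)⌋₊).filter
    fun k : ℕ => quadraticChar (ZMod p) (k : ZMod p) = 1
  have hRcard : ∀ q ∈ A, c * ((Q : ℝ) ^ (1 - ε / 2) * (1 / q)) ≤ (R q).card := by
    intro q hq
    obtain ⟨h1, h2, -⟩ := hAmem q hq
    have hq0 : (0 : ℝ) < q := by linarith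
    have hle : (Q : ℝ) / q ≤ Q := div_le_self hQ0.le h1
    have := hc p hp ((Q : ℝ) / q) ((one_le_div hq0).2 h2) (by linarith)
    refine le_trans ?_ this
    rw [Real.div_rpow hQ0.le hq0.le, mul_one_div]
    gcongr
    calc (q : ℝ) ^ (1 - ε / 2) ≤ (q : ℝ) ^ (1 : ℝ) :=
          Real.rpow_le_rpow_of_exponent_le h1 (by linarith)
      _ = q := Real.rpow_one _
  set T := (Finset.Ioc Q (4 * Q)).filter
        fun k : ℕ => quadraticChar (ZMod p) (k : ZMod p) = -1 with hT
  set D := ⌊C * (4 * (Q : ℝ)) ^ (ε / 2)⌋₊ with hD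
  have hcount : ((A.sigma R).image fun x => (x.1, x.2)).card ≤ D * T.card := by
    refine card_le_mul_card_of_mul_mem ?_ ?_
    · intro x hx
      obtain ⟨⟨q, k⟩, hqk, rfl⟩ := Finset.mem_image.1 hx
      obtain ⟨hq, hk⟩ := Finset.mem_sigma.1 hqk
      obtain ⟨h1, h2, h3⟩ := hAmem q hq
      obtain ⟨hk1, hk2⟩ := Finset.mem_filter.1 hk
      have hq0 : (0 : ℝ) < q := by linarith
      rw [Finset.mem_Ioc, Nat.floor_lt (by positivity), Nat.le_floor_iff (by positivity),
        div_lt_iff₀ hq0, ← mul_div_assoc, le_div_iff₀ hq0] at hk1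
      simp only [hT, Finset.mem_filter, Finset.mem_Ioc]
      refine ⟨⟨?_, ?_⟩, ?_⟩
      · have : (Q : ℝ) < q * k := by linarith [hk1.1]
        exact_mod_cast this
      · have : (q : ℝ) * k ≤ 4 * Q := by linarith [hk1.2]
        exact_mod_cast this
      · rw [Nat.cast_mul, map_mul]
        exact (congrArg₂ (· * ·) h3 hk2).trans (by norm_num)
    · intro n hn
      have hn1 := Finset.mem_Ioc.1 (Finset.mem_filter.1 hn).1
      have hn0 : n ≠ 0 := by omega
      refine ⟨hn0, Nat.le_floor ((hC n hn0).trans ?_)⟩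
      have : (n : ℝ) ≤ 4 * Q := by exact_mod_cast hn1.2
      gcongr
  rw [Finset.card_image_of_injective _ (by rintro ⟨a, b⟩ ⟨a', b'⟩ h; simpa using h),
    Finset.card_sigma] at hcount
  have h1 : c * ((Q : ℝ) ^ (1 - ε / 2) * κ) ≤ D * T.card := by
    calc c * ((Q : ℝ) ^ (1 - ε / 2) * κ) ≤ c * ((Q : ℝ) ^ (1 - ε / 2) * ∑ q ∈ A, (1 : ℝ) / q) := by
          gcongr
      _ = ∑ q ∈ A, c * ((Q : ℝ) ^ (1 - ε / 2) * (1 / q)) := by rw [Finset.mul_sum, Finset.mul_sum]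
      _ ≤ ∑ q ∈ A, ((R q).card : ℝ) := Finset.sum_le_sum hRcard
      _ ≤ D * T.card := by exact_mod_cast hcount
  have h2 : (D : ℝ) ≤ C * (4 * Q) ^ (ε / 2) := Nat.floor_le (by positivity)
  have h3 : c * ((Q : ℝ) ^ (1 - ε / 2) * κ) ≤ C * (4 * Q) ^ (ε / 2) * T.card :=
    h1.trans (by gcongr)
  have h4 : (Q : ℝ) ^ (1 - ε / 2) = (Q : ℝ) ^ (1 - ε) * (Q : ℝ) ^ (ε / 2) := by
    rw [← Real.rpow_add hQ0]; congr 1; ring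
  rw [Real.mul_rpow (by norm_num) hQ0.le, h4] at h3
  rw [div_mul_eq_mul_div, div_mul_eq_mul_div, div_le_iff₀ (by positivity)]
  refine le_of_mul_le_mul_right ?_ (by positivity : 0 < (Q : ℝ) ^ (ε / 2))
  linarith

/-- The additive character `x ↦ exp (2 * π * i * x)` of `ℝ`. -/
noncomputable def expTwoPi (x : ℝ) : ℂ := Complex.exp (((2 * Real.pi * x : ℝ) : ℂ) * Complex.I)

theorem expTwoPi_add (x y : ℝ) : expTwoPi (x + y) = expTwoPi x * expTwoPi y := by
  rw [expTwoPi, expTwoPi, expTwoPi, ← Complex.exp_add]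
  congr 1
  push_cast
  ring

theorem norm_expTwoPi (x : ℝ) : ‖expTwoPi x‖ = 1 := Complex.norm_exp_ofReal_mul_I _

theorem expTwoPi_intCast (n : ℤ) : expTwoPi n = 1 := by
  rw [expTwoPi, Complex.exp_eq_one_iff]
  exact ⟨n, by push_cast; ring⟩

theorem conj_expTwoPi (x : ℝ) : (starRingEnd ℂ) (expTwoPi x) = expTwoPi (-x) := by
  rw [expTwoPi, expTwoPi, ← Complex.exp_conj, map_mul, Complex.conj_ofReal, Complex.conj_I]
  congr 1
  push_cast
  ring

theorem one_sub_expTwoPi_mul {x : ℝ} (hx : Real.sin (Real.pi * x) ≠ 0) :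
    (1 - expTwoPi x) * (1 / 2 + ((Real.cos (Real.pi * x) / (2 * Real.sin (Real.pi * x)) : ℝ) : ℂ)
      * Complex.I) = 1 := by
  set θ := Real.pi * x with hθ
  have h1 : expTwoPi x = (Real.cos (2 * θ) : ℂ) + (Real.sin (2 * θ) : ℂ) * Complex.I := by
    rw [expTwoPi, show 2 * Real.pi * x = 2 * θ by rw [hθ]; ring, Complex.exp_mul_I,
      Complex.ofReal_cos, Complex.ofReal_sin]
  have hs := Real.sin_sq_add_cos_sq θ
  rw [h1, Real.cos_two_mul, Real.sin_two_mul]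
  generalize Real.cos θ = k at *
  generalize Real.sin θ = s at *
  have hd : ∀ t : ℝ, (1 - (((2 * k ^ 2 - 1 : ℝ) : ℂ) + ((2 * s * k : ℝ) : ℂ) * Complex.I)) *
      (1 / 2 + (t : ℂ) * Complex.I) =
      ((1 - k ^ 2 + 2 * s * k * t : ℝ) : ℂ) +
      ((2 * (1 - k ^ 2) * t - s * k : ℝ) : ℂ) * Complex.I := by
    intro t
    push_cast
    linear_combination (-2 * s * k * t : ℂ) * Complex.I_sq
  rw [hd, show 1 - k ^ 2 = s ^ 2 by linarith]
  have e1 : s ^ 2 + 2 * s * k * (k / (2 * s)) = 1 := by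
    field_simp; linarith
  have e2 : 2 * s ^ 2 * (k / (2 * s)) - s * k = 0 := by
    field_simp; ring
  rw [e1, e2]
  simp

theorem sum_range_mul_sub_succ (c E : ℕ → ℂ) (M : ℕ) :
    ∑ n ∈ Finset.range (M + 1), c n * (E n - E (n + 1)) =
      c 0 * E 0 - c M * E (M + 1) + ∑ n ∈ Finset.range M, (c (n + 1) - c n) * E (n + 1) := by
  induction M with
  | zero => simp; ring
  | succ M ih => rw [Finset.sum_range_succ, ih, Finset.sum_range_succ]; ring

/-- The Kusmin–Landau inequality, in discrete form. -/
theorem norm_sum_expTwoPi_le_of_range (f : ℕ → ℝ) {M : ℕ} {δ : ℝ} (hδ : 0 < δ) (j : ℤ)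
    (h1 : ∀ n < M, j + δ ≤ f (n + 1) - f n) (h2 : ∀ n < M, f (n + 1) - f n ≤ j + 1 - δ)
    (hmono : ∀ n, n + 1 < M → f (n + 1) - f n ≤ f (n + 2) - f (n + 1)) :
    ‖∑ n ∈ Finset.range M, expTwoPi (f n)‖ ≤ 1 / δ := by
  rcases M with _ | M
  · simp only [Finset.range_zero, Finset.sum_empty, norm_zero]; positivity
  set g : ℕ → ℝ := fun n => f (n + 1) - f n - j with hg
  have hg1 : ∀ n < M + 1, δ ≤ g n := fun n hn => by have := h1 n hn; simp only [hg]; linarith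
  have hg2 : ∀ n < M + 1, g n ≤ 1 - δ := fun n hn => by have := h2 n hn; simp only [hg]; linarith
  have hsin : ∀ n < M + 1, 2 * δ ≤ Real.sin (Real.pi * g n) := by
    intro n hn
    have a1 := hg1 n hn
    have a2 := hg2 n hn
    rcases le_total (g n) (1 / 2) with h | h
    · have := Real.mul_le_sin (x := Real.pi * g n) (by have := Real.pi_pos; nlinarith)
        (by have := Real.pi_pos; nlinarith)
      refine le_trans ?_ this
      rw [← mul_assoc, div_mul_cancel₀ _ Real.pi_ne_zero]; linarith
    · have := Real.mul_le_sin (x := Real.pi * (1 - g n)) (by have := Real.pi_pos; nlinarith)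
        (by have := Real.pi_pos; nlinarith)
      rw [show Real.pi * (1 - g n) = Real.pi - Real.pi * g n by ring, Real.sin_pi_sub] at this
      refine le_trans ?_ this
      have : 2 / Real.pi * (Real.pi - Real.pi * g n) = 2 * (1 - g n) := by
        field_simp
      rw [this]; linarith
  set y : ℕ → ℝ := fun n => Real.cos (Real.pi * g n) / (2 * Real.sin (Real.pi * g n)) with hy
  set c : ℕ → ℂ := fun n => 1 / 2 + (y n : ℂ) * Complex.I with hc
  set E : ℕ → ℂ := fun n => expTwoPi (f n) with hE
  have hEg : ∀ n, E (n + 1) = E n * expTwoPi (g n) := by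
    intro n
    have : f (n + 1) = f n + g n + j := by simp only [hg]; ring
    simp only [hE]
    rw [this, expTwoPi_add, expTwoPi_add, expTwoPi_intCast, mul_one]
  have hcE : ∀ n < M + 1, E n = c n * (E n - E (n + 1)) := by
    intro n hn
    have h3 := one_sub_expTwoPi_mul (x := g n) (by have := hsin n hn; linarith)
    change (1 - expTwoPi (g n)) * c n = 1 at h3
    rw [hEg]
    linear_combination (-E n) * h3
  have hyb : ∀ n < M + 1, |y n| ≤ 1 / (4 * δ) := by
    intro n hn
    have h3 := hsin n hn
    simp only [hy]
    rw [abs_div, abs_of_pos (by linarith : 0 < 2 * Real.sin (Real.pi * g n))]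
    exact div_le_div₀ zero_le_one (Real.abs_cos_le_one _) (by positivity) (by linarith)
  have hδ1 : δ ≤ 1 / 2 := by
    have := hg1 0 (by omega); have := hg2 0 (by omega); linarith
  have hcb : ∀ n < M + 1, ‖c n‖ ≤ 1 / (4 * δ) := by
    intro n hn
    have h3 := one_sub_expTwoPi_mul (x := g n) (by have := hsin n hn; linarith)
    change (1 - expTwoPi (g n)) * c n = 1 at h3
    have hsq : ‖c n‖ ^ 2 = (1 / (2 * Real.sin (Real.pi * g n))) ^ 2 := by
      have hq : ∀ t : ℝ, Complex.normSq (1 / 2 + (t : ℂ) * Complex.I) = 1 / 4 + t ^ 2 := by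
        intro t
        rw [Complex.normSq_apply]
        simp
        ring
      rw [← Complex.normSq_eq_norm_sq]
      simp only [hc, hy]
      rw [hq]
      have := hsin n hn
      have hs0 : Real.sin (Real.pi * g n) ≠ 0 := by linarith
      field_simp
      norm_num
      linear_combination 4 * Real.sin_sq_add_cos_sq (Real.pi * g n)
    have h4 : ‖c n‖ = 1 / (2 * Real.sin (Real.pi * g n)) := by
      have := hsin n hn
      exact (sq_eq_sq₀ (norm_nonneg _) (one_div_nonneg.2 (by linarith))).1 hsq
    rw [h4]
    have := hsin n hn
    exact one_div_le_one_div_of_le (by positivity) (by linarith)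
  have hanti : ∀ n < M, y (n + 1) ≤ y n := by
    intro n hn
    have s1 := hsin n (by omega)
    have s2 := hsin (n + 1) (by omega)
    have m : g n ≤ g (n + 1) := by have := hmono n (by omega); simp only [hg]; linarith
    have a1 := hg1 n (by omega)
    have a2 := hg2 (n + 1) (by omega)
    have s3 : 0 ≤ Real.sin (Real.pi * g (n + 1) - Real.pi * g n) :=
      Real.sin_nonneg_of_nonneg_of_le_pi (by have := Real.pi_pos; nlinarith)
        (by have := Real.pi_pos; nlinarith)
    rw [Real.sin_sub] at s3
    simp only [hy]
    rw [div_le_div_iff₀ (by linarith) (by linarith)]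
    linarith
  have hsum : ∑ n ∈ Finset.range (M + 1), E n =
      c 0 * E 0 - c M * E (M + 1) + ∑ n ∈ Finset.range M, (c (n + 1) - c n) * E (n + 1) := by
    rw [← sum_range_mul_sub_succ]
    exact Finset.sum_congr rfl fun n hn => hcE n (Finset.mem_range.1 hn)
  have hvar : ‖∑ n ∈ Finset.range M, (c (n + 1) - c n) * E (n + 1)‖ ≤ y 0 - y M := by
    refine (norm_sum_le _ _).trans ?_
    rw [← Finset.sum_range_sub' y M]
    refine Finset.sum_le_sum fun n hn => ?_
    have : c (n + 1) - c n = ((y (n + 1) - y n : ℝ) : ℂ) * Complex.I := by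
      simp only [hc]; push_cast; ring
    rw [norm_mul, this, norm_mul, Complex.norm_I, Complex.norm_real, norm_expTwoPi, mul_one,
      mul_one, Real.norm_eq_abs, abs_of_nonpos (by linarith [hanti n (Finset.mem_range.1 hn)])]
    linarith
  have b1 := hcb 0 (by omega)
  have b2 := hcb M (by omega)
  have b3 := abs_le.1 (hyb 0 (by omega))
  have b4 := abs_le.1 (hyb M (by omega))
  change ‖∑ n ∈ Finset.range (M + 1), E n‖ ≤ _
  rw [hsum]
  have b5 : ‖c 0 * E 0‖ ≤ 1 / (4 * δ) := by rw [norm_mul, norm_expTwoPi, mul_one]; exact b1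
  have b6 : ‖c M * E (M + 1)‖ ≤ 1 / (4 * δ) := by rw [norm_mul, norm_expTwoPi, mul_one]; exact b2
  have b7 : 1 / δ = 1 / (4 * δ) + 1 / (4 * δ) + (1 / (4 * δ) + 1 / (4 * δ)) := by
    field_simp; norm_num
  rw [b7]
  refine (norm_add_le _ _).trans (add_le_add ((norm_sub_le _ _).trans (add_le_add b5 b6)) ?_)
  linarith [b3.2, b4.1]

theorem sub_bounds_of_succ_sub_bounds {g : ℕ → ℝ} {lam mu : ℝ} {M : ℕ}
    (h : ∀ n < M, lam ≤ g (n + 1) - g n ∧ g (n + 1) - g n ≤ mu) (m k : ℕ) (hmk : m + k ≤ M) :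
    lam * k ≤ g (m + k) - g m ∧ g (m + k) - g m ≤ mu * k := by
  induction k with
  | zero => simp
  | succ k ih =>
    obtain ⟨h1, h2⟩ := ih (by omega)
    obtain ⟨h3, h4⟩ := h (m + k) (by omega)
    rw [← add_assoc]
    push_cast
    constructor <;> linarith

theorem card_filter_mem_Icc_le {g : ℕ → ℝ} {lam mu : ℝ} {M : ℕ} (hlam : 0 < lam)
    (h : ∀ n < M, lam ≤ g (n + 1) - g n ∧ g (n + 1) - g n ≤ mu) {u δ : ℝ} (hδ : 0 ≤ δ) :
    (((Finset.range M).filter fun n => u ≤ g n ∧ g n ≤ u + δ).card : ℝ) ≤ δ / lam + 1 := by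
  set s := (Finset.range M).filter fun n => u ≤ g n ∧ g n ≤ u + δ with hs
  rcases s.eq_empty_or_nonempty with h0 | h0
  · rw [h0]; simp; positivity
  · have ha := Finset.mem_filter.1 (s.min'_mem h0)
    have hb := Finset.mem_filter.1 (s.max'_mem h0)
    set a := s.min' h0
    set b := s.max' h0
    have hab : a ≤ b := s.min'_le_max' h0
    have h1 : s ⊆ Finset.Icc a b := fun n hn =>
      Finset.mem_Icc.2 ⟨s.min'_le n hn, s.le_max' n hn⟩
    have h2 := Finset.card_le_card h1
    rw [Nat.card_Icc] at h2
    obtain ⟨k, hk⟩ := Nat.exists_eq_add_of_le hab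
    have h3 : (s.card : ℝ) ≤ k + 1 := by exact_mod_cast (by omega : s.card ≤ k + 1)
    have h4 := (sub_bounds_of_succ_sub_bounds h a k
      (by have := Finset.mem_range.1 hb.1; omega)).1
    rw [← hk] at h4
    have h5 : (k : ℝ) ≤ δ / lam := by
      rw [le_div_iff₀ hlam]; linarith [hb.2.2, ha.2.1]
    linarith

theorem norm_sum_filter_le {f : ℕ → ℝ} {lam mu : ℝ} {M : ℕ} (hlam : 0 < lam)
    (h : ∀ n < M, lam ≤ (f (n + 2) - f (n + 1)) - (f (n + 1) - f n) ∧
      (f (n + 2) - f (n + 1)) - (f (n + 1) - f n) ≤ mu) {δ : ℝ} (hδ : 0 < δ) (j : ℤ) :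
    ‖∑ n ∈ (Finset.range M).filter fun n => j + δ ≤ f (n + 1) - f n ∧ f (n + 1) - f n ≤ j + 1 - δ,
      expTwoPi (f n)‖ ≤ 1 / δ := by
  set g : ℕ → ℝ := fun n => f (n + 1) - f n with hg
  set s := (Finset.range M).filter fun n => j + δ ≤ g n ∧ g n ≤ j + 1 - δ with hs
  rcases s.eq_empty_or_nonempty with h0 | h0
  · rw [h0]; simp; positivity
  · have ha := Finset.mem_filter.1 (s.min'_mem h0)
    have hb := Finset.mem_filter.1 (s.max'_mem h0)
    set a := s.min' h0
    set b := s.max' h0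
    have hab : a ≤ b := s.min'_le_max' h0
    have hbM := Finset.mem_range.1 hb.1
    have hmono : ∀ m k, m + k < M → g m ≤ g (m + k) := by
      intro m k hmk
      have := (sub_bounds_of_succ_sub_bounds (g := g) h m k hmk.le).1
      have : 0 ≤ lam * k := by positivity
      linarith
    have h1 : s = Finset.Ico a (b + 1) := by
      ext n
      rw [Finset.mem_Ico]
      constructor
      · intro hn
        exact ⟨s.min'_le n hn, Nat.lt_succ_of_le (s.le_max' n hn)⟩
      · rintro ⟨h2, h3⟩
        obtain ⟨k, hk⟩ := Nat.exists_eq_add_of_le h2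
        obtain ⟨l, hl⟩ := Nat.exists_eq_add_of_le (Nat.le_of_lt_succ h3)
        refine Finset.mem_filter.2 ⟨Finset.mem_range.2 (by omega), ?_, ?_⟩
        · rw [hk]; exact ha.2.1.trans (hmono a k (by omega))
        · refine le_trans ?_ hb.2.2
          rw [hl]; exact hmono n l (by omega)
    have hmem : ∀ n < b + 1 - a, a + n ∈ s := by
      intro n hn
      rw [h1, Finset.mem_Ico]; omega
    rw [h1, Finset.sum_Ico_eq_sum_range]
    refine norm_sum_expTwoPi_le_of_range (fun n => f (a + n)) hδ j ?_ ?_ ?_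
    · intro n hn; exact (Finset.mem_filter.1 (hmem n hn)).2.1
    · intro n hn; exact (Finset.mem_filter.1 (hmem n hn)).2.2
    · intro n hn
      have := (h (a + n) (by omega)).1
      change f (a + n + 1) - f (a + n) ≤ f (a + n + 2) - f (a + n + 1)
      linarith

/-- Van der Corput's second difference test. -/
theorem norm_sum_expTwoPi_le_of_second_diff {f : ℕ → ℝ} {lam mu : ℝ} {M : ℕ} (hlam : 0 < lam)
    (h : ∀ n < M, lam ≤ (f (n + 2) - f (n + 1)) - (f (n + 1) - f n) ∧
      (f (n + 2) - f (n + 1)) - (f (n + 1) - f n) ≤ mu) :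
    ‖∑ n ∈ Finset.range M, expTwoPi (f n)‖ ≤ (mu * M + 2) * (3 / √lam + 2) := by
  classical
  set g : ℕ → ℝ := fun n => f (n + 1) - f n with hg
  set δ := √lam with hδ
  have hδ0 : 0 < δ := Real.sqrt_pos.2 hlam
  set J := (Finset.range M).image fun n => ⌊g n⌋ with hJ
  have hJcard : (J.card : ℝ) ≤ mu * M + 2 := by
    have h1 : J ⊆ Finset.Icc ⌊g 0⌋ ⌊g M⌋ := by
      intro j hj
      obtain ⟨n, hn, rfl⟩ := Finset.mem_image.1 hj
      have hnM := Finset.mem_range.1 hn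
      obtain ⟨k, hk⟩ := Nat.exists_eq_add_of_le hnM.le
      have h2 := (sub_bounds_of_succ_sub_bounds (g := g) h 0 n (by omega)).1
      have h3 := (sub_bounds_of_succ_sub_bounds (g := g) h n k (by omega)).1
      rw [zero_add] at h2
      rw [← hk] at h3
      have : 0 ≤ lam * n := by positivity
      have : 0 ≤ lam * k := by positivity
      exact Finset.mem_Icc.2 ⟨Int.floor_mono (by linarith), Int.floor_mono (by linarith)⟩
    have h2 := Finset.card_le_card h1
    have h3 := (sub_bounds_of_succ_sub_bounds (g := g) h 0 M (by omega))
    rw [zero_add] at h3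
    have h4 : ⌊g 0⌋ ≤ ⌊g M⌋ := Int.floor_mono (by
      have : 0 ≤ lam * M := by positivity
      linarith [h3.1])
    have h5 : (J.card : ℤ) ≤ ⌊g M⌋ + 1 - ⌊g 0⌋ := by
      rw [Int.card_Icc] at h2; omega
    have h6 : (J.card : ℝ) ≤ ⌊g M⌋ + 1 - ⌊g 0⌋ := by exact_mod_cast h5
    have := Int.floor_le (g M)
    have := Int.lt_floor_add_one (g 0)
    linarith [h3.2]
  rw [← Finset.sum_fiberwise_of_maps_to (s := Finset.range M) (t := J) (g := fun n => ⌊g n⌋)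
    (fun n hn => Finset.mem_image_of_mem _ hn)]
  have hfib : ∀ j ∈ J, ‖∑ n ∈ (Finset.range M).filter (fun n => ⌊g n⌋ = j), expTwoPi (f n)‖ ≤
      3 / δ + 2 := by
    intro j _
    rw [← Finset.sum_filter_add_sum_filter_not _ (fun n => j + δ ≤ g n ∧ g n ≤ j + 1 - δ)]
    refine (norm_add_le _ _).trans ?_
    have e1 : ((Finset.range M).filter (fun n => ⌊g n⌋ = j)).filter
        (fun n => j + δ ≤ g n ∧ g n ≤ j + 1 - δ) =
        (Finset.range M).filter (fun n => j + δ ≤ g n ∧ g n ≤ j + 1 - δ) := by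
      rw [Finset.filter_filter]
      refine Finset.filter_congr fun n _ => ?_
      constructor
      · exact fun h => h.2
      · rintro ⟨h1, h2⟩
        exact ⟨Int.floor_eq_iff.2 ⟨by linarith, by linarith⟩, h1, h2⟩
    have b1 := norm_sum_filter_le hlam h hδ0 j
    rw [e1]
    have b2 : ‖∑ n ∈ ((Finset.range M).filter (fun n => ⌊g n⌋ = j)).filter
        (fun n => ¬ (j + δ ≤ g n ∧ g n ≤ j + 1 - δ)), expTwoPi (f n)‖ ≤
        (δ / lam + 1) + (δ / lam + 1) := by
      refine (norm_sum_le _ _).trans ?_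
      simp only [norm_expTwoPi, Finset.sum_const, nsmul_eq_mul, mul_one]
      have c1 := card_filter_mem_Icc_le (g := g) (u := j) hlam h hδ0.le
      have c2 := card_filter_mem_Icc_le (g := g) (u := j + 1 - δ) hlam h hδ0.le
      refine le_trans ?_ (add_le_add c1 c2)
      rw [← Nat.cast_add]
      refine Nat.cast_le.2 (le_trans (Finset.card_le_card ?_) (Finset.card_union_le _ _))
      intro n hn
      obtain ⟨hn1, hn2⟩ := Finset.mem_filter.1 hn
      obtain ⟨hn3, hn4⟩ := Finset.mem_filter.1 hn1
      obtain ⟨h5, h6⟩ := Int.floor_eq_iff.1 hn4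
      rw [Finset.mem_union, Finset.mem_filter, Finset.mem_filter]
      by_cases h7 : j + δ ≤ g n
      · right
        refine ⟨hn3, ?_, by linarith⟩
        by_contra h8
        exact hn2 ⟨h7, by linarith⟩
      · left
        exact ⟨hn3, h5, by linarith⟩
    have e2 : δ / lam = 1 / δ := by
      rw [← Real.mul_self_sqrt hlam.le, ← hδ]; field_simp
    rw [e2] at b2
    have e3 : 3 / δ = 1 / δ + 1 / δ + 1 / δ := by ring
    rw [e3]
    linarith [b1]
  refine (norm_sum_le _ _).trans ((Finset.sum_le_sum hfib).trans ?_)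
  rw [Finset.sum_const, nsmul_eq_mul]
  gcongr

theorem exists_rpow_second_diff_eq {γ x : ℝ} (hx : 0 < x) :
    ∃ η, x < η ∧ η < x + 2 ∧
      ((x + 2) ^ γ - (x + 1) ^ γ) - ((x + 1) ^ γ - x ^ γ) = γ * (γ - 1) * η ^ (γ - 2) := by
  have hd : ∀ (r t : ℝ), 0 < t → HasDerivAt (fun y : ℝ => y ^ r) (r * t ^ (r - 1)) t :=
    fun r t ht => Real.hasDerivAt_rpow_const (Or.inl ht.ne')
  have hd' : ∀ t : ℝ, 0 < t → HasDerivAt (fun y : ℝ => (y + 1) ^ γ - y ^ γ)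
      (γ * (t + 1) ^ (γ - 1) - γ * t ^ (γ - 1)) t := by
    intro t ht
    refine HasDerivAt.sub ?_ (hd γ t ht)
    exact HasDerivAt.comp_add_const t 1 (hd γ (t + 1) (by linarith))
  obtain ⟨ξ, hξ, h1⟩ := exists_hasDerivAt_eq_slope (fun y : ℝ => (y + 1) ^ γ - y ^ γ)
    (fun t => γ * (t + 1) ^ (γ - 1) - γ * t ^ (γ - 1)) (show x < x + 1 by linarith)
    (fun t ht => (hd' t (by linarith [ht.1])).continuousAt.continuousWithinAt)
    (fun t ht => hd' t (by linarith [ht.1]))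
  obtain ⟨η, hη, h2⟩ := exists_hasDerivAt_eq_slope (fun y : ℝ => y ^ (γ - 1))
    (fun t => (γ - 1) * t ^ (γ - 1 - 1)) (show ξ < ξ + 1 by linarith)
    (fun t ht => (hd _ t (by linarith [ht.1, hξ.1])).continuousAt.continuousWithinAt)
    (fun t ht => hd _ t (by linarith [ht.1, hξ.1]))
  refine ⟨η, by linarith [hξ.1, hη.1], by linarith [hξ.2, hη.2], ?_⟩
  simp only [add_sub_cancel_left, div_one] at h1 h2
  rw [show x + 1 + 1 = x + 2 by ring] at h1
  rw [← h1, ← mul_sub, ← h2, show γ - 1 - 1 = γ - 2 by ring]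
  ring

theorem norm_sum_expTwoPi_neg (s : Finset ℕ) (f : ℕ → ℝ) :
    ‖∑ q ∈ s, expTwoPi (-f q)‖ = ‖∑ q ∈ s, expTwoPi (f q)‖ := by
  rw [← RCLike.norm_conj (∑ q ∈ s, expTwoPi (f q)), map_sum]
  simp only [conj_expTwoPi]

theorem norm_sum_expTwoPi_rpow_le {γ : ℝ} (h0 : 0 < γ) (h1 : γ < 1) {Q : ℕ} (hQ : 1 ≤ Q)
    {β : ℝ} (hβ : 0 < β) :
    ‖∑ q ∈ Finset.Ioc Q (4 * Q), expTwoPi (-(β * (q : ℝ) ^ γ))‖ ≤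
      (540 + 60 / √(γ * (1 - γ))) *
        (√(β * (Q : ℝ) ^ γ) + Q / √(β * (Q : ℝ) ^ γ)) := by
  have hQ0 : (0 : ℝ) < Q := by exact_mod_cast hQ
  have hQ1 : (1 : ℝ) ≤ Q := by exact_mod_cast hQ
  set L := β * (Q : ℝ) ^ γ with hL
  set G := γ * (1 - γ) with hG
  have hG0 : 0 < G := mul_pos h0 (by linarith)
  have hG1 : G ≤ 1 := by rw [hG]; nlinarith
  have hL0 : 0 < L := by positivity
  have hsL : 0 < √L := Real.sqrt_pos.2 hL0
  have hsG : 0 < √G := Real.sqrt_pos.2 hG0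
  set lam := G * (6 : ℝ) ^ (γ - 2) * (L / (Q : ℝ) ^ 2) with hlam
  have h6 : (0 : ℝ) < (6 : ℝ) ^ (γ - 2) := by positivity
  have h61 : (6 : ℝ) ^ (γ - 2) ≤ 1 := Real.rpow_le_one_of_one_le_of_nonpos (by norm_num) (by linarith)
  have h62 : 1 / 36 ≤ (6 : ℝ) ^ (γ - 2) := by
    calc (1 : ℝ) / 36 = (6 : ℝ) ^ (-2 : ℝ) := by
          rw [Real.rpow_neg (by norm_num)]; norm_num
      _ ≤ _ := Real.rpow_le_rpow_of_exponent_le (by norm_num) (by linarith)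
  have hlam0 : 0 < lam := by positivity
  have hlamle : lam ≤ L / (Q : ℝ) ^ 2 := by
    have : G * (6 : ℝ) ^ (γ - 2) ≤ 1 := by nlinarith
    have h : 0 < L / (Q : ℝ) ^ 2 := by positivity
    rw [hlam]; nlinarith
  have hsq : √lam ≤ √L / Q := by
    calc √lam ≤ √(L / (Q : ℝ) ^ 2) := Real.sqrt_le_sqrt hlamle
      _ = _ := by rw [Real.sqrt_div hL0.le, Real.sqrt_sq hQ0.le]
  have hsq' : √G * √L / (6 * Q) ≤ √lam := by
    have : √G * √L / (6 * Q) = √(G * L / (6 * Q) ^ 2) := by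
      rw [Real.sqrt_div (by positivity), Real.sqrt_sq (by positivity), Real.sqrt_mul hG0.le]
    rw [this]
    apply Real.sqrt_le_sqrt
    rw [hlam, div_le_iff₀ (by positivity)]
    have : G * (6 : ℝ) ^ (γ - 2) * (L / (Q : ℝ) ^ 2) * (6 * Q) ^ 2 =
      G * L * (36 * (6 : ℝ) ^ (γ - 2)) := by field_simp; ring
    rw [this]
    have : 0 < G * L := by positivity
    nlinarith
  have hs0 : 0 < √lam := Real.sqrt_pos.2 hlam0
  have hinv : 1 / √lam ≤ 6 / √G * (Q / √L) := by
    rw [div_le_iff₀ hs0]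
    calc (1 : ℝ) = 6 / √G * (Q / √L) * (√G * √L / (6 * Q)) := by field_simp
      _ ≤ _ := by gcongr
  have hsum : ∑ q ∈ Finset.Ioc Q (4 * Q), expTwoPi (-(β * (q : ℝ) ^ γ)) =
      ∑ n ∈ Finset.range (3 * Q), expTwoPi (-(β * ((Q + 1 + n : ℕ) : ℝ) ^ γ)) := by
    rw [← Finset.Ico_add_one_add_one_eq_Ioc, Finset.sum_Ico_eq_sum_range]
    congr 2; omega
  rw [hsum]
  have hQpow : β * (Q : ℝ) ^ (γ - 2) = L / (Q : ℝ) ^ 2 := by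
    rw [hL, Real.rpow_sub hQ0]; norm_num; ring
  have hmain : ‖∑ n ∈ Finset.range (3 * Q), expTwoPi (-(β * ((Q + 1 + n : ℕ) : ℝ) ^ γ))‖ ≤
      180 * (3 * Q) * √lam + 10 * (1 / √lam) := by
    rcases le_or_gt 1 lam with hl | hl
    · have : 1 ≤ √lam := Real.one_le_sqrt.2 hl
      calc _ ≤ ∑ n ∈ Finset.range (3 * Q), (1 : ℝ) :=
            norm_sum_le_of_le _ fun n _ => (norm_expTwoPi _).le
        _ = 3 * Q := by simp
        _ ≤ 180 * (3 * Q) * √lam + 10 * (1 / √lam) := by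
            have : 0 < 1 / √lam := by positivity
            nlinarith
    · have h := norm_sum_expTwoPi_le_of_second_diff
        (f := fun n => -(β * ((Q + 1 + n : ℕ) : ℝ) ^ γ)) (lam := lam) (mu := 36 * lam)
        (M := 3 * Q) hlam0 ?_
      · refine h.trans ?_
        have hs1 : √lam < 1 := by rw [Real.sqrt_lt' one_pos]; simpa using hl
        have hge : 1 < 1 / √lam := by rw [lt_div_iff₀ hs0]; linarith
        have hle : 3 / √lam + 2 ≤ 5 * (1 / √lam) := by
          rw [show 3 / √lam = 3 * (1 / √lam) by ring]; linarith
        have hls : lam * (1 / √lam) = √lam := by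
          rw [mul_one_div, Real.div_sqrt]
        push_cast
        calc _ ≤ (36 * lam * (3 * Q) + 2) * (5 * (1 / √lam)) := by gcongr
          _ = 180 * (3 * Q) * (lam * (1 / √lam)) + 10 * (1 / √lam) := by ring
          _ = _ := by rw [hls]
      · intro n hn
        obtain ⟨η, e1, e2, e3⟩ := exists_rpow_second_diff_eq (γ := γ) (x := ((Q + 1 + n : ℕ) : ℝ))
          (by positivity)
        have hbase : -(β * ((Q + 1 + (n + 2) : ℕ) : ℝ) ^ γ) - -(β * ((Q + 1 + (n + 1) : ℕ) : ℝ) ^ γ)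
          - (-(β * ((Q + 1 + (n + 1) : ℕ) : ℝ) ^ γ) - -(β * ((Q + 1 + n : ℕ) : ℝ) ^ γ)) =
          G * (β * η ^ (γ - 2)) := by
          have : ((Q + 1 + (n + 2) : ℕ) : ℝ) = ((Q + 1 + n : ℕ) : ℝ) + 2 := by push_cast; ring
          rw [this]
          have : ((Q + 1 + (n + 1) : ℕ) : ℝ) = ((Q + 1 + n : ℕ) : ℝ) + 1 := by push_cast; ring
          rw [this]
          rw [hG]
          linear_combination -β * e3
        simp only [hbase]
        have hηQ : (Q : ℝ) ≤ η := by push_cast at e1; linarith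
        have hη0 : 0 < η := by linarith
        have hη6 : η ≤ 6 * Q := by
          have : ((Q + 1 + n : ℕ) : ℝ) ≤ 4 * Q := by exact_mod_cast (by omega : Q + 1 + n ≤ 4 * Q)
          linarith
        have a1 : η ^ (γ - 2) ≤ (Q : ℝ) ^ (γ - 2) :=
          Real.rpow_le_rpow_of_nonpos hQ0 hηQ (by linarith)
        have a2 : (6 * Q : ℝ) ^ (γ - 2) ≤ η ^ (γ - 2) :=
          Real.rpow_le_rpow_of_nonpos hη0 hη6 (by linarith)
        rw [Real.mul_rpow (by norm_num) hQ0.le] at a2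
        constructor
        · calc lam = G * (β * ((6 : ℝ) ^ (γ - 2) * (Q : ℝ) ^ (γ - 2))) := by
                rw [hlam, ← hQpow]; ring
            _ ≤ _ := by gcongr
        · calc G * (β * η ^ (γ - 2)) ≤ G * (β * (Q : ℝ) ^ (γ - 2)) := by gcongr
            _ = G * (L / (Q : ℝ) ^ 2) * 1 := by rw [hQpow]; ring
            _ ≤ G * (L / (Q : ℝ) ^ 2) * (36 * (6 : ℝ) ^ (γ - 2)) := by
                gcongr; linarith
            _ = 36 * lam := by rw [hlam]; ring
  refine hmain.trans ?_
  have b1 : 180 * (3 * Q) * √lam ≤ 540 * √L := by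
    calc 180 * (3 * Q) * √lam ≤ 180 * (3 * Q) * (√L / Q) := by gcongr
      _ = 540 * √L := by field_simp; ring
  have b2 : 10 * (1 / √lam) ≤ 60 / √G * (Q / √L) := by
    calc 10 * (1 / √lam) ≤ 10 * (6 / √G * (Q / √L)) := by gcongr
      _ = _ := by ring
  have b3 : 0 ≤ 60 / √G * √L := by positivity
  have b4 : 0 ≤ 540 * (Q / √L) := by positivity
  calc _ ≤ 540 * √L + 60 / √G * (Q / √L) := add_le_add b1 b2
    _ ≤ _ := by linarith

theorem exists_norm_sum_expTwoPi_rpow_le {γ : ℝ} (h0 : 0 < γ) (h1 : γ < 1) :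
    ∃ C : ℝ, 0 < C ∧ ∀ Q : ℕ, 1 ≤ Q → ∀ α : ℝ, α ≠ 0 →
      ‖∑ q ∈ Finset.Ioc Q (4 * Q), expTwoPi (α * (q : ℝ) ^ γ)‖ ≤
        C * (√(|α| * (Q : ℝ) ^ γ) + Q / √(|α| * (Q : ℝ) ^ γ)) := by
  refine ⟨540 + 60 / √(γ * (1 - γ)), by positivity, fun Q hQ α hα => ?_⟩
  have h := norm_sum_expTwoPi_rpow_le h0 h1 hQ (abs_pos.2 hα)
  rcases abs_choice α with h2 | h2
  · rw [norm_sum_expTwoPi_neg _ fun q : ℕ => |α| * (q : ℝ) ^ γ] at h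
    simpa only [h2] using h
  · convert h using 4
    rw [h2]; ring

theorem sum_erase_natDist_le {W : ℕ → ℝ} (hW : ∀ m, 0 ≤ W m) {n h : ℕ} (hh : h < n) :
    ∑ k ∈ (Finset.range n).erase h, W (Nat.dist h k) ≤ 2 * ∑ m ∈ Finset.Ico 1 n, W m := by
  have hsub : (Finset.range n).erase h = Finset.range h ∪ Finset.Ico (h + 1) n := by
    ext k; simp only [Finset.mem_erase, Finset.mem_range, Finset.mem_union, Finset.mem_Ico]; omega
  have hdis : Disjoint (Finset.range h) (Finset.Ico (h + 1) n) := by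
    rw [Finset.disjoint_left]; intro k hk
    simp only [Finset.mem_range, Finset.mem_Ico] at *; omega
  rw [hsub, Finset.sum_union hdis, two_mul]
  refine add_le_add ?_ ?_
  · have : ∑ k ∈ Finset.range h, W (Nat.dist h k) = ∑ m ∈ Finset.Ico 1 (h + 1), W m := by
      refine Finset.sum_nbij' (fun k => h - k) (fun m => h - m) ?_ ?_ ?_ ?_ ?_ <;>
        · intro k hk
          simp only [Finset.mem_range, Finset.mem_Ico] at *
          first | omega | (congr 1; unfold Nat.dist; omega)
    rw [this]
    exact Finset.sum_le_sum_of_subset_of_nonneg (Finset.Ico_subset_Ico_right (by omega))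
      fun m _ _ => hW m
  · have : ∑ k ∈ Finset.Ico (h + 1) n, W (Nat.dist h k) = ∑ m ∈ Finset.Ico 1 (n - h), W m := by
      refine Finset.sum_nbij' (fun k => k - h) (fun m => h + m) ?_ ?_ ?_ ?_ ?_ <;>
        · intro k hk
          simp only [Finset.mem_Ico] at *
          first | omega | (congr 1; unfold Nat.dist; omega)
    rw [this]
    exact Finset.sum_le_sum_of_subset_of_nonneg (Finset.Ico_subset_Ico_right (by omega))
      fun m _ _ => hW m

theorem norm_sum_expTwoPi_natDist {ι : Type*} (s : Finset ι) (t : ι → ℝ) (h k : ℕ) :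
    ‖∑ j ∈ s, expTwoPi (((h : ℝ) - k) * t j)‖ = ‖∑ j ∈ s, expTwoPi ((Nat.dist h k : ℕ) * t j)‖ := by
  rcases le_total k h with hk | hk
  · rw [Nat.dist_eq_sub_of_le_right hk, Nat.cast_sub hk]
  · rw [Nat.dist_eq_sub_of_le hk, Nat.cast_sub hk,
      ← RCLike.norm_conj (∑ j ∈ s, expTwoPi (((k : ℝ) - h) * t j)), map_sum]
    simp only [conj_expTwoPi]
    congr 2; funext j; congr 1; ring

/-- The mean square of a trigonometric polynomial over a finite family of points, compared with
its mean square over the circle. -/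
theorem abs_sum_norm_sq_sub_le {ι : Type*} (s : Finset ι) (t : ι → ℝ) (u : ℕ → ℝ) (n : ℕ) :
    |∑ j ∈ s, ‖∑ h ∈ Finset.range n, (u h : ℂ) * expTwoPi (h * t j)‖ ^ 2 -
        s.card * ∑ h ∈ Finset.range n, u h ^ 2| ≤
      2 * (∑ h ∈ Finset.range n, u h ^ 2) *
        ∑ m ∈ Finset.Ico 1 n, ‖∑ j ∈ s, expTwoPi (m * t j)‖ := by
  set W : ℕ → ℝ := fun m => ‖∑ j ∈ s, expTwoPi (m * t j)‖ with hWdef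
  have hW : ∀ m, 0 ≤ W m := fun m => norm_nonneg _
  have hexp : ∀ j, ((‖∑ h ∈ Finset.range n, (u h : ℂ) * expTwoPi (h * t j)‖ ^ 2 : ℝ) : ℂ) =
      ∑ h ∈ Finset.range n, ∑ k ∈ Finset.range n,
        ((u h * u k : ℝ) : ℂ) * expTwoPi (((h : ℝ) - k) * t j) := by
    intro j
    rw [Complex.ofReal_pow, ← Complex.mul_conj', map_sum, Finset.sum_mul_sum]
    refine Finset.sum_congr rfl fun h _ => Finset.sum_congr rfl fun k _ => ?_
    rw [map_mul, conj_expTwoPi, Complex.conj_ofReal, sub_mul, sub_eq_add_neg, expTwoPi_add]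
    push_cast; ring
  have hdiag : ((∑ j ∈ s, ‖∑ h ∈ Finset.range n, (u h : ℂ) * expTwoPi (h * t j)‖ ^ 2 -
        s.card * ∑ h ∈ Finset.range n, u h ^ 2 : ℝ) : ℂ) =
      ∑ h ∈ Finset.range n, ∑ k ∈ (Finset.range n).erase h,
        ((u h * u k : ℝ) : ℂ) * ∑ j ∈ s, expTwoPi (((h : ℝ) - k) * t j) := by
    rw [Complex.ofReal_sub, Complex.ofReal_sum, Finset.sum_congr rfl fun j _ => hexp j,
      Finset.sum_comm]
    have : ∀ h ∈ Finset.range n, (∑ j ∈ s, ∑ k ∈ Finset.range n,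
        ((u h * u k : ℝ) : ℂ) * expTwoPi (((h : ℝ) - k) * t j)) =
        ((s.card * u h ^ 2 : ℝ) : ℂ) + ∑ k ∈ (Finset.range n).erase h,
        ((u h * u k : ℝ) : ℂ) * ∑ j ∈ s, expTwoPi (((h : ℝ) - k) * t j) := by
      intro h hh
      rw [Finset.sum_comm, ← Finset.add_sum_erase _ _ hh]
      congr 1
      · rw [sub_self]
        have : expTwoPi 0 = 1 := by simpa using expTwoPi_intCast 0
        simp only [zero_mul, this, Finset.sum_const, nsmul_eq_mul]
        push_cast; ring
      · exact Finset.sum_congr rfl fun k _ => (Finset.mul_sum _ _ _).symm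
    rw [Finset.sum_congr rfl this, Finset.sum_add_distrib, Finset.mul_sum, Complex.ofReal_sum]
    ring
  rw [← Real.norm_eq_abs, ← Complex.norm_real, hdiag]
  calc _ ≤ ∑ h ∈ Finset.range n, ∑ k ∈ (Finset.range n).erase h,
        (u h ^ 2 / 2 + u k ^ 2 / 2) * W (Nat.dist h k) := by
        refine norm_sum_le_of_le _ fun h _ => norm_sum_le_of_le _ fun k _ => ?_
        rw [norm_mul, norm_sum_expTwoPi_natDist, Complex.norm_real, Real.norm_eq_abs]
        refine mul_le_mul_of_nonneg_right ?_ (norm_nonneg _)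
        rw [abs_le]
        constructor <;> nlinarith [sq_nonneg (u h + u k), sq_nonneg (u h - u k)]
    _ = ∑ h ∈ Finset.range n, u h ^ 2 * ∑ k ∈ (Finset.range n).erase h, W (Nat.dist h k) := by
        have hsymm : ∑ h ∈ Finset.range n, ∑ k ∈ (Finset.range n).erase h,
            u k ^ 2 / 2 * W (Nat.dist h k) =
            ∑ h ∈ Finset.range n, ∑ k ∈ (Finset.range n).erase h,
            u h ^ 2 / 2 * W (Nat.dist h k) := by
          rw [Finset.sum_comm' (t' := Finset.range n) (s' := fun k => (Finset.range n).erase k)]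
          · simp only [Nat.dist_comm]
          · intro x y; simp only [Finset.mem_erase, Finset.mem_range]; tauto
        simp only [add_mul, Finset.sum_add_distrib]
        rw [hsymm, ← Finset.sum_add_distrib]
        refine Finset.sum_congr rfl fun h _ => ?_
        rw [← Finset.mul_sum]; ring
    _ ≤ ∑ h ∈ Finset.range n, u h ^ 2 * (2 * ∑ m ∈ Finset.Ico 1 n, W m) :=
        Finset.sum_le_sum fun h hh => mul_le_mul_of_nonneg_left
          (sum_erase_natDist_le hW (Finset.mem_range.1 hh)) (sq_nonneg _)
    _ = _ := by rw [← Finset.sum_mul]; ring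

theorem cube_div_three_le_sum_sq (H : ℕ) :
    (H : ℝ) ^ 3 / 3 ≤ ∑ h ∈ Finset.range H, ((h : ℝ) + 1) ^ 2 := by
  induction H with
  | zero => simp
  | succ H ih =>
    rw [Finset.sum_range_succ]
    push_cast
    have : (0 : ℝ) ≤ H := by positivity
    nlinarith

theorem four_mul_le_norm_one_sub_expTwoPi {x δ : ℝ} (h : ∀ n : ℤ, δ ≤ |x - n|) :
    4 * δ ≤ ‖1 - expTwoPi x‖ := by
  set y := x - round x with hy
  have h1 : expTwoPi x = expTwoPi y := by
    rw [show x = y + (round x : ℤ) by rw [hy]; ring, expTwoPi_add, expTwoPi_intCast, mul_one]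
  have h2 := h (round x)
  have h3 : |y| ≤ 1 / 2 := abs_sub_round x
  have h4 : ‖1 - expTwoPi y‖ = 2 * |Real.sin (Real.pi * y)| := by
    rw [norm_sub_rev, expTwoPi, mul_comm _ Complex.I, Complex.norm_exp_I_mul_ofReal_sub_one,
      norm_mul]
    simp only [Real.norm_eq_abs, Nat.abs_ofNat]
    congr 3; ring
  have h5 : 2 * |y| ≤ |Real.sin (Real.pi * y)| := by
    have := Real.mul_abs_le_abs_sin (x := Real.pi * y) (by
      rw [abs_mul, abs_of_pos Real.pi_pos]; nlinarith [Real.pi_pos])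
    rw [abs_mul, abs_of_pos Real.pi_pos] at this
    have e : 2 / Real.pi * (Real.pi * |y|) = 2 * |y| := by
      field_simp
    linarith
  rw [h1, h4]; linarith

/-- If the points `t j` stay away from the integers, some low-frequency exponential sum over them
is large. -/
theorem card_le_sum_norm_sum_expTwoPi {ι : Type*} (s : Finset ι) (t : ι → ℝ) {δ : ℝ} (hδ : 0 < δ)
    {H : ℕ} (hH : 1 ≤ H * δ) (ht : ∀ j ∈ s, ∀ n : ℤ, δ ≤ |t j - n|) :
    (s.card : ℝ) ≤ 6 * ∑ m ∈ Finset.Ico 1 (2 * H), ‖∑ j ∈ s, expTwoPi (m * t j)‖ := by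
  have hH0 : 0 < H := by
    rcases Nat.eq_zero_or_pos H with h | h
    · rw [h] at hH; norm_num at hH
    · exact h
  have hHr : (0 : ℝ) < H := by exact_mod_cast hH0
  set T := ∑ m ∈ Finset.Ico 1 (2 * H), ‖∑ j ∈ s, expTwoPi (m * t j)‖ with hT
  set d : ℕ → ℝ := fun h => min (h : ℝ) (2 * H - h) with hd
  set N := 2 * H - 1 with hN
  have hN1 : N + 1 = 2 * H := by omega
  have hd0 : d 0 = 0 := by simp [hd]
  have hdN : d (N + 1) = 0 := by
    rw [hN1, hd]; simp
  set A := ∑ h ∈ Finset.range N, d (h + 1) ^ 2 with hA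
  set B := ∑ h ∈ Finset.range (N + 1), (d (h + 1) - d h) ^ 2 with hB
  have hBle : B ≤ 2 * H := by
    calc B ≤ ∑ h ∈ Finset.range (N + 1), (1 : ℝ) := by
          refine Finset.sum_le_sum fun h _ => ?_
          have := abs_min_sub_min_le_max ((h + 1 : ℕ) : ℝ) (2 * H - (h + 1 : ℕ)) (h : ℝ) (2 * H - h)
          have e : max |((h + 1 : ℕ) : ℝ) - h| |2 * (H : ℝ) - (h + 1 : ℕ) - (2 * H - h)| = 1 := by
            push_cast
            rw [show (h : ℝ) + 1 - h = 1 by ring,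
              show 2 * (H : ℝ) - (h + 1) - (2 * H - h) = -1 by ring]
            simp
          rw [e] at this
          exact (sq_le_one_iff_abs_le_one _).2 this
      _ = 2 * H := by rw [hN1]; simp
  have hAge : (H : ℝ) ^ 3 / 3 ≤ A := by
    refine (cube_div_three_le_sum_sq H).trans ?_
    calc _ = ∑ h ∈ Finset.range H, d (h + 1) ^ 2 := by
          refine Finset.sum_congr rfl fun h hh => ?_
          have : (h : ℝ) + 1 ≤ H := by exact_mod_cast Finset.mem_range.1 hh
          simp only [hd]
          push_cast
          rw [min_eq_left (by linarith)]
      _ ≤ A := Finset.sum_le_sum_of_subset_of_nonneg (Finset.range_subset_range.2 (by omega))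
          fun _ _ _ => sq_nonneg _
  have hpoint : ∀ j, (1 - expTwoPi (t j)) *
      ∑ h ∈ Finset.range N, ((d (h + 1) : ℝ) : ℂ) * expTwoPi (h * t j) =
      ∑ h ∈ Finset.range (N + 1), ((d (h + 1) - d h : ℝ) : ℂ) * expTwoPi (h * t j) := by
    intro j
    simp only [Complex.ofReal_sub, sub_mul, Finset.sum_sub_distrib, one_mul]
    congr 1
    · rw [Finset.sum_range_succ, hdN]; simp
    · rw [Finset.sum_range_succ', hd0, Finset.mul_sum]
      simp only [Complex.ofReal_zero, zero_mul, add_zero]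
      refine Finset.sum_congr rfl fun h _ => ?_
      push_cast
      rw [add_mul, one_mul, expTwoPi_add]; ring
  have hD := abs_le.1 (abs_sum_norm_sq_sub_le s t (fun h => d (h + 1)) N)
  have hE := abs_le.1 (abs_sum_norm_sq_sub_le s t (fun h => d (h + 1) - d h) (N + 1))
  have hTN : ∑ m ∈ Finset.Ico 1 N, ‖∑ j ∈ s, expTwoPi (m * t j)‖ ≤ T :=
    Finset.sum_le_sum_of_subset_of_nonneg (Finset.Ico_subset_Ico_right (by omega))
      fun _ _ _ => norm_nonneg _
  have hcmp : 16 * δ ^ 2 * ∑ j ∈ s, ‖∑ h ∈ Finset.range N,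
      ((d (h + 1) : ℝ) : ℂ) * expTwoPi (h * t j)‖ ^ 2 ≤
      ∑ j ∈ s, ‖∑ h ∈ Finset.range (N + 1),
        ((d (h + 1) - d h : ℝ) : ℂ) * expTwoPi (h * t j)‖ ^ 2 := by
    rw [Finset.mul_sum]
    refine Finset.sum_le_sum fun j hj => ?_
    rw [← hpoint, norm_mul, mul_pow]
    have := four_mul_le_norm_one_sub_expTwoPi (ht j hj)
    have h2 : (4 * δ) ^ 2 ≤ ‖1 - expTwoPi (t j)‖ ^ 2 := by gcongr
    nlinarith [sq_nonneg ‖∑ h ∈ Finset.range N, ((d (h + 1) : ℝ) : ℂ) * expTwoPi (h * t j)‖]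
  rw [hN1, ← hT] at hE
  set X := ∑ j ∈ s, ‖∑ h ∈ Finset.range N, ((d (h + 1) : ℝ) : ℂ) * expTwoPi (h * t j)‖ ^ 2
  rw [hN1] at hcmp hB
  rw [← hB] at hE
  have hA0 : 0 < A := lt_of_lt_of_le (by positivity) hAge
  have hX : A * (s.card - 2 * T) ≤ X := by
    have := mul_le_mul_of_nonneg_left hTN (show 0 ≤ 2 * A by positivity)
    nlinarith [hD.1]
  have hY := hE.2
  have hT0 : 0 ≤ T := Finset.sum_nonneg fun _ _ => norm_nonneg _
  have hAB : 2 * B ≤ 16 * δ ^ 2 * A := by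
    have h1 : 1 ≤ (H * δ) ^ 2 := one_le_pow₀ hH
    have h2 : 16 * δ ^ 2 * ((H : ℝ) ^ 3 / 3) ≤ 16 * δ ^ 2 * A := by gcongr
    have h3 : 16 * δ ^ 2 * ((H : ℝ) ^ 3 / 3) = 16 / 3 * H * (H * δ) ^ 2 := by ring
    nlinarith
  by_contra hcon
  push Not at hcon
  have hc0 : (0 : ℝ) ≤ s.card := by positivity
  have k1 : 16 * δ ^ 2 * (A * (s.card - 2 * T)) ≤ B * (s.card + 2 * T) := by
    have := mul_le_mul_of_nonneg_left hX (show 0 ≤ 16 * δ ^ 2 by positivity)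
    linarith
  have k2 : (2 * B) * (s.card - 2 * T) ≤ 16 * δ ^ 2 * A * (s.card - 2 * T) :=
    mul_le_mul_of_nonneg_right hAB (by linarith)
  have k3 : 0 < 16 * δ ^ 2 * A := by positivity
  rcases (show 0 ≤ B from Finset.sum_nonneg fun _ _ => sq_nonneg _).eq_or_lt with hB0 | hB0
  · nlinarith
  · nlinarith

theorem mul_rpow_sub_one_le_rpow_sub_rpow {γ x y : ℝ} (h0 : 0 < γ) (h1 : γ < 1) (hx : 0 < x)
    (hxy : x < y) : γ * y ^ (γ - 1) * (y - x) ≤ y ^ γ - x ^ γ := by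
  have hd : ∀ t : ℝ, 0 < t → HasDerivAt (fun y : ℝ => y ^ γ) (γ * t ^ (γ - 1)) t :=
    fun t ht => Real.hasDerivAt_rpow_const (Or.inl ht.ne')
  obtain ⟨ξ, hξ, h⟩ := exists_hasDerivAt_eq_slope (fun t : ℝ => t ^ γ)
    (fun t => γ * t ^ (γ - 1)) hxy
    (fun t ht => (hd t (by linarith [ht.1])).continuousAt.continuousWithinAt)
    (fun t ht => hd t (by linarith [ht.1]))
  have h2 : y ^ (γ - 1) ≤ ξ ^ (γ - 1) :=
    Real.rpow_le_rpow_of_nonpos (by linarith [hξ.1]) hξ.2.le (by linarith)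
  have h3 : 0 < y - x := sub_pos.2 hxy
  rw [eq_div_iff h3.ne'] at h
  rw [← h]
  gcongr

/-- If no `⌊n ^ γ⁻¹⌋` equals `m`, then `m ^ γ` has no integer shortly above it. -/
theorem le_abs_sub_of_floor_ne {γ δ : ℝ} (h0 : 0 < γ) (h1 : γ < 1) {m : ℕ} (hm : 0 < m)
    (hδ : 2 * δ ≤ γ * ((m : ℝ) + 1) ^ (γ - 1))
    (h : ∀ n : ℕ, 0 < n → (n : ℝ) ≤ (m : ℝ) ^ γ + 1 → ⌊(n : ℝ) ^ γ⁻¹⌋ ≠ (m : ℤ)) (z : ℤ) :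
    δ ≤ |((m : ℝ) ^ γ + δ) - z| := by
  have hm0 : (0 : ℝ) < m := by exact_mod_cast hm
  have hx : 0 < (m : ℝ) ^ γ := by positivity
  rcases lt_or_ge (z : ℝ) ((m : ℝ) ^ γ) with hz | hz
  · exact le_trans (by linarith) (le_abs_self _)
  set n := ⌈(m : ℝ) ^ γ⌉₊ with hn
  have hn0 : 0 < n := Nat.ceil_pos.2 hx
  have hnx : (m : ℝ) ^ γ ≤ n := Nat.le_ceil _
  have hnz : (n : ℝ) ≤ z := by
    have hz0 : 0 ≤ z := by exact_mod_cast hx.le.trans hz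
    lift z to ℕ using hz0
    push_cast at hz ⊢
    exact_mod_cast Nat.ceil_le.2 hz
  have h2 := h n hn0 (Nat.ceil_lt_add_one hx.le).le
  have h3 : (m : ℝ) ≤ (n : ℝ) ^ γ⁻¹ := by
    calc (m : ℝ) = ((m : ℝ) ^ γ) ^ γ⁻¹ := (Real.rpow_rpow_inv hm0.le h0.ne').symm
      _ ≤ _ := by gcongr
  have h4 : (m : ℝ) + 1 ≤ (n : ℝ) ^ γ⁻¹ := by
    by_contra hcon
    push Not at hcon
    exact h2 (Int.floor_eq_iff.2 ⟨by exact_mod_cast h3, by exact_mod_cast hcon⟩)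
  have h5 : ((m : ℝ) + 1) ^ γ ≤ n := by
    calc _ ≤ ((n : ℝ) ^ γ⁻¹) ^ γ := by gcongr
      _ = n := Real.rpow_inv_rpow (by positivity) h0.ne'
  have h6 := mul_rpow_sub_one_le_rpow_sub_rpow h0 h1 hm0 (show (m : ℝ) < m + 1 by linarith)
  rw [add_sub_cancel_left, mul_one] at h6
  rw [abs_sub_comm]
  exact le_trans (by linarith) (le_abs_self _)

theorem norm_sq_sum_sum_le (A B s : Finset ℕ) (hA : A ⊆ s) (φ : ℕ → ℕ → ℝ) :
    ‖∑ q ∈ A, ∑ k ∈ B, expTwoPi (φ q k)‖ ^ 2 ≤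
      A.card * ∑ k ∈ B, ∑ l ∈ B, ‖∑ q ∈ s, expTwoPi (φ q k - φ q l)‖ := by
  have h1 : ‖∑ q ∈ A, ∑ k ∈ B, expTwoPi (φ q k)‖ ^ 2 ≤
      A.card * ∑ q ∈ s, ‖∑ k ∈ B, expTwoPi (φ q k)‖ ^ 2 := by
    calc _ ≤ (∑ q ∈ A, ‖∑ k ∈ B, expTwoPi (φ q k)‖) ^ 2 := by
          gcongr; exact norm_sum_le _ _
      _ ≤ A.card * ∑ q ∈ A, ‖∑ k ∈ B, expTwoPi (φ q k)‖ ^ 2 := sq_sum_le_card_mul_sum_sq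
      _ ≤ _ := by
          gcongr
  refine h1.trans (mul_le_mul_of_nonneg_left ?_ (by positivity))
  have h2 : ((∑ q ∈ s, ‖∑ k ∈ B, expTwoPi (φ q k)‖ ^ 2 : ℝ) : ℂ) =
      ∑ k ∈ B, ∑ l ∈ B, ∑ q ∈ s, expTwoPi (φ q k - φ q l) := by
    have : ∀ q ∈ s, ((‖∑ k ∈ B, expTwoPi (φ q k)‖ ^ 2 : ℝ) : ℂ) =
        ∑ k ∈ B, ∑ l ∈ B, expTwoPi (φ q k - φ q l) := by
      intro q _
      rw [Complex.ofReal_pow, ← Complex.mul_conj', map_sum, Finset.sum_mul_sum]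
      simp only [conj_expTwoPi, ← expTwoPi_add, sub_eq_add_neg]
    rw [Complex.ofReal_sum, Finset.sum_congr rfl this, Finset.sum_comm]
    exact Finset.sum_congr rfl fun k _ => Finset.sum_comm
  have h3 : 0 ≤ ∑ q ∈ s, ‖∑ k ∈ B, expTwoPi (φ q k)‖ ^ 2 :=
    Finset.sum_nonneg fun _ _ => sq_nonneg _
  rw [← abs_of_nonneg h3, ← Real.norm_eq_abs, ← Complex.norm_real, h2]
  exact norm_sum_le_of_le _ fun k _ => norm_sum_le _ _

theorem exists_norm_sq_bilinear_le {γ : ℝ} (h0 : 0 < γ) (h1 : γ < 1) :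
    ∃ C : ℝ, 1 ≤ C ∧ ∀ Q K H m : ℕ, 1 ≤ Q → 1 ≤ K → 1 ≤ m → m ≤ 2 * H →
      ∀ A B : Finset ℕ, A ⊆ Finset.Ioc Q (4 * Q) → B ⊆ Finset.Ioc K (4 * K) →
      ‖∑ q ∈ A, ∑ k ∈ B, expTwoPi (m * (((q * k : ℕ) : ℝ) ^ γ))‖ ^ 2 ≤
        C * (A.card * B.card) * (Q + B.card * √(H * ((Q * K : ℕ) : ℝ) ^ γ) +
          B.card * Q * √(K / ((Q * K : ℕ) : ℝ) ^ γ)) := by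
  obtain ⟨C, hC, hS⟩ := exists_norm_sum_expTwoPi_rpow_le h0 h1
  refine ⟨3 + C * (3 + 2 / √γ), ?_, ?_⟩
  · have : 0 ≤ C * (3 + 2 / √γ) := by positivity
    linarith
  intro Q K H m hQ hK hm hmH A B hA hB
  have hQ0 : (0 : ℝ) < Q := by exact_mod_cast hQ
  have hK0 : (0 : ℝ) < K := by exact_mod_cast hK
  have hm1 : (1 : ℝ) ≤ m := by exact_mod_cast hm
  have hmH' : (m : ℝ) ≤ 2 * H := by exact_mod_cast hmH
  set N := ((Q * K : ℕ) : ℝ) ^ γ with hN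
  have hNQK : N = (Q : ℝ) ^ γ * (K : ℝ) ^ γ := by
    rw [hN]; push_cast; exact Real.mul_rpow hQ0.le hK0.le
  have hN0 : 0 < N := by rw [hNQK]; positivity
  set R := (3 + 2 / √γ) * (√(H * N) + Q * √(K / N)) with hR
  have hR0 : 0 ≤ R := by positivity
  have key : ∀ k ∈ B, ∀ l ∈ B, l < k →
      ‖∑ q ∈ Finset.Ioc Q (4 * Q), expTwoPi ((m * ((k : ℝ) ^ γ - (l : ℝ) ^ γ)) * (q : ℝ) ^ γ)‖ ≤
        C * R := by
    intro k hk l hl hlk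
    have hk1 := Finset.mem_Ioc.1 (hB hk)
    have hl1 := Finset.mem_Ioc.1 (hB hl)
    have hl0 : (0 : ℝ) < l := by exact_mod_cast (by omega : 0 < l)
    have hk0 : (0 : ℝ) < k := by exact_mod_cast (by omega : 0 < k)
    have hlk1 : (1 : ℝ) ≤ k - l := by
      have : (l : ℝ) + 1 ≤ k := by exact_mod_cast hlk
      linarith
    have hk4 : (k : ℝ) ≤ 4 * K := by exact_mod_cast hk1.2
    have hlow : γ / 4 * ((K : ℝ) ^ γ / K) ≤ (k : ℝ) ^ γ - (l : ℝ) ^ γ := by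
      have e1 := mul_rpow_sub_one_le_rpow_sub_rpow h0 h1 hl0 (show (l : ℝ) < k by linarith)
      have e2 : (4 * K : ℝ) ^ (γ - 1) ≤ (k : ℝ) ^ (γ - 1) :=
        Real.rpow_le_rpow_of_nonpos hk0 hk4 (by linarith)
      have e3 : (4 : ℝ)⁻¹ ≤ (4 : ℝ) ^ (γ - 1) := by
        rw [← Real.rpow_neg_one]
        exact Real.rpow_le_rpow_of_exponent_le (by norm_num) (by linarith)
      calc γ / 4 * ((K : ℝ) ^ γ / K) = γ * ((4 : ℝ)⁻¹ * (K : ℝ) ^ (γ - 1)) := by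
            rw [Real.rpow_sub_one hK0.ne']; ring
        _ ≤ γ * ((4 : ℝ) ^ (γ - 1) * (K : ℝ) ^ (γ - 1)) := by gcongr
        _ = γ * (4 * K : ℝ) ^ (γ - 1) := by rw [Real.mul_rpow (by norm_num) hK0.le]
        _ ≤ γ * (k : ℝ) ^ (γ - 1) := by gcongr
        _ ≤ γ * (k : ℝ) ^ (γ - 1) * (k - l) := le_mul_of_one_le_right (by positivity) hlk1
        _ ≤ _ := e1
    have hup : (k : ℝ) ^ γ - (l : ℝ) ^ γ ≤ 4 * (K : ℝ) ^ γ := by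
      have e1 : (4 : ℝ) ^ γ ≤ 4 := by
        simpa using Real.rpow_le_rpow_of_exponent_le (show (1 : ℝ) ≤ 4 by norm_num) h1.le
      have e2 : 0 < (l : ℝ) ^ γ := by positivity
      calc _ ≤ (k : ℝ) ^ γ := by linarith
        _ ≤ (4 * K : ℝ) ^ γ := by gcongr
        _ = (4 : ℝ) ^ γ * (K : ℝ) ^ γ := Real.mul_rpow (by norm_num) hK0.le
        _ ≤ _ := by gcongr
    set D := (k : ℝ) ^ γ - (l : ℝ) ^ γ with hD
    have hD0 : 0 < D := lt_of_lt_of_le (by positivity) hlow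
    have hmD : 0 < m * D := by positivity
    have h := hS Q hQ (m * D) hmD.ne'
    refine h.trans (mul_le_mul_of_nonneg_left ?_ hC.le)
    rw [abs_of_pos hmD]
    set L := m * D * (Q : ℝ) ^ γ with hL
    have hL0 : 0 < L := by positivity
    have b1 : √L ≤ 3 * √(H * N) := by
      calc √L ≤ √(3 ^ 2 * (H * N)) := by
            apply Real.sqrt_le_sqrt
            calc L ≤ (2 * H) * (4 * (K : ℝ) ^ γ) * (Q : ℝ) ^ γ := by rw [hL]; gcongr
              _ = 8 * (H * N) := by rw [hNQK]; ring
              _ ≤ _ := by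
                have : 0 ≤ H * N := by positivity
                linarith
        _ = _ := by rw [Real.sqrt_mul (by norm_num), Real.sqrt_sq (by norm_num)]
    have b2 : Q / √L ≤ 2 / √γ * (Q * √(K / N)) := by
      have e1 : γ / 4 * (N / K) ≤ L := by
        calc γ / 4 * (N / K) = 1 * (γ / 4 * ((K : ℝ) ^ γ / K)) * (Q : ℝ) ^ γ := by
              rw [hNQK]; ring
          _ ≤ _ := by rw [hL]; gcongr
      calc Q / √L ≤ Q / √(γ / 4 * (N / K)) := by gcongr
        _ = _ := by
          rw [Real.sqrt_mul (by positivity), Real.sqrt_div hN0.le, Real.sqrt_div h0.le,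
            Real.sqrt_div hK0.le, show (4 : ℝ) = 2 ^ 2 by norm_num, Real.sqrt_sq (by norm_num)]
          field_simp
    have b3 : 0 ≤ 2 / √γ * √(H * N) := by positivity
    have b4 : 0 ≤ 3 * (Q * √(K / N)) := by positivity
    calc √L + Q / √L ≤ 3 * √(H * N) + 2 / √γ * (Q * √(K / N)) := add_le_add b1 b2
      _ ≤ R := by rw [hR]; linarith
  have hall : ∀ k ∈ B, ∀ l ∈ B, ‖∑ q ∈ Finset.Ioc Q (4 * Q),
      expTwoPi (m * (((q * k : ℕ) : ℝ) ^ γ) - m * (((q * l : ℕ) : ℝ) ^ γ))‖ ≤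
      (if k = l then 3 * (Q : ℝ) else 0) + C * R := by
    intro k hk l hl
    have e : ∀ q : ℕ, (m * (((q * k : ℕ) : ℝ) ^ γ) - m * (((q * l : ℕ) : ℝ) ^ γ)) =
        (m * ((k : ℝ) ^ γ - (l : ℝ) ^ γ)) * (q : ℝ) ^ γ := by
      intro q
      push_cast
      rw [Real.mul_rpow (by positivity) (by positivity),
        Real.mul_rpow (by positivity) (by positivity)]
      ring
    simp only [e]
    rcases lt_trichotomy l k with hlk | hlk | hlk
    · rw [if_neg hlk.ne', zero_add]; exact key k hk l hl hlk
    · rw [if_pos hlk.symm]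
      have : ‖∑ q ∈ Finset.Ioc Q (4 * Q),
          expTwoPi ((m * ((k : ℝ) ^ γ - (l : ℝ) ^ γ)) * (q : ℝ) ^ γ)‖ ≤ 3 * Q := by
        calc _ ≤ ∑ q ∈ Finset.Ioc Q (4 * Q), (1 : ℝ) :=
              norm_sum_le_of_le _ fun _ _ => (norm_expTwoPi _).le
          _ = 3 * Q := by
              rw [Finset.sum_const, Nat.card_Ioc, nsmul_eq_mul, mul_one,
                show 4 * Q - Q = 3 * Q by omega]
              push_cast; ring
      have : 0 ≤ C * R := by positivity
      linarith
    · rw [if_neg hlk.ne, zero_add, ← norm_sum_expTwoPi_neg]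
      convert key l hl k hk hlk using 4
      ring
  refine (norm_sq_sum_sum_le A B _ hA _).trans ?_
  have hb : (0 : ℝ) ≤ B.card := by positivity
  calc _ ≤ A.card * ∑ k ∈ B, ∑ l ∈ B, ((if k = l then 3 * (Q : ℝ) else 0) + C * R) := by
        gcongr with k hk l hl
        exact hall k hk l hl
    _ = A.card * (B.card * (3 * Q + B.card * (C * R))) := by
        congr 1
        rw [Finset.sum_congr rfl (g := fun _ => 3 * Q + B.card * (C * R)), Finset.sum_const,
          nsmul_eq_mul]
        intro k hk
        rw [Finset.sum_add_distrib, Finset.sum_ite_eq, if_pos hk, Finset.sum_const, nsmul_eq_mul]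
    _ = (A.card * B.card) * (3 * Q + C * (3 + 2 / √γ) * (B.card * √(H * N) +
          B.card * Q * √(K / N))) := by rw [hR]; ring
    _ ≤ (A.card * B.card) * ((3 + C * (3 + 2 / √γ)) * (Q + B.card * √(H * N) +
          B.card * Q * √(K / N))) := by
        gcongr
        have e1 : 0 ≤ C * (3 + 2 / √γ) * Q := by positivity
        have e2 : 0 ≤ 3 * (B.card * √(H * N) + B.card * Q * √(K / N)) := by positivity
        linarith
    _ = _ := by ring

/-- Products `q * k` that are never of the form `⌊n ^ γ⁻¹⌋` are sparse. -/
theorem exists_card_mul_card_le {γ : ℝ} (h0 : 0 < γ) (h1 : γ < 1) :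
    ∃ C : ℝ, 0 < C ∧ ∀ Q K : ℕ, 1 ≤ Q → 1 ≤ K →
      ∀ A B : Finset ℕ, A ⊆ Finset.Ioc Q (4 * Q) → B ⊆ Finset.Ioc K (4 * K) →
      (∀ q ∈ A, ∀ k ∈ B, ∀ n : ℕ, 0 < n → (n : ℝ) ≤ ((q * k : ℕ) : ℝ) ^ γ + 1 →
        ⌊(n : ℝ) ^ γ⁻¹⌋ ≠ ((q * k : ℕ) : ℤ)) →
      (A.card * B.card : ℝ) ≤ C * ((Q * K : ℕ) : ℝ) ^ (2 - 2 * γ) *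
        (Q + B.card * √((Q * K : ℕ) : ℝ) + B.card * Q * √(K / ((Q * K : ℕ) : ℝ) ^ γ)) := by
  obtain ⟨C, hC, hS⟩ := exists_norm_sq_bilinear_le h0 h1
  set c := 128 / γ with hc
  have hc0 : 0 < c := by positivity
  refine ⟨144 * c ^ 2 * C * (1 + √c), by positivity, ?_⟩
  intro Q K hQ hK A B hA hB hno
  set X := ((Q * K : ℕ) : ℝ) with hX
  have hX1 : 1 ≤ X := by rw [hX]; exact_mod_cast Nat.mul_pos hQ hK
  have hX0 : 0 < X := by linarith
  set δ := γ / 64 * X ^ (γ - 1) with hδ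
  have hδ0 : 0 < δ := by positivity
  have hinv : 1 / δ = c / 2 * X ^ (1 - γ) := by
    have : X ^ (γ - 1) * X ^ (1 - γ) = 1 := by
      rw [← Real.rpow_add hX0]; simp
    rw [div_eq_iff hδ0.ne', hδ, hc]
    calc (1 : ℝ) = X ^ (γ - 1) * X ^ (1 - γ) := this.symm
      _ = _ := by field_simp; ring
  set H := ⌈1 / δ⌉₊ with hH
  have hpow1 : 1 ≤ X ^ (1 - γ) := Real.one_le_rpow hX1 (by linarith)
  have hHle : (H : ℝ) ≤ c * X ^ (1 - γ) := by
    have e1 := (Nat.ceil_lt_add_one (show 0 ≤ 1 / δ by positivity)).le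
    have e2 : 1 ≤ c / 2 * X ^ (1 - γ) := by
      have : 1 ≤ c / 2 := by rw [hc, le_div_iff₀ (by norm_num), le_div_iff₀ h0]; linarith
      nlinarith
    rw [hinv] at e1
    rw [hH, hinv]; linarith
  have hHδ : 1 ≤ H * δ := by
    rw [← div_le_iff₀ hδ0]; exact Nat.le_ceil _
  have haway : ∀ j ∈ A ×ˢ B, ∀ z : ℤ, δ ≤ |(((j.1 * j.2 : ℕ) : ℝ) ^ γ + δ) - z| := by
    intro j hj z
    obtain ⟨ha, hb⟩ := Finset.mem_product.1 hj
    have ha1 := Finset.mem_Ioc.1 (hA ha)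
    have hb1 := Finset.mem_Ioc.1 (hB hb)
    refine le_abs_sub_of_floor_ne h0 h1 (Nat.mul_pos (by omega) (by omega)) ?_
      (hno _ ha _ hb) z
    have e1 : ((j.1 * j.2 : ℕ) : ℝ) + 1 ≤ 32 * X := by
      have : j.1 * j.2 ≤ (4 * Q) * (4 * K) := Nat.mul_le_mul ha1.2 hb1.2
      have : ((j.1 * j.2 : ℕ) : ℝ) ≤ 16 * X := by
        rw [hX]; exact_mod_cast this.trans (by apply le_of_eq; ring)
      linarith
    have e2 : (32 : ℝ)⁻¹ ≤ (32 : ℝ) ^ (γ - 1) := by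
      rw [← Real.rpow_neg_one]
      exact Real.rpow_le_rpow_of_exponent_le (by norm_num) (by linarith)
    calc 2 * δ = γ * ((32 : ℝ)⁻¹ * X ^ (γ - 1)) := by rw [hδ]; ring
      _ ≤ γ * ((32 : ℝ) ^ (γ - 1) * X ^ (γ - 1)) := by gcongr
      _ = γ * (32 * X) ^ (γ - 1) := by rw [Real.mul_rpow (by norm_num) hX0.le]
      _ ≤ γ * (((j.1 * j.2 : ℕ) : ℝ) + 1) ^ (γ - 1) :=
          mul_le_mul_of_nonneg_left
            (Real.rpow_le_rpow_of_nonpos (by positivity) e1 (by linarith)) h0.le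
  have hdet := card_le_sum_norm_sum_expTwoPi (A ×ˢ B)
    (fun j => ((j.1 * j.2 : ℕ) : ℝ) ^ γ + δ) hδ0 hHδ haway
  rw [Finset.card_product, Nat.cast_mul] at hdet
  set P : ℝ := A.card * B.card with hP
  have hP0 : 0 ≤ P := by positivity
  set E := (Q : ℝ) + B.card * √X + B.card * Q * √(K / X ^ γ) with hE
  have hE0 : 0 ≤ E := by positivity
  have hbound : ∀ m ∈ Finset.Ico 1 (2 * H), ‖∑ j ∈ A ×ˢ B,
      expTwoPi (m * (((j.1 * j.2 : ℕ) : ℝ) ^ γ + δ))‖ ≤ √(C * P * ((1 + √c) * E)) := by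
    intro m hm
    have hm1 := Finset.mem_Ico.1 hm
    apply Real.le_sqrt_of_sq_le
    have e1 : ‖∑ j ∈ A ×ˢ B, expTwoPi (m * (((j.1 * j.2 : ℕ) : ℝ) ^ γ + δ))‖ =
        ‖∑ q ∈ A, ∑ k ∈ B, expTwoPi (m * (((q * k : ℕ) : ℝ) ^ γ))‖ := by
      simp only [mul_add, expTwoPi_add]
      rw [← Finset.sum_mul, norm_mul, norm_expTwoPi, mul_one, Finset.sum_product]
    rw [e1]
    refine (hS Q K H m hQ hK hm1.1 hm1.2.le A B hA hB).trans ?_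
    rw [← hX, ← hP]
    have e2 : √(H * X ^ γ) ≤ √c * √X := by
      rw [← Real.sqrt_mul hc0.le]
      apply Real.sqrt_le_sqrt
      calc H * X ^ γ ≤ c * X ^ (1 - γ) * X ^ γ := by gcongr
        _ = c * X := by rw [mul_assoc, ← Real.rpow_add hX0]; simp
    gcongr
    have f1 : B.card * √(H * X ^ γ) ≤ B.card * (√c * √X) := by gcongr
    have f2 : 0 ≤ √c * (Q + B.card * Q * √(K / X ^ γ)) := by positivity
    have f3 : 0 ≤ B.card * √X := by positivity
    rw [hE]; linarith
  have hfin : P ≤ 12 * H * √(C * P * ((1 + √c) * E)) := by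
    calc P ≤ 6 * ∑ m ∈ Finset.Ico 1 (2 * H), √(C * P * ((1 + √c) * E)) :=
          hdet.trans (by gcongr with m hm; exact hbound m hm)
      _ ≤ 6 * ((2 * H) * √(C * P * ((1 + √c) * E))) := by
          rw [Finset.sum_const, Nat.card_Ico, nsmul_eq_mul]
          gcongr
          exact_mod_cast Nat.sub_le _ _
      _ = _ := by ring
  rcases hP0.eq_or_lt with hz | hpos
  · rw [← hz]; positivity
  have hsq : P ^ 2 ≤ (12 * H) ^ 2 * (C * P * ((1 + √c) * E)) := by
    calc P ^ 2 ≤ (12 * H * √(C * P * ((1 + √c) * E))) ^ 2 := by gcongr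
      _ = _ := by rw [mul_pow, Real.sq_sqrt (by positivity)]
  have hle : P ≤ (12 * H) ^ 2 * (C * ((1 + √c) * E)) := by
    refine le_of_mul_le_mul_left ?_ hpos
    calc P * P = P ^ 2 := by ring
      _ ≤ _ := hsq
      _ = _ := by ring
  calc P ≤ (12 * H) ^ 2 * (C * ((1 + √c) * E)) := hle
    _ ≤ (12 * (c * X ^ (1 - γ))) ^ 2 * (C * ((1 + √c) * E)) := by gcongr
    _ = 144 * c ^ 2 * C * (1 + √c) * (X ^ (1 - γ)) ^ 2 * E := by ring
    _ = _ := by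
      rw [sq (X ^ (1 - γ)), ← Real.rpow_add hX0, show 1 - γ + (1 - γ) = 2 - 2 * γ by ring]

open Filter in
theorem eventually_const_mul_rpow_le_rpow (c : ℝ) {r s : ℝ} (h : r < s) :
    ∀ᶠ y : ℝ in atTop, c * y ^ r ≤ y ^ s := by
  filter_upwards [(tendsto_rpow_atTop (sub_pos.2 h)).eventually_ge_atTop c,
    eventually_gt_atTop 0] with y h1 h2
  calc c * y ^ r ≤ y ^ (s - r) * y ^ r := by gcongr
    _ = y ^ s := by rw [← Real.rpow_add h2]; simp

theorem half_le_natFloor {x : ℝ} (hx : 1 ≤ x) : x / 2 ≤ (⌊x⌋₊ : ℝ) := by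
  have h1 := Nat.lt_floor_add_one x
  have h2 : (1 : ℝ) ≤ ⌊x⌋₊ := by exact_mod_cast (Nat.one_le_floor_iff x).2 hx
  linarith

theorem half_mul_rpow_le_natFloor_rpow {y b η : ℝ} (hy : 1 ≤ y) (hb0 : 0 ≤ b) (hb1 : b ≤ 1)
    (hη : 0 ≤ η) (hη1 : η ≤ 1) : y ^ (b - η) / 2 ≤ (⌊y ^ b⌋₊ : ℝ) ^ (1 - η) := by
  have hy0 : 0 < y := by linarith
  have h1 : 1 ≤ y ^ b := Real.one_le_rpow hy hb0
  have h2 := half_le_natFloor h1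
  have h3 : (1 / 2 : ℝ) ≤ (1 / 2) ^ (1 - η) := by
    simpa using Real.rpow_le_rpow_of_exponent_ge (show (0 : ℝ) < 1 / 2 by norm_num)
      (by norm_num) (show 1 - η ≤ 1 by linarith)
  calc y ^ (b - η) / 2 = 1 / 2 * y ^ (b - η) := by ring
    _ ≤ (1 / 2) ^ (1 - η) * y ^ (b * (1 - η)) := by
        gcongr
        nlinarith
    _ = (y ^ b / 2) ^ (1 - η) := by
        rw [Real.rpow_mul hy0.le, ← Real.mul_rpow (by norm_num) (by positivity)]
        congr 1; ring
    _ ≤ _ := by gcongr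

set_option maxHeartbeats 1000000 in
open Filter in
theorem eventually_exists_floor_rpow_nonresidue {γ a θ : ℝ} (hγ0 : 7 / 8 < γ) (hγ1 : γ < 1)
    (ha0 : 5 / 2 - 2 * γ < a) (ha1 : a < 2 * γ - 1)
    (hθ0 : 1 / (4 * Real.sqrt (Real.exp 1)) < θ) (hθ1 : θ < 1 / 4) :
    ∃ p₀ : ℕ, ∀ p : ℕ, p₀ ≤ p → ∀ _ : Fact p.Prime, ∃ n : ℕ, 0 < n ∧
      (n : ℝ) ≤ 17 * (p : ℝ) ^ (θ / a * γ) ∧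
      quadraticChar (ZMod p) ((⌊(n : ℝ) ^ γ⁻¹⌋ : ℤ) : ZMod p) = -1 := by
  have hθpos : 0 < θ := lt_trans (by positivity) hθ0
  have ha : 1 / 2 < a := by linarith
  have haa : a < 1 := by linarith
  obtain ⟨η, hη0, hη⟩ : ∃ η : ℝ, 0 < η ∧ η < min ((2 * γ - 1 - a) / 4) ((a - (5 / 2 - 2 * γ)) / 4) :=
    exists_between (lt_min (by linarith) (by linarith))
  have hη2 : η < (2 * γ - 1 - a) / 4 := hη.trans_le (min_le_left _ _)
  have hη3 : η < (a - (5 / 2 - 2 * γ)) / 4 := hη.trans_le (min_le_right _ _)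
  obtain ⟨κ, hκ, p₁, hκp⟩ := exists_le_sum_prime_nonresidue_inv hθ0 hθ1
  obtain ⟨b₁, hb₁, hres⟩ := exists_le_card_residue hη0
  obtain ⟨a₁, ha₁, hnon⟩ := exists_le_card_nonresidue hη0 (by linarith)
  obtain ⟨C, hC, hmain⟩ := exists_card_mul_card_le (γ := γ) (by linarith) hγ1
  set α := a₁ * κ / 2 with hα
  set β := b₁ / 2 with hβ
  have hα0 : 0 < α := by positivity
  have hβ0 : 0 < β := by positivity
  have hev : ∀ᶠ y : ℝ in atTop, 17 ≤ y ∧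
      4 * C / (α * β) * y ^ (2 - 2 * γ + a) ≤ y ^ (1 - 2 * η) ∧
      4 * C / α * y ^ (5 / 2 - 2 * γ) ≤ y ^ (a - η) ∧
      8 * C / α * y ^ (2 - 2 * γ + a + (1 - a - γ) / 2) ≤ y ^ (a - η) :=
    (eventually_ge_atTop 17).and
      ((eventually_const_mul_rpow_le_rpow _ (by linarith)).and
      ((eventually_const_mul_rpow_le_rpow _ (by linarith)).and
      (eventually_const_mul_rpow_le_rpow _ (by linarith))))
  have htend : Tendsto (fun p : ℕ => (p : ℝ) ^ (θ / a)) atTop atTop :=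
    (tendsto_rpow_atTop (by positivity)).comp tendsto_natCast_atTop_atTop
  obtain ⟨p₂, hp₂⟩ := eventually_atTop.1 (htend.eventually hev)
  refine ⟨max p₁ (max p₂ 1), fun p hp hpf => ?_⟩
  have hp1 : (1 : ℝ) ≤ p := by exact_mod_cast (le_of_max_le_right (le_of_max_le_right hp))
  have hpp₁ : p₁ ≤ p := le_of_max_le_left hp
  have hpp₂ : p₂ ≤ p := le_of_max_le_left (le_of_max_le_right hp)
  obtain ⟨hY17, hT1, hT2, hT3⟩ := hp₂ p hpp₂
  have hYγ : (p : ℝ) ^ (θ / a * γ) = ((p : ℝ) ^ (θ / a)) ^ γ := Real.rpow_mul (by linarith) _ _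
  have hYa : (p : ℝ) ^ θ = ((p : ℝ) ^ (θ / a)) ^ a := by
    rw [← Real.rpow_mul (by linarith), div_mul_cancel₀ _ (by linarith)]
  have hYp : ((p : ℝ) ^ (θ / a)) ^ 2 ≤ p := by
    rw [← Real.rpow_natCast, ← Real.rpow_mul (by linarith)]
    have h1 : θ / a * (2 : ℕ) ≤ 1 := by
      rw [div_mul_eq_mul_div, div_le_one (by linarith)]; push_cast; linarith
    simpa using Real.rpow_le_rpow_of_exponent_le hp1 h1
  rw [hYγ]
  have hκ' := hκp p hpp₁ hpf
  rw [hYa] at hκ'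
  generalize (p : ℝ) ^ (θ / a) = Y at *
  have hY1 : 1 ≤ Y := by linarith
  have hY0 : 0 < Y := by linarith
  have hYp' : 4 * Y < p := by nlinarith
  set Q := ⌊Y ^ a⌋₊ with hQ
  set K := ⌊Y ^ (1 - a)⌋₊ with hK
  have hYa1 : 1 ≤ Y ^ a := Real.one_le_rpow hY1 (by linarith)
  have hYb1 : 1 ≤ Y ^ (1 - a) := Real.one_le_rpow hY1 (by linarith)
  have hYab : Y ^ a * Y ^ (1 - a) = Y := by
    rw [← Real.rpow_add hY0]; simp
  have hQle : (Q : ℝ) ≤ Y ^ a := Nat.floor_le (by linarith)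
  have hKle : (K : ℝ) ≤ Y ^ (1 - a) := Nat.floor_le (by linarith)
  have hQge : Y ^ a / 2 ≤ Q := half_le_natFloor hYa1
  have hKge : Y ^ (1 - a) / 2 ≤ K := half_le_natFloor hYb1
  have hQ1 : 1 ≤ Q := (Nat.one_le_floor_iff _).2 hYa1
  have hK1 : 1 ≤ K := (Nat.one_le_floor_iff _).2 hYb1
  have hQY : (Q : ℝ) ≤ Y := hQle.trans (by nlinarith)
  have hKY : (K : ℝ) ≤ Y := hKle.trans (by nlinarith)
  have hQp : 4 * Q < p := by
    have : (4 : ℝ) * Q < p := by linarith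
    exact_mod_cast this
  have hKp : 4 * (K : ℝ) < p := by linarith
  have hcA := hnon p hpf Q hQp κ hκ'
  have hcB := hres p hpf K (by exact_mod_cast hK1) hKp
  rw [Nat.floor_natCast, show (4 * (K : ℝ)) = ((4 * K : ℕ) : ℝ) by push_cast; ring,
    Nat.floor_natCast] at hcB
  set A := (Finset.Ioc Q (4 * Q)).filter fun k : ℕ => quadraticChar (ZMod p) (k : ZMod p) = -1
    with hA
  set B := (Finset.Ioc K (4 * K)).filter fun k : ℕ => quadraticChar (ZMod p) (k : ZMod p) = 1
    with hB
  have hAge : α * Y ^ (a - η) ≤ A.card := by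
    refine le_trans ?_ hcA
    have := half_mul_rpow_le_natFloor_rpow hY1 (show 0 ≤ a by linarith) haa.le hη0.le
      (show η ≤ 1 by linarith)
    calc α * Y ^ (a - η) = a₁ * κ * (Y ^ (a - η) / 2) := by rw [hα]; ring
      _ ≤ _ := by gcongr
  have hBge : β * Y ^ (1 - a - η) ≤ B.card := by
    refine le_trans ?_ hcB
    have := half_mul_rpow_le_natFloor_rpow hY1 (show 0 ≤ 1 - a by linarith)
      (show 1 - a ≤ 1 by linarith) hη0.le (show η ≤ 1 by linarith)
    calc β * Y ^ (1 - a - η) = b₁ * (Y ^ (1 - a - η) / 2) := by rw [hβ]; ring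
      _ ≤ _ := by gcongr
  by_contra hcon
  push Not at hcon
  have hno : ∀ q ∈ A, ∀ k ∈ B, ∀ n : ℕ, 0 < n → (n : ℝ) ≤ ((q * k : ℕ) : ℝ) ^ γ + 1 →
      ⌊(n : ℝ) ^ γ⁻¹⌋ ≠ ((q * k : ℕ) : ℤ) := by
    intro q hq k hk n hn hnle heq
    obtain ⟨hq1, hq2⟩ := Finset.mem_filter.1 hq
    obtain ⟨hk1, hk2⟩ := Finset.mem_filter.1 hk
    have hq4 : (q : ℝ) ≤ 4 * Y ^ a := by
      have : (q : ℝ) ≤ 4 * Q := by exact_mod_cast (Finset.mem_Ioc.1 hq1).2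
      linarith
    have hk4 : (k : ℝ) ≤ 4 * Y ^ (1 - a) := by
      have : (k : ℝ) ≤ 4 * K := by exact_mod_cast (Finset.mem_Ioc.1 hk1).2
      linarith
    have hqk : ((q * k : ℕ) : ℝ) ≤ 16 * Y := by
      push_cast
      calc (q : ℝ) * k ≤ (4 * Y ^ a) * (4 * Y ^ (1 - a)) := by gcongr
        _ = 16 * (Y ^ a * Y ^ (1 - a)) := by ring
        _ = 16 * Y := by rw [hYab]
    have h16 : (16 : ℝ) ^ γ ≤ 16 := by
      simpa using Real.rpow_le_rpow_of_exponent_le (show (1 : ℝ) ≤ 16 by norm_num) hγ1.le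
    refine hcon n hn ?_ ?_
    · calc (n : ℝ) ≤ ((q * k : ℕ) : ℝ) ^ γ + 1 := hnle
        _ ≤ (16 * Y) ^ γ + 1 := by gcongr
        _ = (16 : ℝ) ^ γ * Y ^ γ + 1 := by rw [Real.mul_rpow (by norm_num) hY0.le]
        _ ≤ 16 * Y ^ γ + Y ^ γ := by
            gcongr
            exact Real.one_le_rpow hY1 (by linarith)
        _ = _ := by ring
    · rw [heq]
      push_cast
      rw [map_mul, hq2, hk2, mul_one]
  have hfin := hmain Q K hQ1 hK1 A B (Finset.filter_subset _ _) (Finset.filter_subset _ _) hno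
  set X := ((Q * K : ℕ) : ℝ) with hX
  have hXQK : X = Q * K := by rw [hX]; push_cast; rfl
  have hXle : X ≤ Y := by
    calc X ≤ Y ^ a * Y ^ (1 - a) := by rw [hXQK]; gcongr
      _ = Y := hYab
  have hXge : Y / 4 ≤ X := by
    calc Y / 4 = (Y ^ a / 2) * (Y ^ (1 - a) / 2) := by linear_combination - hYab / 4
      _ ≤ X := by rw [hXQK]; gcongr
  have hX0 : 0 < X := by linarith
  have hsqrt : √(K / X ^ γ) ≤ 2 * Y ^ ((1 - a - γ) / 2) := by
    apply Real.sqrt_le_iff.2 ⟨by positivity, ?_⟩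
    have e1 : Y ^ γ / 4 ≤ X ^ γ := by
      have e2 : (1 / 4 : ℝ) ≤ (1 / 4) ^ γ := by
        simpa using Real.rpow_le_rpow_of_exponent_ge (show (0 : ℝ) < 1 / 4 by norm_num)
          (by norm_num) hγ1.le
      calc Y ^ γ / 4 = 1 / 4 * Y ^ γ := by ring
        _ ≤ (1 / 4) ^ γ * Y ^ γ := by gcongr
        _ = (1 / 4 * Y) ^ γ := by rw [Real.mul_rpow (by norm_num) hY0.le]
        _ ≤ X ^ γ := by gcongr; linarith
    calc (K : ℝ) / X ^ γ ≤ Y ^ (1 - a) / (Y ^ γ / 4) := by gcongr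
      _ = 4 * Y ^ (1 - a - γ) := by rw [Real.rpow_sub hY0 (1 - a)]; field_simp
      _ = (2 * Y ^ ((1 - a - γ) / 2)) ^ 2 := by
          rw [mul_pow, sq (Y ^ _), ← Real.rpow_add hY0]; norm_num
  have hub : (A.card * B.card : ℝ) ≤ C * Y ^ (2 - 2 * γ) * (Y ^ a + B.card * Y ^ (1 / 2 : ℝ) +
      B.card * Y ^ a * (2 * Y ^ ((1 - a - γ) / 2))) := by
    refine hfin.trans ?_
    rw [Real.sqrt_eq_rpow X]
    gcongr
    linarith
  have hB0 : 0 < (B.card : ℝ) := lt_of_lt_of_le (by positivity) hBge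
  have hA0 : 0 < (A.card : ℝ) := lt_of_lt_of_le (by positivity) hAge
  have u1 : C * Y ^ (2 - 2 * γ) * Y ^ a ≤ A.card * B.card / 4 := by
    have e : Y ^ (1 - 2 * η) = Y ^ (a - η) * Y ^ (1 - a - η) := by
      rw [← Real.rpow_add hY0]; congr 1; ring
    rw [e, div_mul_eq_mul_div, div_le_iff₀ (by positivity), Real.rpow_add hY0] at hT1
    have := mul_le_mul hAge hBge (by positivity) hA0.le
    linarith
  have u2 : C * Y ^ (2 - 2 * γ) * Y ^ (1 / 2 : ℝ) ≤ A.card / 4 := by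
    have e : Y ^ (5 / 2 - 2 * γ) = Y ^ (2 - 2 * γ) * Y ^ (1 / 2 : ℝ) := by
      rw [← Real.rpow_add hY0]; congr 1; ring
    rw [e, div_mul_eq_mul_div, div_le_iff₀ (by positivity)] at hT2
    linarith
  have u3 : C * Y ^ (2 - 2 * γ) * (Y ^ a * (2 * Y ^ ((1 - a - γ) / 2))) ≤ A.card / 4 := by
    rw [div_mul_eq_mul_div, div_le_iff₀ (by positivity), Real.rpow_add hY0,
      Real.rpow_add hY0] at hT3
    linarith
  have v2 := mul_le_mul_of_nonneg_left u2 hB0.le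
  have v3 := mul_le_mul_of_nonneg_left u3 hB0.le
  have hAB : 0 < (A.card * B.card : ℝ) := mul_pos hA0 hB0
  have hexpand : C * Y ^ (2 - 2 * γ) * (Y ^ a + B.card * Y ^ (1 / 2 : ℝ) +
      B.card * Y ^ a * (2 * Y ^ ((1 - a - γ) / 2))) = C * Y ^ (2 - 2 * γ) * Y ^ a +
      B.card * (C * Y ^ (2 - 2 * γ) * Y ^ (1 / 2 : ℝ)) +
      B.card * (C * Y ^ (2 - 2 * γ) * (Y ^ a * (2 * Y ^ ((1 - a - γ) / 2)))) := by ring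
  linarith

/-- Let 1 < c < 8/7 be fixed. For every ε > 0, for all sufficiently large primes p,
there is a positive integer n ≤ p^{1/(4(2−c)√e) + ε} with ⌊n^c⌋ a quadratic
non-residue modulo p. -/
theorem least_nonresidue_piatetski_shapiro
    (c : ℝ) (hc1 : 1 < c) (hc2 : c < 8 / 7) (ε : ℝ) (hε : 0 < ε) :
    ∃ p₀ : ℕ, ∀ p : ℕ, p₀ ≤ p → ∀ hp : p.Prime,
      ∃ n : ℕ, 0 < n ∧
        (n : ℝ) ≤ (p : ℝ) ^ (1 / (4 * (2 - c) * Real.sqrt (Real.exp 1)) + ε) ∧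
        @legendreSym p ⟨hp⟩ ⌊(n : ℝ) ^ c⌋ = -1 := by
  have hc0 : 0 < c := by linarith
  set θ₀ := 1 / (4 * Real.sqrt (Real.exp 1)) with hθ₀
  have hθ₀0 : 0 < θ₀ := by positivity
  have hθ₀1 : θ₀ < 1 / 4 := by
    have h1 : 1 < Real.sqrt (Real.exp 1) := by
      rw [Real.lt_sqrt zero_le_one]; simp
    rw [hθ₀]
    exact one_div_lt_one_div_of_lt (by norm_num) (by linarith)
  have hν : 1 / (4 * (2 - c) * Real.sqrt (Real.exp 1)) = θ₀ / (2 - c) := by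
    rw [hθ₀, div_div]; congr 1; ring
  rw [hν]
  set ν := θ₀ / (2 - c) + ε with hνε
  have h2c : 0 < 2 - c := by linarith
  have hν0 : 0 < ν := by positivity
  have hθν : θ₀ < (2 - c) * ν := by
    have : (2 - c) * ν = θ₀ + (2 - c) * ε := by rw [hνε]; field_simp
    have : 0 < (2 - c) * ε := by positivity
    linarith
  obtain ⟨θ, h1, h2⟩ := exists_between (lt_min hθ₀1 hθν)
  have h3 : θ < 1 / 4 := h2.trans_le (min_le_left _ _)
  have h4 : θ < (2 - c) * ν := h2.trans_le (min_le_right _ _)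
  set γ := c⁻¹ with hγ
  have hγc : γ * c = 1 := inv_mul_cancel₀ hc0.ne'
  have hγ0 : 7 / 8 < γ := by nlinarith
  have hγ1 : γ < 1 := inv_lt_one_of_one_lt₀ hc1
  have hlt : θ * γ / ν < 2 * γ - 1 := by
    rw [div_lt_iff₀ hν0]
    have : (2 * γ - 1) * ν = γ * ((2 - c) * ν) := by linear_combination ν * hγc
    nlinarith
  obtain ⟨a, ha, ha1⟩ := exists_between (max_lt (show 5 / 2 - 2 * γ < 2 * γ - 1 by linarith) hlt)
  have ha0 : 5 / 2 - 2 * γ < a := (le_max_left _ _).trans_lt ha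
  have ha2 : θ * γ / ν < a := (le_max_right _ _).trans_lt ha
  have hapos : 0 < a := by linarith
  have hexp : θ / a * γ < ν := by
    rw [div_lt_iff₀ hν0] at ha2
    rw [div_mul_eq_mul_div, div_lt_iff₀ hapos]; linarith
  obtain ⟨p₁, hp₁⟩ := eventually_exists_floor_rpow_nonresidue hγ0 hγ1 ha0 ha1 h1 h3
  obtain ⟨p₂, hp₂⟩ := Filter.eventually_atTop.1 (tendsto_natCast_atTop_atTop.eventually
    (eventually_const_mul_rpow_le_rpow 17 hexp) : ∀ᶠ p : ℕ in Filter.atTop, _)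
  refine ⟨max p₁ p₂, fun p hp hpp => ?_⟩
  obtain ⟨n, hn0, hn1, hn2⟩ := hp₁ p (le_of_max_le_left hp) ⟨hpp⟩
  refine ⟨n, hn0, hn1.trans (hp₂ p (le_of_max_le_right hp)), ?_⟩
  rw [hγ, inv_inv] at hn2
  exact hn2
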